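/- Let u be a smooth solution of (−Δ)^{3/2}u = 2e^{3u} with finite volume, and suppose u is not a spherical solution (i.e. there are no λ > 0, x₀ ∈ ℝ³ with u(x) = log(2λ/(1+λ²|x−x₀|²))). Then there exists a constant a > 0 such that Δu(x) → −a as |x| → ∞. -/

import Mathlib

open MeasureTheory Real Filter

noncomputable section

abbrev E3 := EuclideanSpace ℝ (Fin 3)

/-- The Laplacian of `f : ℝ³ → ℝ` as the sum of second partial derivatives. -/
def lap (f : E3 → ℝ) (x : E3) : ℝ :=
  ∑ i, fderiv ℝ (fun y => fderiv ℝ f y (EuclideanSpace.single i 1)) x (EuclideanSpace.single i 1)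

/-- The half Laplacian `(-Δ)^{1/2} φ` of a Schwartz function on ℝ³, defined as a
principal value: `(1/π²) lim_{ε→0⁺} ∫_{|x−y|>ε} (φ(x)−φ(y))/|x−y|⁴ dy`. -/
def halfLap (φ : SchwartzMap E3 ℝ) (x : E3) : ℝ :=
  limUnder (nhdsWithin (0:ℝ) (Set.Ioi 0)) fun ε =>
    (1 / π ^ 2) * ∫ y in {y : E3 | ε < ‖x - y‖}, (φ x - φ y) / ‖x - y‖ ^ 4

/-- `w ∈ L_{1/2}(ℝ³)`. -/
def MemL12 (w : E3 → ℝ) : Prop :=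
  LocallyIntegrable w volume ∧ Integrable (fun x => |w x| / (1 + ‖x‖ ^ 4)) volume

/-- `u` is a smooth solution of `(-Δ)^{3/2} u = 2 e^{3u}` in ℝ³ with finite volume. -/
def IsSolution (u : E3 → ℝ) : Prop :=
  ContDiff ℝ (⊤ : ℕ∞) u ∧ MemL12 (lap u) ∧ Integrable (fun x => exp (3 * u x)) volume ∧
    ∀ φ : SchwartzMap E3 ℝ,
      ∫ x, (-(lap u x)) * halfLap φ x = 2 * ∫ x, exp (3 * u x) * φ x

/-- `u` is a spherical solution. -/
def IsSpherical (u : E3 → ℝ) : Prop :=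
  ∃ lam : ℝ, 0 < lam ∧ ∃ x₀ : E3, ∀ x, u x = log (2 * lam / (1 + lam ^ 2 * ‖x - x₀‖ ^ 2))

/-- `α = (1/π²) ∫ e^{3u}`. -/
def solAlpha (u : E3 → ℝ) : ℝ := (1 / π ^ 2) * ∫ y, exp (3 * u y)

/-- `v(x) = (1/π²) ∫ log(|y|/|x−y|) e^{3u(y)} dy`. -/
def solV (u : E3 → ℝ) (x : E3) : ℝ :=
  (1 / π ^ 2) * ∫ y, log (‖y‖ / ‖x - y‖) * exp (3 * u y)

end

open scoped Topology

theorem Ioi_ftc {F f : ℝ → ℝ} {A B : ℝ} (hd : ∀ x ∈ Set.Ioi (0:ℝ), HasDerivAt F (f x) x)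
    (hi : IntegrableOn f (Set.Ioi 0)) (h0 : Tendsto F (𝓝[>] 0) (𝓝 A))
    (h1 : Tendsto F atTop (𝓝 B)) : ∫ x in Set.Ioi (0:ℝ), f x = B - A := by
  have key := integral_Ioi_of_hasDerivAt_of_tendsto (f := Function.update F 0 A) (f' := f) (a := 0)
    (m := B) ?_ ?_ hi ?_
  · simpa using key
  · rw [continuousWithinAt_update_same]
    refine h0.mono_left (nhdsWithin_mono _ ?_)
    intro x hx
    exact lt_of_le_of_ne hx.1 (Ne.symm hx.2)
  · intro x hx
    refine (hd x hx).congr_of_eventuallyEq ?_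
    filter_upwards [isOpen_Ioi.mem_nhds hx] with y hy
    exact Function.update_of_ne (ne_of_gt hy) _ _
  · refine h1.congr' ?_
    filter_upwards [eventually_gt_atTop 0] with y hy
    exact (Function.update_of_ne (ne_of_gt hy) _ _).symm

theorem Ioi_ftc_nonneg {F f : ℝ → ℝ} {A B : ℝ}
    (hd : ∀ x ∈ Set.Ioi (0:ℝ), HasDerivAt F (f x) x)
    (hf : ∀ x ∈ Set.Ioi (0:ℝ), 0 ≤ f x) (h0 : Tendsto F (𝓝[>] 0) (𝓝 A))
    (h1 : Tendsto F atTop (𝓝 B)) :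
    IntegrableOn f (Set.Ioi 0) ∧ ∫ x in Set.Ioi (0:ℝ), f x = B - A := by
  have hi : IntegrableOn f (Set.Ioi 0) := by
    refine integrableOn_Ioi_deriv_of_nonneg (g := Function.update F 0 A) (l := B) ?_ ?_ hf ?_
    · rw [continuousWithinAt_update_same]
      refine h0.mono_left (nhdsWithin_mono _ ?_)
      intro x hx
      exact lt_of_le_of_ne hx.1 (Ne.symm hx.2)
    · intro x hx
      refine (hd x hx).congr_of_eventuallyEq ?_
      filter_upwards [isOpen_Ioi.mem_nhds hx] with y hy
      exact Function.update_of_ne (ne_of_gt hy) _ _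
    · refine h1.congr' ?_
      filter_upwards [eventually_gt_atTop 0] with y hy
      exact (Function.update_of_ne (ne_of_gt hy) _ _).symm
  exact ⟨hi, Ioi_ftc hd hi h0 h1⟩

/-- Passing to `τ = a² + b²` in a planar integral. -/
theorem planar_integral (F : ℝ → ℝ) :
    ∫ q : ℝ × ℝ, F (q.1 ^ 2 + q.2 ^ 2) = π * ∫ τ in Set.Ioi (0:ℝ), F τ := by
  have h1 : ∫ q : ℝ × ℝ, F (q.1 ^ 2 + q.2 ^ 2) = ∫ z : ℂ, F (‖z‖ ^ 2) := by
    rw [← Complex.volume_preserving_equiv_real_prod.integral_comp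
      Complex.measurableEquivRealProd.measurableEmbedding]
    refine integral_congr_ae (Eventually.of_forall fun z => ?_)
    simp only [Complex.measurableEquivRealProd_apply]
    rw [Complex.sq_norm, Complex.normSq_apply]; ring_nf
  rw [h1, integral_fun_norm_addHaar (volume : Measure ℂ) (fun r => F (r ^ 2))]
  have h2 := integral_comp_rpow_Ioi F (p := 2) (by norm_num)
  rw [← h2]
  simp only [Complex.finrank_real_complex, Measure.real, Complex.volume_ball]
  simp only [smul_eq_mul, nsmul_eq_mul]
  rw [← integral_const_mul, ← integral_const_mul, ← integral_const_mul]
  refine setIntegral_congr_fun measurableSet_Ioi fun r hr => ?_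
  norm_num
  ring

theorem planar_integrable {F : ℝ → ℝ} (hF : IntegrableOn F (Set.Ioi 0)) :
    Integrable (fun q : ℝ × ℝ => F (q.1 ^ 2 + q.2 ^ 2)) := by
  rw [← Complex.volume_preserving_equiv_real_prod.integrable_comp_emb
      Complex.measurableEquivRealProd.measurableEmbedding]
  have h1 : ((fun q : ℝ × ℝ => F (q.1 ^ 2 + q.2 ^ 2)) ∘ Complex.measurableEquivRealProd)
      = fun z : ℂ => F (‖z‖ ^ 2) := by
    funext z
    simp only [Function.comp, Complex.measurableEquivRealProd_apply]
    rw [Complex.sq_norm, Complex.normSq_apply]; ring_nf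
  rw [h1, integrable_fun_norm_addHaar (volume : Measure ℂ) (f := fun r => F (r ^ 2))]
  have h2 := (integrableOn_Ioi_comp_rpow_iff' F (p := 2) (by norm_num)).2 hF
  refine h2.congr_fun (fun r _ => ?_) measurableSet_Ioi
  norm_num

/-- The heat kernel of `ℝ³` up to normalisation, as a function of time and squared distance. -/
noncomputable def heatK (s n : ℝ) : ℝ := (√s)⁻¹ ^ 3 * exp (-n / (4 * s))

/-- The time derivative of `heatK`, with opposite sign. -/
noncomputable def heatJ (s n : ℝ) : ℝ := (3 / (2 * s) - n / (4 * s ^ 2)) * heatK s n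

theorem hasDerivAt_heatK {s : ℝ} (hs : 0 < s) (n : ℝ) :
    HasDerivAt (fun s => heatK s n) (-heatJ s n) s := by
  have h1 : HasDerivAt (fun s : ℝ => √s) (1 / (2 * √s)) s := Real.hasDerivAt_sqrt hs.ne'
  have hq : √s ≠ 0 := (Real.sqrt_pos.2 hs).ne'
  have h2 := (h1.inv hq).pow 3
  have h3 : HasDerivAt (fun s : ℝ => -n / (4 * s)) (n / (4 * s ^ 2)) s := by
    have := ((hasDerivAt_id s).const_mul (4:ℝ)).inv (by simpa using hs.ne')
    have := this.const_mul (-n)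
    refine (this.congr_deriv ?_).congr_of_eventuallyEq (Eventually.of_forall fun y => ?_)
    · simp; field_simp
    · simp [div_eq_mul_inv]
  refine (h2.mul h3.exp).congr_deriv ?_
  have hss : √s ^ 2 = s := Real.sq_sqrt hs.le
  have hs4 : s ^ 2 = √s ^ 4 := by rw [← hss]; ring_nf; simp [hs.le]
  unfold heatJ heatK
  generalize exp (-n / (4 * s)) = e
  simp only [Pi.inv_apply, Pi.pow_apply]
  rw [hs4, show 3 / (2 * s) = 3 / (2 * √s ^ 2) by rw [hss]]
  generalize √s = q at *
  rw [show -((3 / (2 * q ^ 2) - n / (4 * q ^ 4)) * (q⁻¹ ^ 3 * e)) = -((3 / (2 * q ^ 2) - n / (4 * q ^ 4)) * (e / q ^ 3)) by rw [inv_pow]; ring]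
  simp only [inv_pow]
  field_simp
  ring

theorem one_add_pow_le_exp {t : ℝ} (ht : 0 ≤ t) : (1 + t) ^ 5 ≤ 245760 * exp (t / 4) := by
  have h := Real.pow_div_factorial_le_exp ((1 + t) / 4) (by positivity) 5
  have h2 : exp ((1 + t) / 4) ≤ 2 * exp (t / 4) := by
    rw [show (1 + t) / 4 = 1 / 4 + t / 4 by ring, Real.exp_add]
    have : exp (1 / 4) ≤ 2 := by
      have := Real.exp_one_lt_d9
      have h3 : exp (1/4) ^ 4 = exp 1 := by rw [← Real.exp_nat_mul]; norm_num
      by_contra hc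
      push Not at hc
      have : (2:ℝ) ^ 4 < exp (1/4) ^ 4 := pow_lt_pow_left₀ hc (by norm_num) (by norm_num)
      linarith
    gcongr
  have h5 : ((5).factorial : ℝ) = 120 := by norm_num [Nat.factorial]
  rw [h5, div_pow] at h
  have := h.trans h2
  rw [div_div, div_le_iff₀ (by norm_num)] at this
  nlinarith

theorem one_add_pow_mul_gaussian_le {p : ℝ} (hp : 0 < p) (N : ℕ) {r : ℝ} (hr : 0 ≤ r) :
    (1 + r) ^ N * exp (-p * r ^ 2) ≤ N.factorial * exp (1 + 1 / (4 * p)) := by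
  have h := Real.pow_div_factorial_le_exp (1 + r) (by positivity) N
  rw [div_le_iff₀ (by positivity)] at h
  calc (1 + r) ^ N * exp (-p * r ^ 2) ≤ (exp (1 + r) * N.factorial) * exp (-p * r ^ 2) := by gcongr
    _ = N.factorial * exp (1 + r + -p * r ^ 2) := by rw [Real.exp_add (1 + r)]; ring
    _ ≤ _ := by
      gcongr ?_ * exp ?_
      have : 0 ≤ (2 * p * r - 1) ^ 2 / (4 * p) := by positivity
      have h2 : (2 * p * r - 1) ^ 2 / (4 * p) = p * r ^ 2 - r + 1 / (4 * p) := by field_simp; ring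
      linarith

theorem gaussian_decay {p : ℝ} (hp : 0 < p) (k n : ℕ) :
    ∃ C, ∀ x : E3, ‖x‖ ^ k * ‖iteratedFDeriv ℝ n (fun y => exp (-p * ‖y‖ ^ 2)) x‖ ≤ C := by
  have htg : (fun y : E3 => -p * ‖y‖ ^ 2).HasTemperateGrowth :=
    (Function.HasTemperateGrowth.const (-p)).mul (Function.hasTemperateGrowth_norm_sq E3)
  obtain ⟨m, C, hC, hb⟩ := htg.norm_iteratedFDeriv_le_uniform n
  refine ⟨n.factorial * (C + 1) ^ n *
    ((k + m * n).factorial * exp (1 + 1 / (4 * p))), fun x => ?_⟩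
  have h1 : ‖iteratedFDeriv ℝ n (exp ∘ fun y : E3 => -p * ‖y‖ ^ 2) x‖ ≤
      n.factorial * exp (-p * ‖x‖ ^ 2) * ((C + 1) * (1 + ‖x‖) ^ m) ^ n := by
    refine norm_iteratedFDeriv_comp_le (N := (⊤ : ℕ∞)) Real.contDiff_exp htg.1
      (by exact_mod_cast le_top) x ?_ ?_
    · intro i _
      rw [norm_iteratedFDeriv_eq_norm_iteratedDeriv, iteratedDeriv_eq_iterate, Real.iter_deriv_exp,
        Real.norm_of_nonneg (exp_nonneg _)]
    · intro i hi hin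
      have h1 : (1:ℝ) ≤ (C + 1) * (1 + ‖x‖) ^ m := by
        have : (1:ℝ) ≤ (1 + ‖x‖) ^ m := one_le_pow₀ (by linarith [norm_nonneg x])
        nlinarith
      calc _ ≤ C * (1 + ‖x‖) ^ m := hb i hin x
        _ ≤ (C + 1) * (1 + ‖x‖) ^ m := by gcongr; linarith
        _ ≤ _ := le_self_pow₀ h1 (by omega)
  have h2 := one_add_pow_mul_gaussian_le hp (k + m * n) (norm_nonneg x)
  calc ‖x‖ ^ k * ‖iteratedFDeriv ℝ n (fun y : E3 => exp (-p * ‖y‖ ^ 2)) x‖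
      ≤ (1 + ‖x‖) ^ k *
        (n.factorial * exp (-p * ‖x‖ ^ 2) * ((C + 1) * (1 + ‖x‖) ^ m) ^ n) := by
        gcongr
        · linarith
        · exact h1
    _ = n.factorial * (C + 1) ^ n * ((1 + ‖x‖) ^ (k + m * n) * exp (-p * ‖x‖ ^ 2)) := by
        rw [mul_pow, pow_add, pow_mul]; ring
    _ ≤ _ := by gcongr

/-- The heat kernel at time `s` centred at `x`, as a Schwartz function. -/
noncomputable def heatSchwartz (s : ℝ) (hs : 0 < s) (x : E3) : SchwartzMap E3 ℝ :=
  SchwartzMap.compSubConstCLM ℝ x ((√s)⁻¹ ^ 3 •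
    (⟨fun y => exp (-(1 / (4 * s)) * ‖y‖ ^ 2),
      (contDiff_const.mul (contDiff_norm_sq ℝ)).exp,
      gaussian_decay (by positivity)⟩ : SchwartzMap E3 ℝ))

theorem heatSchwartz_apply (s : ℝ) (hs : 0 < s) (x y : E3) :
    heatSchwartz s hs x y = heatK s (‖x - y‖ ^ 2) := by
  simp only [heatSchwartz, SchwartzMap.compSubConstCLM_apply, heatK, norm_sub_rev x y]
  change (√s)⁻¹ ^ 3 * exp (-(1 / (4 * s)) * ‖y - x‖ ^ 2) = _
  congr 2; ring

theorem finrank_E3 : Module.finrank ℝ E3 = 3 := by simp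

theorem integrable_radial {f : ℝ → ℝ} (h : IntegrableOn (fun r => r ^ 2 * f r) (Set.Ioi 0)) :
    Integrable (fun z : E3 => f ‖z‖) := by
  rw [integrable_fun_norm_addHaar (volume : Measure E3) (f := f)]
  simpa using h

theorem integral_radial (f : ℝ → ℝ) :
    ∫ z : E3, f ‖z‖ = 4 * π * ∫ r in Set.Ioi (0:ℝ), r ^ 2 * f r := by
  rw [integral_fun_norm_addHaar (volume : Measure E3) f]
  simp only [finrank_E3, Measure.real, EuclideanSpace.volume_ball_fin_three]
  norm_num
  rw [ENNReal.toReal_ofReal (by positivity)]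
  ring

theorem integrable_inv_sq_mul : Integrable (fun z : E3 => 1 / (‖z‖ ^ 2 * (1 + ‖z‖ ^ 2))) := by
  refine integrable_radial (f := fun r => 1 / (r ^ 2 * (1 + r ^ 2))) ?_
  refine (integrable_inv_one_add_sq.integrableOn (s := Set.Ioi 0)).congr_fun (fun r hr => ?_)
    measurableSet_Ioi
  have : r ≠ 0 := ne_of_gt hr
  simp only
  field_simp

theorem gaussian_convolution {p q : ℝ} (hp : 0 < p) (hq : 0 < q) (v : E3) :
    ∫ z : E3, exp (-q * ‖z‖ ^ 2) * exp (-p * ‖v - z‖ ^ 2) =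
      (π / (p + q)) ^ ((3:ℝ) / 2) * exp (-(p * q / (p + q)) * ‖v‖ ^ 2) := by
  have h : ∀ z : E3, exp (-q * ‖z‖ ^ 2) * exp (-p * ‖v - z‖ ^ 2) =
      exp (-(p * q / (p + q)) * ‖v‖ ^ 2) * exp (-(p + q) * ‖z - (p / (p + q)) • v‖ ^ 2) := by
    intro z
    rw [← Real.exp_add, ← Real.exp_add, norm_sub_sq_real v z, norm_sub_sq_real z,
      norm_smul, inner_smul_right, real_inner_comm z v, Real.norm_of_nonneg (by positivity)]
    congr 1
    field_simp
    ring
  simp_rw [h]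
  rw [integral_const_mul,
    integral_sub_right_eq_self (fun z : E3 => exp (-(p + q) * ‖z‖ ^ 2)),
    GaussianFourier.integral_rexp_neg_mul_sq_norm (by positivity)]
  rw [finrank_E3]
  norm_num
  ring

theorem gaussian_convolution_integrable {p q : ℝ} (hp : 0 < p) (hq : 0 < q) (v : E3) :
    Integrable fun z : E3 => exp (-q * ‖z‖ ^ 2) * exp (-p * ‖v - z‖ ^ 2) := by
  by_contra h
  have := gaussian_convolution hp hq v
  rw [integral_undef h] at this
  have h2 : 0 < (π / (p + q)) ^ ((3:ℝ) / 2) * exp (-(p * q / (p + q)) * ‖v‖ ^ 2) := by positivity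
  linarith

theorem gaussian_integrable {q : ℝ} (hq : 0 < q) :
    Integrable fun z : E3 => exp (-q * ‖z‖ ^ 2) := by
  by_contra h
  have := GaussianFourier.integral_rexp_neg_mul_sq_norm (V := E3) hq
  rw [integral_undef h] at this
  have h2 : 0 < (π / q) ^ ((Module.finrank ℝ E3 : ℝ) / 2) := by positivity
  linarith

theorem rpow_three_halves {a : ℝ} (ha : 0 ≤ a) : a ^ ((3:ℝ) / 2) = √a ^ 3 := by
  rw [Real.sqrt_eq_rpow, ← Real.rpow_natCast, ← Real.rpow_mul ha]; norm_num

theorem heatK_semigroup {s b : ℝ} (hs : 0 < s) (hb : 0 < b) (v : E3) :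
    ∫ z : E3, exp (-‖z‖ ^ 2 / (4 * b ^ 2)) * heatK s (‖v - z‖ ^ 2) =
      8 * √π ^ 3 * b ^ 3 * heatK (s + b ^ 2) (‖v‖ ^ 2) := by
  have h := gaussian_convolution (p := 1 / (4 * s)) (q := 1 / (4 * b ^ 2)) (by positivity)
    (by positivity) v
  have h1 : ∀ z : E3, exp (-‖z‖ ^ 2 / (4 * b ^ 2)) * heatK s (‖v - z‖ ^ 2) =
      (√s)⁻¹ ^ 3 *
        (exp (-(1 / (4 * b ^ 2)) * ‖z‖ ^ 2) * exp (-(1 / (4 * s)) * ‖v - z‖ ^ 2)) := by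
    intro z
    rw [heatK, mul_left_comm]
    congr 3 <;> ring
  simp_rw [h1]
  rw [integral_const_mul, h, rpow_three_halves (by positivity), heatK, ← mul_assoc, ← mul_assoc]
  congr 1
  · rw [← mul_pow, show (8 : ℝ) * √π ^ 3 * b ^ 3 * (√(s + b ^ 2))⁻¹ ^ 3 =
      (2 * √π * b * (√(s + b ^ 2))⁻¹) ^ 3 by ring]
    congr 1
    have : π / (1 / (4 * s) + 1 / (4 * b ^ 2)) = 2 ^ 2 * π * b ^ 2 * s / (s + b ^ 2) := by
      field_simp; ring
    rw [this, Real.sqrt_div (by positivity), Real.sqrt_mul (by positivity),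
      Real.sqrt_mul (by positivity), Real.sqrt_mul (by positivity), Real.sqrt_sq hb.le,
      Real.sqrt_sq (by norm_num)]
    have : 0 < √s := Real.sqrt_pos.2 hs
    field_simp
  · congr 1
    field_simp
    ring

theorem sqrt_pow_mul_exp_le {t : ℝ} (ht : 0 ≤ t) {k : ℕ} (hk : k ≤ 10) :
    √(1 + t) ^ k * exp (-t / 4) ≤ 245760 := by
  have h1 : (1:ℝ) ≤ √(1 + t) := by rw [Real.one_le_sqrt]; linarith
  have h2 : √(1 + t) ^ k ≤ (1 + t) ^ 5 := by
    calc √(1 + t) ^ k ≤ √(1 + t) ^ 10 := pow_le_pow_right₀ h1 hk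
      _ = (√(1 + t) ^ 2) ^ 5 := by ring
      _ = _ := by rw [Real.sq_sqrt (by linarith)]
  have h3 := one_add_pow_le_exp ht
  calc √(1 + t) ^ k * exp (-t / 4) ≤ (245760 * exp (t / 4)) * exp (-t / 4) := by
        gcongr; exact h2.trans h3
    _ = 245760 * exp (t / 4 + -t / 4) := by rw [Real.exp_add]; ring
    _ = _ := by rw [show t / 4 + -t / 4 = 0 by ring]; simp

theorem heatK_nonneg (s n : ℝ) : 0 ≤ heatK s n := by unfold heatK; positivity

theorem one_add_mul_heatK_le {s n : ℝ} (hs : 0 < s) (hn : 0 ≤ n) {j : ℕ} (hj : j ≤ 2) :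
    (1 + n / s) * (s⁻¹ ^ j * heatK s n) ≤ 245760 * (√(s + n))⁻¹ ^ (3 + 2 * j) := by
  have hq : 0 < √s := Real.sqrt_pos.2 hs
  have hss : √s ^ 2 = s := Real.sq_sqrt hs.le
  have ht : 0 ≤ n / s := by positivity
  have h1 : √(s + n) = √s * √(1 + n / s) := by
    rw [← Real.sqrt_mul hs.le]; congr 1; field_simp
  have h2 := sqrt_pow_mul_exp_le ht (k := 5 + 2 * j) (by omega)
  have h3 : 0 < √(1 + n / s) := Real.sqrt_pos.2 (by positivity)
  rw [h1, inv_pow (√s * _), ← div_eq_mul_inv, le_div_iff₀ (by positivity), heatK]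
  calc _ = (√(1 + n / s) ^ 2) * √(1 + n / s) ^ (3 + 2 * j) * exp (-n / (4 * s)) *
        ((s⁻¹ ^ j * (√s) ^ (2 * j)) * ((√s)⁻¹ ^ 3 * √s ^ 3)) := by
          rw [Real.sq_sqrt (by positivity)]; ring
    _ = √(1 + n / s) ^ (5 + 2 * j) * exp (-(n / s) / 4) := by
      rw [pow_mul (√s), hss, ← mul_pow, ← mul_pow, inv_mul_cancel₀ hs.ne', inv_mul_cancel₀ hq.ne']
      rw [show -n / (4 * s) = -(n / s) / 4 by field_simp]
      ring
    _ ≤ _ := h2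

theorem heatK_le {s n : ℝ} (hs : 0 < s) (hn : 0 ≤ n) :
    heatK s n ≤ 245760 * (√(s + n))⁻¹ ^ 3 := by
  have h := one_add_mul_heatK_le hs hn (j := 0) (by norm_num)
  have h1 := heatK_nonneg s n
  have : 0 ≤ n / s := by positivity
  simp only [pow_zero, one_mul, mul_zero, add_zero] at h
  nlinarith

theorem abs_heatJ_le {s n : ℝ} (hs : 0 < s) (hn : 0 ≤ n) :
    |heatJ s n| ≤ 368640 * (√(s + n))⁻¹ ^ 5 := by
  have h := one_add_mul_heatK_le hs hn (j := 1) (by norm_num)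
  have h1 := heatK_nonneg s n
  have ht : 0 ≤ n / s := by positivity
  rw [heatJ, show 3 / (2 * s) - n / (4 * s ^ 2) = (3 / 2 - n / s / 4) * s⁻¹ by field_simp,
    abs_mul, abs_mul, abs_of_nonneg h1, abs_of_nonneg (inv_nonneg.2 hs.le)]
  have h2 : |3 / 2 - n / s / 4| ≤ 3 / 2 * (1 + n / s) := by rw [abs_le]; constructor <;> linarith
  calc _ ≤ 3 / 2 * (1 + n / s) * s⁻¹ * heatK s n := by gcongr
    _ = 3 / 2 * ((1 + n / s) * (s⁻¹ ^ 1 * heatK s n)) := by ring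
    _ ≤ 3 / 2 * (245760 * (√(s + n))⁻¹ ^ (3 + 2 * 1)) := by gcongr
    _ = _ := by ring

theorem hasDerivAt_heatJ_right {s : ℝ} (hs : 0 < s) (n : ℝ) :
    HasDerivAt (fun n => heatJ s n)
      ((-1 / 4 - (3 / 2 - n / s / 4) / 4) * (s⁻¹ ^ 2 * heatK s n)) n := by
  have h1 : HasDerivAt (fun n : ℝ => -n / (4 * s)) (-1 / (4 * s)) n :=
    (hasDerivAt_id n).neg.div_const _
  have h2 := ((((hasDerivAt_id n).div_const (4 * s ^ 2)).const_sub (3 / (2 * s))).mul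
    (h1.exp.const_mul ((√s)⁻¹ ^ 3)))
  refine h2.congr_deriv ?_
  simp only [heatK, id]
  generalize exp (-n / (4 * s)) = e
  generalize √s = q
  field_simp
  ring

theorem heatJ_sub_le {s m n n' : ℝ} (hs : 0 < s) (hm : 0 ≤ m) (hn : m ≤ n) (hn' : m ≤ n') :
    |heatJ s n - heatJ s n'| ≤ 245760 * (√(s + m))⁻¹ ^ 7 * |n - n'| := by
  refine (convex_Ici m).norm_image_sub_le_of_norm_hasDerivWithin_le
    (fun x _ => (hasDerivAt_heatJ_right hs x).hasDerivWithinAt) (fun x hx => ?_) hn' hn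
  have hx' : m ≤ x := hx
  have h := one_add_mul_heatK_le hs (hm.trans hx) (j := 2) (by norm_num)
  have ht : 0 ≤ x / s := div_nonneg (hm.trans hx) hs.le
  have h1 : 0 ≤ s⁻¹ ^ 2 * heatK s x := mul_nonneg (by positivity) (heatK_nonneg _ _)
  rw [norm_mul, Real.norm_of_nonneg h1]
  have h2 : ‖(-1 / 4 - (3 / 2 - x / s / 4) / 4 : ℝ)‖ ≤ 1 + x / s := by
    rw [Real.norm_eq_abs, abs_le]; constructor <;> linarith
  have h3 : 0 < √(s + m) := Real.sqrt_pos.2 (by linarith)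
  calc _ ≤ (1 + x / s) * (s⁻¹ ^ 2 * heatK s x) := by gcongr
    _ ≤ _ := h
    _ ≤ _ := by gcongr

theorem schwartz_taylor (φ : SchwartzMap E3 ℝ) :
    ∃ C, 0 ≤ C ∧ ∀ y z : E3, |φ (y + z) - φ y - fderiv ℝ φ y z| ≤ C * ‖z‖ ^ 2 := by
  obtain ⟨C, hC0, hC⟩ := (SchwartzMap.fderivCLM ℝ E3 ℝ φ).decay 0 1
  have hL : ∀ y w : E3, ‖fderiv ℝ φ w - fderiv ℝ φ y‖ ≤ C * ‖w - y‖ := by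
    intro y w
    have := (convex_univ (𝕜 := ℝ) (E := E3)).norm_image_sub_le_of_norm_fderiv_le
      (f := SchwartzMap.fderivCLM ℝ E3 ℝ φ) (C := C)
      (fun x _ => (SchwartzMap.differentiable _).differentiableAt) (fun x _ => by
        have := hC x
        rwa [pow_zero, one_mul, norm_iteratedFDeriv_one] at this) (Set.mem_univ y) (Set.mem_univ w)
    simpa using this
  refine ⟨C, hC0.le, fun y z => ?_⟩
  have := (convex_closedBall y ‖z‖).norm_image_sub_le_of_norm_fderiv_le' (𝕜 := ℝ)
    (f := φ) (φ := fderiv ℝ φ y) (C := C * ‖z‖) (x := y) (y := y + z)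
    (fun x _ => φ.differentiableAt) (fun x hx => (hL y x).trans ?_) (by simp) (by simp)
  · rw [add_sub_cancel_left] at this
    rw [Real.norm_eq_abs] at this
    linarith
  · have : ‖x - y‖ ≤ ‖z‖ := by simpa [dist_eq_norm] using hx
    gcongr

theorem schwartz_second_difference (φ : SchwartzMap E3 ℝ) :
    ∃ C, 0 ≤ C ∧ ∀ y z : E3, |2 * φ y - φ (y - z) - φ (y + z)| ≤ C * ‖z‖ ^ 2 ∧
      |2 * φ y - φ (y - z) - φ (y + z)| ≤ C := by
  obtain ⟨C, hC0, hC⟩ := schwartz_taylor φ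
  obtain ⟨B, hB0, hB⟩ := φ.decay 0 0
  have hB' : ∀ x, |φ x| ≤ B := fun x => by simpa using hB x
  refine ⟨max (2 * C) (4 * B), by positivity, fun y z => ⟨?_, ?_⟩⟩
  · have h1 := hC y z
    have h2 := hC y (-z)
    rw [norm_neg, map_neg, ← sub_eq_add_neg] at h2
    have h3 := le_max_left (2 * C) (4 * B)
    have h4 : 2 * C * ‖z‖ ^ 2 ≤ max (2 * C) (4 * B) * ‖z‖ ^ 2 := by gcongr
    rw [abs_le] at *
    constructor <;> linarith [h1.1, h1.2, h2.1, h2.2]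
  · have h1 := hB' y
    have h2 := hB' (y - z)
    have h3 := hB' (y + z)
    have h4 := le_max_right (2 * C) (4 * B)
    rw [abs_le] at *
    constructor <;> linarith [h1.1, h1.2, h2.1, h2.2, h3.1, h3.2]

theorem second_difference_integrable (φ : SchwartzMap E3 ℝ) (y : E3) :
    Integrable fun z : E3 => (2 * φ y - φ (y - z) - φ (y + z)) / ‖z‖ ^ 4 := by
  obtain ⟨C, hC0, hC⟩ := schwartz_second_difference φ
  refine (integrable_inv_sq_mul.const_mul (2 * C)).mono' ?_ ?_
  · have hc : Continuous φ := φ.continuous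
    refine Measurable.aestronglyMeasurable ?_
    refine Measurable.div ?_ (by fun_prop)
    exact Continuous.measurable (by fun_prop)
  · filter_upwards [Measure.ae_ne volume (0 : E3)] with z hz
    have h : 0 < ‖z‖ := norm_pos_iff.2 hz
    obtain ⟨h1, h2⟩ := hC y z
    rw [norm_div, Real.norm_of_nonneg (by positivity : 0 ≤ ‖z‖ ^ 4), Real.norm_eq_abs,
      ← mul_div_assoc, div_le_div_iff₀ (by positivity) (by positivity)]
    have h3 : |2 * φ y - φ (y - z) - φ (y + z)| * (1 + ‖z‖ ^ 2) ≤ 2 * C * ‖z‖ ^ 2 := by nlinarith [sq_nonneg ‖z‖]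
    calc _ = (|2 * φ y - φ (y - z) - φ (y + z)| * (1 + ‖z‖ ^ 2)) * ‖z‖ ^ 2 := by ring
      _ ≤ (2 * C * ‖z‖ ^ 2) * ‖z‖ ^ 2 := by gcongr
      _ = _ := by ring

theorem truncated_integrable (φ : SchwartzMap E3 ℝ) (y : E3) {ε : ℝ} (hε : 0 < ε)
    (g : E3 → E3) (hg : Continuous g) :
    IntegrableOn (fun z : E3 => (φ y - φ (g z)) / ‖z‖ ^ 4) {z | ε < ‖z‖} := by
  obtain ⟨B, hB0, hB⟩ := φ.decay 0 0
  have hB' : ∀ x, |φ x| ≤ B := fun x => by simpa using hB x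
  have hm : MeasurableSet {z : E3 | ε < ‖z‖} := measurableSet_lt measurable_const measurable_norm
  refine (integrable_inv_sq_mul.const_mul (2 * B * (1 + (ε ^ 2)⁻¹))).integrableOn.mono' ?_ ?_
  · have hc : Continuous φ := φ.continuous
    refine Measurable.aestronglyMeasurable ?_
    refine Measurable.div ?_ (by fun_prop)
    exact Continuous.measurable (by fun_prop)
  · filter_upwards [ae_restrict_mem hm] with z hz
    have hz' : ε < ‖z‖ := hz
    have h : 0 < ‖z‖ := hε.trans hz
    rw [norm_div, Real.norm_of_nonneg (by positivity : 0 ≤ ‖z‖ ^ 4), Real.norm_eq_abs,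
      ← mul_div_assoc, div_le_div_iff₀ (by positivity) (by positivity)]
    have h1 : |φ y - φ (g z)| ≤ 2 * B := by
      have h1 := hB' y
      have h2 := hB' (g z)
      rw [abs_le] at *
      constructor <;> linarith [h1.1, h1.2, h2.1, h2.2]
    have h2 : 1 + ‖z‖ ^ 2 ≤ (1 + (ε ^ 2)⁻¹) * ‖z‖ ^ 2 := by
      have : 1 ≤ (ε ^ 2)⁻¹ * ‖z‖ ^ 2 := by
        rw [inv_mul_eq_div, le_div_iff₀ (by positivity), one_mul]; gcongr
      linarith
    calc |φ y - φ (g z)| * (‖z‖ ^ 2 * (1 + ‖z‖ ^ 2))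
        ≤ 2 * B * (‖z‖ ^ 2 * ((1 + (ε ^ 2)⁻¹) * ‖z‖ ^ 2)) := by gcongr
      _ = _ := by ring

theorem halfLap_eq (φ : SchwartzMap E3 ℝ) (y : E3) :
    halfLap φ y =
      1 / (2 * π ^ 2) * ∫ z : E3, (2 * φ y - φ (y - z) - φ (y + z)) / ‖z‖ ^ 4 := by
  have hS : ∀ ε : ℝ, MeasurableSet {z : E3 | ε < ‖z‖} := fun ε =>
    measurableSet_lt measurable_const measurable_norm
  have key : ∀ ε : ℝ, 0 < ε →
      ∫ w in {w : E3 | ε < ‖y - w‖}, (φ y - φ w) / ‖y - w‖ ^ 4 =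
      1 / 2 * ∫ z in {z : E3 | ε < ‖z‖}, (2 * φ y - φ (y - z) - φ (y + z)) / ‖z‖ ^ 4 := by
    intro ε hε
    have e1 : ∫ w in {w : E3 | ε < ‖y - w‖}, (φ y - φ w) / ‖y - w‖ ^ 4 =
        ∫ z in {z : E3 | ε < ‖z‖}, (φ y - φ (y - z)) / ‖z‖ ^ 4 := by
      rw [← integral_indicator (hS ε), ← integral_indicator (by
        exact measurableSet_lt measurable_const (by fun_prop))]
      rw [← integral_sub_left_eq_self _ volume y]
      congr 1; ext w
      simp [Set.indicator]
    have e2 : ∫ z in {z : E3 | ε < ‖z‖}, (φ y - φ (y - z)) / ‖z‖ ^ 4 =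
        ∫ z in {z : E3 | ε < ‖z‖}, (φ y - φ (y + z)) / ‖z‖ ^ 4 := by
      rw [← integral_indicator (hS ε), ← integral_indicator (hS ε)]
      rw [← integral_neg_eq_self]
      congr 1; ext w
      simp [Set.indicator]
    have e3 : ∫ z in {z : E3 | ε < ‖z‖}, (2 * φ y - φ (y - z) - φ (y + z)) / ‖z‖ ^ 4 =
        (∫ z in {z : E3 | ε < ‖z‖}, (φ y - φ (y - z)) / ‖z‖ ^ 4) +
        ∫ z in {z : E3 | ε < ‖z‖}, (φ y - φ (y + z)) / ‖z‖ ^ 4 := by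
      rw [← integral_add (truncated_integrable φ y hε _ (by fun_prop))
        (truncated_integrable φ y hε _ (by fun_prop))]
      congr 1; ext z; ring
    rw [e1, e3, ← e2]; ring
  refine Tendsto.limUnder_eq ?_
  have hI := second_difference_integrable φ y
  have lim : Tendsto (fun ε : ℝ => ∫ z in {z : E3 | ε < ‖z‖},
      (2 * φ y - φ (y - z) - φ (y + z)) / ‖z‖ ^ 4) (𝓝[>] 0)
      (𝓝 (∫ z : E3, (2 * φ y - φ (y - z) - φ (y + z)) / ‖z‖ ^ 4)) := by
    simp_rw [← fun ε => integral_indicator (hS ε)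
      (f := fun z => (2 * φ y - φ (y - z) - φ (y + z)) / ‖z‖ ^ 4) (μ := volume)]
    refine tendsto_integral_filter_of_dominated_convergence
      (fun z => ‖(2 * φ y - φ (y - z) - φ (y + z)) / ‖z‖ ^ 4‖) ?_ ?_ hI.norm ?_
    · exact Eventually.of_forall fun ε => hI.1.indicator (hS ε)
    · exact Eventually.of_forall fun ε => Eventually.of_forall fun z =>
        norm_indicator_le_norm_self _ _
    · filter_upwards [Measure.ae_ne volume (0 : E3)] with z hz
      have h : 0 < ‖z‖ := norm_pos_iff.2 hz
      refine tendsto_const_nhds.congr' ?_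
      filter_upwards [mem_nhdsWithin_of_mem_nhds (isOpen_Iio.mem_nhds h)] with ε hε
      rw [Set.indicator_of_mem]
      exact hε
  have lim2 := lim.const_mul (1 / (2 * π ^ 2))
  refine lim2.congr' ?_
  filter_upwards [self_mem_nhdsWithin] with ε hε
  rw [key ε hε]
  ring

theorem tendsto_one_add_mul_exp_neg_atTop :
    Tendsto (fun t : ℝ => (1 + t) * exp (-t)) atTop (𝓝 0) := by
  have h0 := Real.tendsto_pow_mul_exp_neg_atTop_nhds_zero 0
  have h1 := Real.tendsto_pow_mul_exp_neg_atTop_nhds_zero 1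
  have := h0.add h1
  simp only [pow_zero, pow_one, one_mul, add_zero] at this
  exact this.congr fun t => by ring

theorem subordination {n : ℝ} (hn : 0 < n) :
    IntegrableOn (fun b : ℝ => exp (-n / (4 * b ^ 2)) / (8 * b ^ 5)) (Set.Ioi 0) ∧
    ∫ b in Set.Ioi (0:ℝ), exp (-n / (4 * b ^ 2)) / (8 * b ^ 5) = 1 / n ^ 2 := by
  have h := Ioi_ftc_nonneg (F := fun b : ℝ => 1 / n ^ 2 *
      ((1 + n / (4 * b ^ 2)) * exp (-(n / (4 * b ^ 2)))))
    (f := fun b : ℝ => exp (-n / (4 * b ^ 2)) / (8 * b ^ 5)) (A := 1 / n ^ 2 * 0)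
    (B := 1 / n ^ 2 * ((1 + 0) * exp (-0))) ?_ ?_ ?_ ?_
  · simpa using h
  · intro b hb
    have hb0 : b ≠ 0 := ne_of_gt hb
    have h1 : HasDerivAt (fun b : ℝ => n / (4 * b ^ 2)) (-n / (2 * b ^ 3)) b := by
      have := (((hasDerivAt_pow 2 b).const_mul 4).inv (by positivity)).const_mul n
      refine (this.congr_deriv ?_).congr_of_eventuallyEq (Eventually.of_forall fun y => ?_)
      · simp; field_simp; ring
      · simp [div_eq_mul_inv]
    refine ((((h1.const_add 1).mul h1.neg.exp)).const_mul (1 / n ^ 2)).congr_deriv ?_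
    rw [show -n / (4 * b ^ 2) = -(n / (4 * b ^ 2)) by ring]
    generalize exp (-(n / (4 * b ^ 2))) = e
    field_simp
    ring
  · intro b hb
    have hb0 : 0 < b := hb
    positivity
  · refine (tendsto_one_add_mul_exp_neg_atTop.comp (g := fun t : ℝ => (1 + t) * exp (-t)) (f := fun b : ℝ => n / (4 * b ^ 2)) ?_).const_mul _
    have : Tendsto (fun b : ℝ => n / 4 * (b⁻¹) ^ 2) (𝓝[>] 0) atTop :=
      ((tendsto_pow_atTop two_ne_zero).comp tendsto_inv_nhdsGT_zero).const_mul_atTop (by positivity)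
    refine this.congr fun b => ?_
    rw [inv_pow]; ring
  · have h0 : Tendsto (fun b : ℝ => n / (4 * b ^ 2)) atTop (𝓝 0) :=
      Tendsto.const_div_atTop ((tendsto_pow_atTop two_ne_zero).const_mul_atTop (by norm_num)) n
    refine Tendsto.const_mul _ (Tendsto.mul (h0.const_add 1) ?_)
    exact (Real.continuous_exp.tendsto _).comp h0.neg

theorem hasDerivAt_heatK_comp {s : ℝ} (hs : 0 < s) (n b : ℝ) :
    HasDerivAt (fun b => heatK (s + b ^ 2) n) (-heatJ (s + b ^ 2) n * (2 * b)) b := by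
  have h1 : HasDerivAt (fun b : ℝ => s + b ^ 2) (2 * b) b := by
    simpa using (hasDerivAt_pow 2 b).const_add s
  exact (hasDerivAt_heatK (by positivity : 0 < s + b ^ 2) n).comp b h1

theorem continuous_heatJ_comp {s : ℝ} (hs : 0 < s) (n : ℝ) :
    Continuous (fun b : ℝ => heatJ (s + b ^ 2) n) := by
  unfold heatJ heatK
  have h : ∀ b : ℝ, s + b ^ 2 ≠ 0 := fun b => by positivity
  have h2 : ∀ b : ℝ, √(s + b ^ 2) ≠ 0 := fun b => (Real.sqrt_pos.2 (by positivity)).ne'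
  have h3 : ∀ b : ℝ, 4 * (s + b ^ 2) ≠ 0 := fun b => by positivity
  have h4 : ∀ b : ℝ, 2 * (s + b ^ 2) ≠ 0 := fun b => by positivity
  have h5 : ∀ b : ℝ, 4 * (s + b ^ 2) ^ 2 ≠ 0 := fun b => by positivity
  fun_prop (disch := assumption)

theorem integrable_inv_add_sq {s : ℝ} (hs : 0 < s) : Integrable fun b : ℝ => (s + b ^ 2)⁻¹ := by
  refine (integrable_inv_one_add_sq.const_mul (1 + s⁻¹)).mono' ?_ (Eventually.of_forall fun b => ?_)
  · exact (Continuous.inv₀ (by fun_prop) fun b => by positivity).aestronglyMeasurable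
  · rw [Real.norm_of_nonneg (by positivity), ← div_eq_mul_inv, inv_eq_one_div,
      div_le_div_iff₀ (by positivity) (by positivity)]
    have : s⁻¹ * s = 1 := inv_mul_cancel₀ hs.ne'
    have h2 : 0 ≤ s⁻¹ * b ^ 2 := by positivity
    nlinarith

theorem sqrt_inv_pow_le {s n : ℝ} (hs : 0 < s) (hn : 0 ≤ n) (k : ℕ) :
    (√(s + n))⁻¹ ^ (k + 2) ≤ (√s)⁻¹ ^ k * (s + n)⁻¹ := by
  have hq : 0 < √s := Real.sqrt_pos.2 hs
  have hq2 : 0 < √(s + n) := Real.sqrt_pos.2 (by positivity)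
  rw [pow_add, inv_pow (√(s + n)) 2, Real.sq_sqrt (by positivity)]
  gcongr
  linarith

theorem integrable_heatJ_comp {s n : ℝ} (hs : 0 < s) (hn : 0 ≤ n) :
    Integrable (fun b : ℝ => heatJ (s + b ^ 2) n) := by
  refine ((integrable_inv_add_sq hs).const_mul (368640 * (√s)⁻¹ ^ 3)).mono'
    (continuous_heatJ_comp hs n).aestronglyMeasurable (Eventually.of_forall fun b => ?_)
  have hq : 0 < √s := Real.sqrt_pos.2 hs
  have hq' : 0 < √(s + b ^ 2) := Real.sqrt_pos.2 (by positivity)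
  calc |heatJ (s + b ^ 2) n| ≤ 368640 * (√(s + b ^ 2 + n))⁻¹ ^ 5 := abs_heatJ_le (by positivity) hn
    _ ≤ 368640 * (√(s + b ^ 2))⁻¹ ^ (3 + 2) := by gcongr 368640 * (√?_)⁻¹ ^ 5; linarith
    _ ≤ 368640 * ((√s)⁻¹ ^ 3 * (s + b ^ 2)⁻¹) := by
      gcongr; exact sqrt_inv_pow_le hs (sq_nonneg b) 3
    _ = _ := by ring

theorem integral_heatK_diff {s n : ℝ} (hs : 0 < s) (hn : 0 ≤ n)
    (hi : IntegrableOn (fun b : ℝ => (heatK s n - heatK (s + b ^ 2) n) / b ^ 2) (Set.Ioi 0)) :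
    ∫ b in Set.Ioi (0:ℝ), (heatK s n - heatK (s + b ^ 2) n) / b ^ 2 =
      ∫ b : ℝ, heatJ (s + b ^ 2) n := by
  have h1 : ∫ b : ℝ, heatJ (s + b ^ 2) n = 2 * ∫ b in Set.Ioi (0:ℝ), heatJ (s + b ^ 2) n := by
    have := integral_comp_abs (f := fun b : ℝ => heatJ (s + b ^ 2) n)
    simpa using this
  have hj : IntegrableOn (fun b : ℝ => 2 * heatJ (s + b ^ 2) n) (Set.Ioi 0) :=
    ((integrable_heatJ_comp hs hn).const_mul 2).integrableOn
  rw [h1, ← integral_const_mul, ← sub_eq_zero, ← integral_sub hi hj]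
  have := Ioi_ftc (F := fun b : ℝ => -(b⁻¹ * (heatK s n - heatK (s + b ^ 2) n))) (A := 0) (B := 0)
    (f := fun b : ℝ => (heatK s n - heatK (s + b ^ 2) n) / b ^ 2 - 2 * heatJ (s + b ^ 2) n)
    ?_ (hi.sub hj) ?_ ?_
  · simpa using this
  · intro b hb
    have hb0 : b ≠ 0 := ne_of_gt hb
    refine ((hasDerivAt_inv hb0).mul
      ((hasDerivAt_heatK_comp hs n b).const_sub (heatK s n))).neg.congr_deriv ?_
    field_simp
    ring
  · have := (hasDerivAt_iff_tendsto_slope.1 (hasDerivAt_heatK_comp hs n 0)).mono_left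
      (nhdsWithin_mono _ (fun x (hx : x ∈ Set.Ioi (0:ℝ)) => (ne_of_gt hx)))
    simp only [mul_zero] at this
    refine this.congr fun b => ?_
    simp [slope]
    ring
  · rw [← neg_zero]
    refine Tendsto.neg ?_
    have hM : ∀ b : ℝ, heatK (s + b ^ 2) n ≤ 245760 * (√s)⁻¹ ^ 3 := fun b => by
      have hq : 0 < √s := Real.sqrt_pos.2 hs
      refine (heatK_le (by positivity) hn).trans ?_
      gcongr 245760 * (√?_)⁻¹ ^ 3
      nlinarith [sq_nonneg b]
    have hM0 := hM 0
    simp only [ne_eq, OfNat.ofNat_ne_zero, not_false_eq_true, zero_pow, add_zero] at hM0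
    refine squeeze_zero_norm' (a := fun b : ℝ => b⁻¹ * (245760 * (√s)⁻¹ ^ 3)) ?_ ?_
    · filter_upwards [eventually_gt_atTop 0] with b hb
      rw [norm_mul, Real.norm_of_nonneg (inv_nonneg.2 hb.le), Real.norm_eq_abs]
      gcongr
      rw [abs_le]
      have h1 := hM b
      have h2 := heatK_nonneg s n
      have h3 := heatK_nonneg (s + b ^ 2) n
      constructor <;> linarith
    · simpa only [zero_mul] using
        (tendsto_inv_atTop_zero (𝕜 := ℝ)).mul_const (245760 * (√s)⁻¹ ^ 3)

theorem integral_gaussian_three {b : ℝ} (hb : 0 < b) :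
    ∫ z : E3, exp (-‖z‖ ^ 2 / (4 * b ^ 2)) = 8 * √π ^ 3 * b ^ 3 := by
  have h : ∀ z : E3, exp (-‖z‖ ^ 2 / (4 * b ^ 2)) = exp (-(1 / (4 * b ^ 2)) * ‖z‖ ^ 2) :=
    fun z => by congr 1; ring
  simp_rw [h]
  rw [GaussianFourier.integral_rexp_neg_mul_sq_norm (by positivity), finrank_E3]
  push_cast
  rw [rpow_three_halves (by positivity), show π / (1 / (4 * b ^ 2)) = 2 ^ 2 * π * b ^ 2 by
    field_simp; ring, Real.sqrt_mul (by positivity), Real.sqrt_mul (by positivity),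
    Real.sqrt_sq hb.le, Real.sqrt_sq (by norm_num)]
  ring

theorem gaussian_mul_heatK_integrable {s b : ℝ} (hs : 0 < s) (hb : 0 < b) (v : E3) :
    Integrable fun z : E3 => exp (-‖z‖ ^ 2 / (4 * b ^ 2)) * heatK s (‖v - z‖ ^ 2) := by
  refine ((gaussian_convolution_integrable (p := 1 / (4 * s)) (q := 1 / (4 * b ^ 2))
    (by positivity) (by positivity) v).const_mul ((√s)⁻¹ ^ 3)).congr
      (Eventually.of_forall fun z => ?_)
  symm
  simp only [heatK]
  rw [mul_left_comm]
  congr 3 <;> ring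

theorem halfLap_heat {s : ℝ} (hs : 0 < s) (x y : E3) :
    halfLap (heatSchwartz s hs x) y = 1 / √π * ∫ b : ℝ, heatJ (s + b ^ 2) (‖x - y‖ ^ 2) := by
  set φ := heatSchwartz s hs x with hφ
  set v := x - y with hv
  set D : E3 → ℝ := fun z => 2 * φ y - φ (y - z) - φ (y + z) with hD
  have hDc : Continuous D := by
    have hc : Continuous φ := φ.continuous
    simp only [hD]; fun_prop
  have hDi : Integrable fun z : E3 => D z / ‖z‖ ^ 4 := second_difference_integrable φ y
  have hDv : ∀ z, D z = 2 * heatK s (‖v‖ ^ 2) - heatK s (‖v - -z‖ ^ 2) - heatK s (‖v - z‖ ^ 2) := by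
    intro z
    simp only [hD, hφ, heatSchwartz_apply, hv]
    rw [show x - (y - z) = x - y - -z by abel, show x - (y + z) = x - y - z by abel]
  have hz0 : ∀ᵐ z : E3, 0 < ‖z‖ ^ 2 := by
    filter_upwards [Measure.ae_ne volume (0 : E3)] with z hz
    have h : 0 < ‖z‖ := norm_pos_iff.2 hz
    positivity
  have hFub : Integrable (Function.uncurry fun (z : E3) (b : ℝ) =>
      D z * (exp (-‖z‖ ^ 2 / (4 * b ^ 2)) / (8 * b ^ 5)))
      ((volume : Measure E3).prod (volume.restrict (Set.Ioi (0:ℝ)))) := by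
    rw [integrable_prod_iff]
    · constructor
      · filter_upwards [hz0] with z hz
        exact (subordination hz).1.const_mul (D z)
      · refine hDi.norm.congr ?_
        filter_upwards [hz0] with z hz
        simp only [Function.uncurry]
        have : ∫ b in Set.Ioi (0:ℝ), ‖D z * (exp (-‖z‖ ^ 2 / (4 * b ^ 2)) / (8 * b ^ 5))‖ =
            ∫ b in Set.Ioi (0:ℝ), ‖D z‖ * (exp (-‖z‖ ^ 2 / (4 * b ^ 2)) / (8 * b ^ 5)) := by
          refine setIntegral_congr_fun measurableSet_Ioi fun b hb => ?_
          have hb0 : 0 < b := hb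
          rw [norm_mul, Real.norm_of_nonneg (by positivity : 0 ≤ exp (-‖z‖ ^ 2 / (4 * b ^ 2)) / (8 * b ^ 5))]
        rw [this, integral_const_mul, (subordination hz).2, norm_div,
          Real.norm_of_nonneg (by positivity : 0 ≤ ‖z‖ ^ 4)]
        ring
    · refine Measurable.aestronglyMeasurable ?_
      have := hDc.measurable
      fun_prop
  have hb : ∀ b : ℝ, 0 < b →
      ∫ z : E3, D z * (exp (-‖z‖ ^ 2 / (4 * b ^ 2)) / (8 * b ^ 5)) =
      2 * √π ^ 3 * ((heatK s (‖v‖ ^ 2) - heatK (s + b ^ 2) (‖v‖ ^ 2)) / b ^ 2) := by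
    intro b hb
    have i1 := gaussian_mul_heatK_integrable hs hb v
    have i2 := i1.comp_neg
    have i0 : Integrable fun z : E3 => exp (-‖z‖ ^ 2 / (4 * b ^ 2)) := by
      by_contra h
      have h2 := integral_gaussian_three hb
      rw [integral_undef h] at h2
      have : 0 < 8 * √π ^ 3 * b ^ 3 := by positivity
      linarith
    have e2 : ∫ z : E3, exp (-‖-z‖ ^ 2 / (4 * b ^ 2)) * heatK s (‖v - -z‖ ^ 2) =
      8 * √π ^ 3 * b ^ 3 * heatK (s + b ^ 2) (‖v‖ ^ 2) := by
      rw [← heatK_semigroup hs hb v]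
      exact integral_neg_eq_self (fun z : E3 => exp (-‖z‖ ^ 2 / (4 * b ^ 2)) * heatK s (‖v - z‖ ^ 2)) volume
    have e : ∀ z : E3, D z * (exp (-‖z‖ ^ 2 / (4 * b ^ 2)) / (8 * b ^ 5)) = 1 / (8 * b ^ 5) *
        (2 * heatK s (‖v‖ ^ 2) * exp (-‖z‖ ^ 2 / (4 * b ^ 2))
        - exp (-‖-z‖ ^ 2 / (4 * b ^ 2)) * heatK s (‖v - -z‖ ^ 2)
        - exp (-‖z‖ ^ 2 / (4 * b ^ 2)) * heatK s (‖v - z‖ ^ 2)) := by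
      intro z
      rw [hDv, norm_neg]; ring
    simp_rw [e]
    rw [integral_const_mul, integral_sub, integral_sub, e2, heatK_semigroup hs hb v,
      integral_const_mul, integral_gaussian_three hb]
    · field_simp
      ring
    · exact i0.const_mul _
    · exact i2
    · exact (i0.const_mul _).sub i2
    · exact i1
  have hiD := hFub.integral_prod_right
  have hi : IntegrableOn (fun b : ℝ => (heatK s (‖v‖ ^ 2) - heatK (s + b ^ 2) (‖v‖ ^ 2)) / b ^ 2)
      (Set.Ioi 0) := by
    have h1 : IntegrableOn (fun b => ∫ z : E3, D z * (exp (-‖z‖ ^ 2 / (4 * b ^ 2)) / (8 * b ^ 5)))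
      (Set.Ioi 0) := hiD
    refine IntegrableOn.congr_fun (h1.const_mul (1 / (2 * √π ^ 3))) (fun b hb0 => ?_)
      measurableSet_Ioi
    rw [hb b hb0]
    field_simp
  have hmain : ∫ z : E3, D z / ‖z‖ ^ 4 = 2 * √π ^ 3 * ∫ b : ℝ, heatJ (s + b ^ 2) (‖v‖ ^ 2) := by
    rw [← integral_heatK_diff hs (by positivity) hi, ← integral_const_mul]
    calc ∫ z : E3, D z / ‖z‖ ^ 4 =
        ∫ z : E3, ∫ b in Set.Ioi (0:ℝ), D z * (exp (-‖z‖ ^ 2 / (4 * b ^ 2)) / (8 * b ^ 5)) := by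
          refine integral_congr_ae ?_
          filter_upwards [hz0] with z hz
          rw [integral_const_mul, (subordination hz).2]
          ring
      _ = ∫ b in Set.Ioi (0:ℝ), ∫ z : E3, D z * (exp (-‖z‖ ^ 2 / (4 * b ^ 2)) / (8 * b ^ 5)) :=
          integral_integral_swap hFub
      _ = _ := setIntegral_congr_fun measurableSet_Ioi fun b hb0 => hb b hb0
  rw [halfLap_eq]
  change 1 / (2 * π ^ 2) * ∫ z : E3, D z / ‖z‖ ^ 4 = _
  rw [hmain]
  have hp : π ^ 2 = √π ^ 4 := by
    rw [show √π ^ 4 = (√π ^ 2) ^ 2 by ring, Real.sq_sqrt pi_pos.le]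
  have : 0 < √π := Real.sqrt_pos.2 pi_pos
  rw [hp]
  field_simp

theorem halfLap_sub (φ ψ : SchwartzMap E3 ℝ) (y : E3) :
    halfLap (φ - ψ) y = halfLap φ y - halfLap ψ y := by
  rw [halfLap_eq, halfLap_eq, halfLap_eq, ← mul_sub,
    ← integral_sub (second_difference_integrable φ y) (second_difference_integrable ψ y)]
  congr 2; ext z
  simp only [_root_.sub_apply]
  ring

theorem integral_inv_sq_time {X : ℝ} (hX : 0 < X) :
    IntegrableOn (fun τ => (X + τ)⁻¹ ^ 2) (Set.Ioi 0) ∧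
      ∫ τ in Set.Ioi (0:ℝ), (X + τ)⁻¹ ^ 2 = X⁻¹ := by
  have h2 := Ioi_ftc_nonneg (F := fun τ : ℝ => -(X + τ)⁻¹) (f := fun τ => (X + τ)⁻¹ ^ 2)
    (A := -X⁻¹) (B := -0) (fun τ hτ => ?_) (fun τ hτ => by positivity) ?_ ?_
  · simpa using h2
  · have hτ0 : 0 < τ := hτ
    have h1 : HasDerivAt (fun τ : ℝ => X + τ) 1 τ := (hasDerivAt_id τ).const_add X
    refine (h1.inv (by positivity)).neg.congr_deriv ?_
    simp [neg_div]
  · have : ContinuousAt (fun τ : ℝ => -(X + τ)⁻¹) 0 := by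
      have : X + 0 ≠ 0 := by simpa using hX.ne'
      fun_prop (disch := assumption)
    have := this.tendsto.mono_left (nhdsWithin_le_nhds (s := Set.Ioi 0))
    simpa using this
  · exact (tendsto_inv_atTop_zero.comp (tendsto_atTop_add_const_left _ _ tendsto_id)).neg

theorem integral_heatJ_time {s n : ℝ} (hs : 0 < s) (hn : 0 ≤ n) :
    IntegrableOn (fun τ : ℝ => heatJ (s + τ) n) (Set.Ioi 0) ∧
    ∫ τ in Set.Ioi (0:ℝ), heatJ (s + τ) n = heatK s n := by
  have hd : ∀ τ : ℝ, 0 ≤ τ → HasDerivAt (fun τ => -heatK (s + τ) n) (heatJ (s + τ) n) τ := by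
    intro τ hτ
    have h1 : HasDerivAt (fun τ : ℝ => s + τ) 1 τ := (hasDerivAt_id τ).const_add s
    exact ((hasDerivAt_heatK (by positivity : 0 < s + τ) n).comp τ h1).neg.congr_deriv (by simp)
  have hX : ∀ τ : ℝ, 0 ≤ τ → 0 < s + τ := fun τ h => by positivity
  have hi : IntegrableOn (fun τ : ℝ => heatJ (s + τ) n) (Set.Ioi 0) := by
    have h2 := integral_inv_sq_time hs
    · refine (h2.1.const_mul (368640 * (√s)⁻¹)).mono' ?_ ?_
      · refine ContinuousOn.aestronglyMeasurable ?_ measurableSet_Ioi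
        unfold heatJ heatK
        have h : ∀ b ∈ Set.Ioi (0:ℝ), s + b ≠ 0 := fun b hb => (hX b (le_of_lt hb)).ne'
        have h2 : ∀ b ∈ Set.Ioi (0:ℝ), √(s + b) ≠ 0 := fun b hb =>
          (Real.sqrt_pos.2 (hX b (le_of_lt hb))).ne'
        have h3 : ∀ b ∈ Set.Ioi (0:ℝ), 4 * (s + b) ≠ 0 := fun b hb => mul_ne_zero (by norm_num) (h b hb)
        have h4 : ∀ b ∈ Set.Ioi (0:ℝ), 2 * (s + b) ≠ 0 := fun b hb => mul_ne_zero (by norm_num) (h b hb)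
        have h5 : ∀ b ∈ Set.Ioi (0:ℝ), 4 * (s + b) ^ 2 ≠ 0 := fun b hb =>
          mul_ne_zero (by norm_num) (pow_ne_zero _ (h b hb))
        fun_prop (disch := assumption)
      · filter_upwards [ae_restrict_mem measurableSet_Ioi] with τ hτ
        have hτ0 : 0 < τ := hτ
        have hq : 0 < √(s + τ) := Real.sqrt_pos.2 (hX τ hτ0.le)
        have hq' : 0 < √s := Real.sqrt_pos.2 hs
        calc |heatJ (s + τ) n| ≤ 368640 * (√(s + τ + n))⁻¹ ^ 5 := abs_heatJ_le (hX τ hτ0.le) hn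
          _ ≤ 368640 * (√(s + τ))⁻¹ ^ 5 := by gcongr 368640 * (√?_)⁻¹ ^ 5; linarith
          _ = 368640 * ((√(s + τ))⁻¹ * ((√(s + τ)) ^ 2)⁻¹ ^ 2) := by
            rw [← inv_pow (√(s + τ))]; ring
          _ ≤ 368640 * ((√s)⁻¹ * (s + τ)⁻¹ ^ 2) := by
            rw [Real.sq_sqrt (hX τ hτ0.le).le]
            gcongr 368640 * ((√?_)⁻¹ * _)
            linarith
          _ = _ := by ring
  refine ⟨hi, ?_⟩
  have := Ioi_ftc (F := fun τ => -heatK (s + τ) n) (A := -heatK s n) (B := -0)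
    (fun τ hτ => hd τ (le_of_lt hτ)) hi ?_ ?_
  · simpa using this
  · have := (hd 0 le_rfl).continuousAt.tendsto.mono_left (nhdsWithin_le_nhds (s := Set.Ioi 0))
    simpa using this
  · refine Tendsto.neg ?_
    refine squeeze_zero' (Eventually.of_forall fun τ => heatK_nonneg _ _)
      (g := fun τ => 245760 * (√(s + τ))⁻¹ ^ 3) ?_ ?_
    · filter_upwards [eventually_ge_atTop 0] with τ hτ
      refine (heatK_le (hX τ hτ) hn).trans ?_
      have hq : 0 < √(s + τ) := Real.sqrt_pos.2 (hX τ hτ)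
      gcongr 245760 * (√?_)⁻¹ ^ 3
      linarith
    · have : Tendsto (fun τ : ℝ => (√(s + τ))⁻¹) atTop (𝓝 0) :=
        tendsto_inv_atTop_zero.comp (Real.tendsto_sqrt_atTop.comp
          (tendsto_atTop_add_const_left _ _ tendsto_id))
      have := (this.pow 3).const_mul 245760
      simpa using this

theorem continuous_heatK {α : Type*} [TopologicalSpace α] {f g : α → ℝ} (hf : Continuous f)
    (hg : Continuous g) (h0 : ∀ a, 0 < f a) : Continuous fun a => heatK (f a) (g a) := by
  unfold heatK
  have h1 : ∀ a, √(f a) ≠ 0 := fun a => (Real.sqrt_pos.2 (h0 a)).ne'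
  have h2 : ∀ a, 4 * f a ≠ 0 := fun a => mul_ne_zero (by norm_num) (h0 a).ne'
  fun_prop (disch := assumption)

theorem continuous_heatJ {α : Type*} [TopologicalSpace α] {f g : α → ℝ} (hf : Continuous f)
    (hg : Continuous g) (h0 : ∀ a, 0 < f a) : Continuous fun a => heatJ (f a) (g a) := by
  unfold heatJ
  have h1 := continuous_heatK hf hg h0
  have h2 : ∀ a, 2 * f a ≠ 0 := fun a => mul_ne_zero (by norm_num) (h0 a).ne'
  have h3 : ∀ a, 4 * f a ^ 2 ≠ 0 := fun a => mul_ne_zero (by norm_num) (pow_ne_zero _ (h0 a).ne')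
  fun_prop (disch := assumption)

theorem heatJ_sub_time {s m n n' : ℝ} (hs : 0 < s) (hm : 0 ≤ m) (hn : m ≤ n) (hn' : m ≤ n') :
    ∫ τ in Set.Ioi (0:ℝ), |heatJ (s + τ) n - heatJ (s + τ) n'| ≤
      245760 * |n - n'| * (√(s + m))⁻¹ ^ 5 := by
  have hX : 0 < s + m := by positivity
  have h := integral_inv_sq_time hX
  have hq : 0 < √(s + m) := Real.sqrt_pos.2 hX
  calc ∫ τ in Set.Ioi (0:ℝ), |heatJ (s + τ) n - heatJ (s + τ) n'|
      ≤ ∫ τ in Set.Ioi (0:ℝ), 245760 * |n - n'| * (√(s + m))⁻¹ ^ 3 * (s + m + τ)⁻¹ ^ 2 := by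
        refine setIntegral_mono_on ?_ (h.1.const_mul _) measurableSet_Ioi fun τ hτ => ?_
        · exact ((integral_heatJ_time hs (hm.trans hn)).1.sub
            (integral_heatJ_time hs (hm.trans hn')).1).abs
        · have hτ0 : 0 < τ := hτ
          have hY : 0 < s + m + τ := by positivity
          have hq' : 0 < √(s + m + τ) := Real.sqrt_pos.2 hY
          calc _ ≤ 245760 * (√(s + τ + m))⁻¹ ^ 7 * |n - n'| :=
                heatJ_sub_le (by positivity) hm hn hn'
            _ = 245760 * |n - n'| * (√(s + m + τ))⁻¹ ^ 3 * ((√(s + m + τ)) ^ 2)⁻¹ ^ 2 := by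
                rw [← inv_pow (√(s + m + τ)) 2, add_right_comm]; ring
            _ ≤ _ := by
                rw [Real.sq_sqrt hY.le]
                gcongr 245760 * |n - n'| * (√?_)⁻¹ ^ 3 * _
                linarith
    _ = 245760 * |n - n'| * (√(s + m))⁻¹ ^ 3 * ((√(s + m)) ^ 2)⁻¹ := by
      rw [integral_const_mul, h.2, Real.sq_sqrt hX.le]
    _ = _ := by rw [← inv_pow (√(s + m)) 2]; ring

theorem heat_decay_bound {s : ℝ} (hs : 0 < s) (x x' : E3) : ∃ C, 0 ≤ C ∧ ∀ y : E3,
    ∫ τ in Set.Ioi (0:ℝ), |heatJ (s + τ) (‖x - y‖ ^ 2) - heatJ (s + τ) (‖x' - y‖ ^ 2)| ≤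
      C / (1 + ‖y‖ ^ 4) := by
  set d := ‖x - x'‖ with hd
  set A := max ‖x‖ ‖x'‖ with hA
  have hd0 : 0 ≤ d := norm_nonneg _
  have hqs : 0 < √s := Real.sqrt_pos.2 hs
  refine ⟨245760 * (d * (2 + d / √s)) * ((1 + 8 * A ^ 4) / s ^ 2 + 8), by positivity, fun y => ?_⟩
  obtain ⟨r, hr0, hr1, hr2, hr3⟩ : ∃ r : ℝ, 0 ≤ r ∧ r ≤ ‖x - y‖ ∧ r ≤ ‖x' - y‖ ∧
      (r = ‖x - y‖ ∨ r = ‖x' - y‖) :=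
    ⟨min ‖x - y‖ ‖x' - y‖, by positivity, min_le_left _ _, min_le_right _ _, by
      rcases min_choice ‖x - y‖ ‖x' - y‖ with h | h <;> simp [h]⟩
  have ht1 : ‖x - y‖ ≤ d + ‖x' - y‖ := by
    calc ‖x - y‖ = ‖(x - x') + (x' - y)‖ := by congr 1; abel
      _ ≤ _ := norm_add_le _ _
  have ht2 : ‖x' - y‖ ≤ d + ‖x - y‖ := by
    calc ‖x' - y‖ = ‖(x - y) - (x - x')‖ := by congr 1; abel
      _ ≤ _ := norm_sub_le _ _
      _ = _ := by ring
  have hy : ‖y‖ ≤ A + r := by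
    have a1 : ‖y‖ ≤ ‖x‖ + ‖x - y‖ := by
      calc ‖y‖ = ‖x - (x - y)‖ := by congr 1; abel
        _ ≤ _ := norm_sub_le _ _
    have a2 : ‖y‖ ≤ ‖x'‖ + ‖x' - y‖ := by
      calc ‖y‖ = ‖x' - (x' - y)‖ := by congr 1; abel
        _ ≤ _ := norm_sub_le _ _
    have b1 := le_max_left ‖x‖ ‖x'‖
    have b2 := le_max_right ‖x‖ ‖x'‖
    rcases hr3 with h | h <;> rw [h] <;> linarith
  have hA0 : 0 ≤ A := (norm_nonneg x).trans (le_max_left _ _)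
  have h := heatJ_sub_time hs (sq_nonneg r) (n := ‖x - y‖ ^ 2) (n' := ‖x' - y‖ ^ 2)
    (by gcongr) (by gcongr)
  refine h.trans ?_
  set M := √(s + r ^ 2) with hM
  have hM2 : M ^ 2 = s + r ^ 2 := Real.sq_sqrt (by positivity)
  have hMs : √s ≤ M := Real.sqrt_le_sqrt (by linarith [sq_nonneg r])
  have hM0 : 0 < M := hqs.trans_le hMs
  have hrM : r ≤ M := Real.le_sqrt_of_sq_le (by linarith)
  have hdiff : |‖x - y‖ ^ 2 - ‖x' - y‖ ^ 2| ≤ d * (2 + d / √s) * M := by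
    have e : ‖x - y‖ ^ 2 - ‖x' - y‖ ^ 2 = (‖x - y‖ - ‖x' - y‖) * (‖x - y‖ + ‖x' - y‖) := by ring
    rw [e, abs_mul, abs_of_nonneg (by positivity : 0 ≤ ‖x - y‖ + ‖x' - y‖), mul_assoc]
    have c1 : |‖x - y‖ - ‖x' - y‖| ≤ d := by rw [abs_le]; constructor <;> linarith
    have c2 : ‖x - y‖ + ‖x' - y‖ ≤ (2 + d / √s) * M := by
      have : d ≤ d / √s * M := by
        rw [div_mul_eq_mul_div, le_div_iff₀ hqs]; gcongr
      rcases hr3 with h | h <;> linarith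
    gcongr
  have hfour : 1 + ‖y‖ ^ 4 ≤ ((1 + 8 * A ^ 4) / s ^ 2 + 8) * M ^ 4 := by
    have g1 : ‖y‖ ^ 4 ≤ 8 * A ^ 4 + 8 * r ^ 4 := by
      calc ‖y‖ ^ 4 ≤ (A + r) ^ 4 := by gcongr
        _ ≤ _ := by
          nlinarith [sq_nonneg (A - r), sq_nonneg (A ^ 2 - r ^ 2), sq_nonneg (A + r),
            mul_nonneg (sq_nonneg (A - r)) (sq_nonneg (A + r)),
            mul_nonneg (sq_nonneg (A - r)) (sq_nonneg (A)), mul_nonneg (sq_nonneg (A - r)) (sq_nonneg (r)),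
            mul_nonneg hA0 hr0, mul_nonneg (sq_nonneg (A - r)) (mul_nonneg hA0 hr0)]
    have g2 : r ^ 4 ≤ M ^ 4 := by gcongr
    have g3 : (1 + 8 * A ^ 4) ≤ (1 + 8 * A ^ 4) / s ^ 2 * M ^ 4 := by
      rw [div_mul_eq_mul_div, le_div_iff₀ (by positivity)]
      have : s ^ 2 ≤ M ^ 4 := by
        rw [show M ^ 4 = (M ^ 2) ^ 2 by ring, hM2]; gcongr; linarith [sq_nonneg r]
      gcongr
    linarith
  rw [le_div_iff₀ (by positivity)]
  calc 245760 * |‖x - y‖ ^ 2 - ‖x' - y‖ ^ 2| * M⁻¹ ^ 5 * (1 + ‖y‖ ^ 4)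
      ≤ 245760 * (d * (2 + d / √s) * M) * M⁻¹ ^ 5 * (((1 + 8 * A ^ 4) / s ^ 2 + 8) * M ^ 4) := by
        gcongr
    _ = 245760 * (d * (2 + d / √s)) * ((1 + 8 * A ^ 4) / s ^ 2 + 8) * (M * M⁻¹) ^ 5 := by ring
    _ = _ := by rw [mul_inv_cancel₀ hM0.ne']; ring

theorem integral_triple_swap {f : (ℝ × ℝ) × E3 → ℝ}
    (hf : Integrable f ((volume : Measure (ℝ × ℝ)).prod (volume : Measure E3))) :
    ∫ a : ℝ, ∫ y : E3, ∫ b : ℝ, f ((a, b), y) = ∫ y : E3, ∫ q : ℝ × ℝ, f (q, y) := by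
  have hmp := (measurePreserving_prodAssoc (volume : Measure ℝ) (volume : Measure ℝ)
    (volume : Measure E3))
  have hg : Integrable (fun p : ℝ × (ℝ × E3) => f ((p.1, p.2.1), p.2.2))
      ((volume : Measure ℝ).prod ((volume : Measure ℝ).prod (volume : Measure E3))) :=
    (hmp.integrable_comp_emb MeasurableEquiv.prodAssoc.measurableEmbedding).1 hf
  rw [← integral_prod_symm _ hf]
  have h2 := hmp.integral_comp MeasurableEquiv.prodAssoc.measurableEmbedding
    (fun p : ℝ × (ℝ × E3) => f ((p.1, p.2.1), p.2.2))
  have h3 : ∫ q, f q ∂((volume : Measure (ℝ × ℝ)).prod (volume : Measure E3)) =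
      ∫ p, f ((p.1, p.2.1), p.2.2)
        ∂((volume : Measure ℝ).prod ((volume : Measure ℝ).prod (volume : Measure E3))) := h2
  rw [h3, integral_prod _ hg]
  refine integral_congr_ae ?_
  filter_upwards [hg.prod_right_ae] with a ha
  exact (integral_prod_symm _ ha).symm

theorem smoothed_identity {w ρ : E3 → ℝ} (hwc : Continuous w)
    (hw : Integrable fun y => |w y| / (1 + ‖y‖ ^ 4)) (hρc : Continuous ρ) (hρ : Integrable ρ)
    (heq : ∀ φ : SchwartzMap E3 ℝ, ∫ y, w y * halfLap φ y = 2 * ∫ y, ρ y * φ y)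
    {s : ℝ} (hs : 0 < s) (x x' : E3) :
    √π * ∫ y, w y * (heatK s (‖x - y‖ ^ 2) - heatK s (‖x' - y‖ ^ 2)) =
      2 * ∫ y, ρ y * ∫ a : ℝ, (heatK (s + a ^ 2) (‖x - y‖ ^ 2) - heatK (s + a ^ 2) (‖x' - y‖ ^ 2)) := by
  set f : (ℝ × ℝ) × E3 → ℝ := fun p => w p.2 * (heatJ (s + (p.1.1 ^ 2 + p.1.2 ^ 2)) (‖x - p.2‖ ^ 2) -
    heatJ (s + (p.1.1 ^ 2 + p.1.2 ^ 2)) (‖x' - p.2‖ ^ 2)) with hfdef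
  have hfc : Continuous f := by
    have h1 : Continuous fun p : (ℝ × ℝ) × E3 =>
        heatJ (s + (p.1.1 ^ 2 + p.1.2 ^ 2)) (‖x - p.2‖ ^ 2) :=
      continuous_heatJ (by fun_prop) (by fun_prop) (fun p => by positivity)
    have h2 : Continuous fun p : (ℝ × ℝ) × E3 =>
        heatJ (s + (p.1.1 ^ 2 + p.1.2 ^ 2)) (‖x' - p.2‖ ^ 2) :=
      continuous_heatJ (by fun_prop) (by fun_prop) (fun p => by positivity)
    simp only [hfdef]
    fun_prop
  have hτ : ∀ y : E3, IntegrableOn (fun τ => heatJ (s + τ) (‖x - y‖ ^ 2) -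
      heatJ (s + τ) (‖x' - y‖ ^ 2)) (Set.Ioi 0) := fun y =>
    (integral_heatJ_time hs (by positivity)).1.sub (integral_heatJ_time hs (by positivity)).1
  have hf : Integrable f ((volume : Measure (ℝ × ℝ)).prod (volume : Measure E3)) := by
    rw [integrable_prod_iff' hfc.aestronglyMeasurable]
    constructor
    · refine Eventually.of_forall fun y => ?_
      exact (planar_integrable (hτ y)).const_mul (w y)
    · obtain ⟨C, hC0, hC⟩ := heat_decay_bound hs x x'
      refine (hw.const_mul (π * C)).mono' ?_ ?_
      · exact hfc.aestronglyMeasurable.norm.prod_swap.integral_prod_right'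
      · refine Eventually.of_forall fun y => ?_
        rw [Real.norm_of_nonneg (integral_nonneg fun q => norm_nonneg _)]
        have e : ∀ q : ℝ × ℝ, ‖f (q, y)‖ = |w y| * (fun τ => |heatJ (s + τ) (‖x - y‖ ^ 2) -
            heatJ (s + τ) (‖x' - y‖ ^ 2)|) (q.1 ^ 2 + q.2 ^ 2) := fun q => by
          simp only [hfdef, norm_mul, Real.norm_eq_abs]
        simp_rw [e]
        rw [integral_const_mul, planar_integral (fun τ => |heatJ (s + τ) (‖x - y‖ ^ 2) -
          heatJ (s + τ) (‖x' - y‖ ^ 2)|)]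
        calc _ ≤ |w y| * (π * (C / (1 + ‖y‖ ^ 4))) := by gcongr; exact hC y
          _ = _ := by ring
  have hT := integral_triple_swap hf
  have hR : ∀ y, ∫ q : ℝ × ℝ, f (q, y) =
      π * (w y * (heatK s (‖x - y‖ ^ 2) - heatK s (‖x' - y‖ ^ 2))) := by
    intro y
    have e : ∀ q : ℝ × ℝ, f (q, y) = w y * (fun τ => heatJ (s + τ) (‖x - y‖ ^ 2) -
            heatJ (s + τ) (‖x' - y‖ ^ 2)) (q.1 ^ 2 + q.2 ^ 2) := fun q => rfl
    simp_rw [e]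
    rw [integral_const_mul, planar_integral (fun τ => heatJ (s + τ) (‖x - y‖ ^ 2) -
      heatJ (s + τ) (‖x' - y‖ ^ 2)), integral_sub (integral_heatJ_time hs (by positivity)).1
      (integral_heatJ_time hs (by positivity)).1, (integral_heatJ_time hs (by positivity)).2,
      (integral_heatJ_time hs (by positivity)).2]
    ring
  have hL : ∀ a : ℝ, ∫ y : E3, ∫ b : ℝ, f ((a, b), y) =
      √π * (2 * ∫ y, ρ y * (heatK (s + a ^ 2) (‖x - y‖ ^ 2) - heatK (s + a ^ 2) (‖x' - y‖ ^ 2))) := by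
    intro a
    have hsa : 0 < s + a ^ 2 := by positivity
    have h := heq (heatSchwartz _ hsa x - heatSchwartz _ hsa x')
    simp only [halfLap_sub, _root_.sub_apply, heatSchwartz_apply, halfLap_heat] at h
    rw [← h, ← integral_const_mul]
    congr 1; ext y
    have hp : 0 < √π := Real.sqrt_pos.2 pi_pos
    simp only [hfdef]
    rw [integral_const_mul]
    have e : ∀ b : ℝ, s + (a ^ 2 + b ^ 2) = s + a ^ 2 + b ^ 2 := fun b => by ring
    simp_rw [e]
    rw [integral_sub (integrable_heatJ_comp hsa (by positivity))
      (integrable_heatJ_comp hsa (by positivity))]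
    field_simp
  simp_rw [hL, hR] at hT
  rw [integral_const_mul, integral_const_mul, integral_const_mul] at hT
  have hsw : ∫ a : ℝ, ∫ y, ρ y * (heatK (s + a ^ 2) (‖x - y‖ ^ 2) - heatK (s + a ^ 2) (‖x' - y‖ ^ 2)) =
      ∫ y, ∫ a : ℝ, ρ y * (heatK (s + a ^ 2) (‖x - y‖ ^ 2) - heatK (s + a ^ 2) (‖x' - y‖ ^ 2)) := by
    refine integral_integral_swap ?_
    have hqs : 0 < √s := Real.sqrt_pos.2 hs
    refine ((integrable_inv_add_sq hs).mul_prod (hρ.norm.const_mul (491520 * (√s)⁻¹))).mono' ?_ ?_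
    · have h1 : Continuous fun p : ℝ × E3 => heatK (s + p.1 ^ 2) (‖x - p.2‖ ^ 2) :=
        continuous_heatK (by fun_prop) (by fun_prop) (fun p => by positivity)
      have h2 : Continuous fun p : ℝ × E3 => heatK (s + p.1 ^ 2) (‖x' - p.2‖ ^ 2) :=
        continuous_heatK (by fun_prop) (by fun_prop) (fun p => by positivity)
      refine Continuous.aestronglyMeasurable ?_
      simp only [Function.uncurry_def]
      fun_prop
    · refine Eventually.of_forall fun p => ?_
      simp only [Function.uncurry]
      have hb : ∀ n : ℝ, 0 ≤ n → heatK (s + p.1 ^ 2) n ≤ 245760 * (√s)⁻¹ * (s + p.1 ^ 2)⁻¹ := by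
        intro n hn
        have hq : 0 < √(s + p.1 ^ 2) := Real.sqrt_pos.2 (by positivity)
        calc _ ≤ 245760 * (√(s + p.1 ^ 2 + n))⁻¹ ^ 3 := heatK_le (by positivity) hn
          _ ≤ 245760 * (√(s + p.1 ^ 2))⁻¹ ^ (1 + 2) := by
            gcongr 245760 * (√?_)⁻¹ ^ 3; linarith
          _ ≤ 245760 * ((√s)⁻¹ ^ 1 * (s + p.1 ^ 2)⁻¹) := by
            gcongr; exact sqrt_inv_pow_le hs (sq_nonneg _) 1
          _ = _ := by ring
      have b1 := hb (‖x - p.2‖ ^ 2) (by positivity)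
      have b2 := hb (‖x' - p.2‖ ^ 2) (by positivity)
      have c1 := heatK_nonneg (s + p.1 ^ 2) (‖x - p.2‖ ^ 2)
      have c2 := heatK_nonneg (s + p.1 ^ 2) (‖x' - p.2‖ ^ 2)
      have : |heatK (s + p.1 ^ 2) (‖x - p.2‖ ^ 2) - heatK (s + p.1 ^ 2) (‖x' - p.2‖ ^ 2)| ≤
        491520 * (√s)⁻¹ * (s + p.1 ^ 2)⁻¹ := by rw [abs_le]; constructor <;> linarith
      rw [norm_mul]
      calc _ ≤ ‖ρ p.2‖ * (491520 * (√s)⁻¹ * (s + p.1 ^ 2)⁻¹) := by gcongr; exact this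
        _ = _ := by ring
  rw [hsw] at hT
  simp_rw [integral_const_mul] at hT
  have hp : 0 < √π := Real.sqrt_pos.2 pi_pos
  have hpp : √π * √π = π := Real.mul_self_sqrt pi_pos.le
  rw [← mul_left_cancel_iff_of_pos hp]
  rw [← mul_assoc (√π) (√π), hpp, ← hT]

theorem integrable_mul_inv_sq {ρ : E3 → ℝ} (hρc : Continuous ρ) (hρ : Integrable ρ) (x : E3) :
    Integrable fun y => ρ y * (1 / ‖x - y‖ ^ 2) := by
  obtain ⟨M, hM⟩ := (isCompact_closedBall x 1).exists_bound_of_continuousOn hρc.continuousOn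
  refine ((((integrable_inv_sq_mul.comp_sub_left x)).const_mul (2 * M)).add hρ.norm).mono' ?_ ?_
  · have : Measurable fun y : E3 => 1 / ‖x - y‖ ^ 2 := by fun_prop
    exact hρc.aestronglyMeasurable.mul this.aestronglyMeasurable
  · filter_upwards [Measure.ae_ne volume x] with y hy
    have h0 : 0 < ‖x - y‖ := norm_pos_iff.2 (sub_ne_zero.2 hy.symm)
    have hM0 : 0 ≤ M := (norm_nonneg _).trans (hM x (Metric.mem_closedBall_self zero_le_one))
    simp only [Pi.add_apply, norm_mul]
    rw [Real.norm_of_nonneg (by positivity : (0:ℝ) ≤ 1 / ‖x - y‖ ^ 2)]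
    by_cases h : ‖x - y‖ ≤ 1
    · have := hM y (by rwa [mem_closedBall_iff_norm'])
      have h2 : ‖x - y‖ ^ 2 ≤ 1 := by nlinarith
      calc ‖ρ y‖ * (1 / ‖x - y‖ ^ 2) ≤ M * (2 * (1 / (‖x - y‖ ^ 2 * (1 + ‖x - y‖ ^ 2)))) := by
            gcongr
            rw [← mul_div_assoc, div_le_div_iff₀ (by positivity) (by positivity)]
            nlinarith [sq_nonneg ‖x - y‖]
        _ ≤ _ := by linarith [norm_nonneg (ρ y)]
    · push Not at h
      have : 1 / ‖x - y‖ ^ 2 ≤ 1 := by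
        rw [div_le_one (by positivity)]; nlinarith
      have h3 : 0 ≤ 2 * M * (1 / (‖x - y‖ ^ 2 * (1 + ‖x - y‖ ^ 2))) := by positivity
      nlinarith [norm_nonneg (ρ y)]

theorem heatK_le_far {s n : ℝ} (hs : 0 < s) (hn : 1 ≤ n) : heatK s n ≤ 245760 * s * (1 / n ^ 2) := by
  have h := one_add_mul_heatK_le hs (by linarith : 0 ≤ n) (j := 0) (by norm_num)
  simp only [pow_zero, one_mul, mul_zero, add_zero] at h
  have h0 := heatK_nonneg s n
  have h1 : (√(s + n))⁻¹ ^ 3 ≤ 1 / n := by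
    have a1 : 1 ≤ √(s + n) := by rw [Real.one_le_sqrt]; linarith
    have a2 : √(s + n) ^ 2 = s + n := Real.sq_sqrt (by linarith)
    rw [inv_pow, ← one_div]
    gcongr
    nlinarith [pow_le_pow_right₀ a1 (show 2 ≤ 3 by norm_num)]
  have h2 : n / s * heatK s n ≤ 245760 * (1 / n) := by nlinarith
  calc heatK s n = s / n * (n / s * heatK s n) := by field_simp
    _ ≤ s / n * (245760 * (1 / n)) := by gcongr
    _ = _ := by ring

theorem inv_pow_four_far {x y : E3} (h : 1 ≤ ‖x - y‖) :
    1 / ‖x - y‖ ^ 4 ≤ (9 + 8 * ‖x‖ ^ 4) * (1 / (1 + ‖y‖ ^ 4)) := by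
  have h1 : ‖y‖ ≤ ‖x‖ + ‖x - y‖ := by
    have := norm_sub_le x (x - y); rwa [sub_sub_cancel] at this
  have h2 : ‖y‖ ^ 4 ≤ 8 * (‖x‖ ^ 4 + ‖x - y‖ ^ 4) := by
    calc ‖y‖ ^ 4 ≤ (‖x‖ + ‖x - y‖) ^ 4 := by gcongr
      _ ≤ 2 ^ 3 * (‖x‖ ^ 4 + ‖x - y‖ ^ 4) := add_pow_le (norm_nonneg _) (norm_nonneg _) 4
      _ = _ := by norm_num
  have h3 : 1 ≤ ‖x - y‖ ^ 4 := one_le_pow₀ h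
  have h4 : 0 ≤ ‖x‖ ^ 4 := by positivity
  rw [← mul_div_assoc, div_le_div_iff₀ (by positivity) (by positivity)]
  nlinarith

theorem heat_recover {w : E3 → ℝ} (hwc : Continuous w)
    (hw : Integrable fun y => |w y| / (1 + ‖y‖ ^ 4)) (x : E3) :
    (∀ s, 0 < s → Integrable fun y => w y * heatK s (‖x - y‖ ^ 2)) ∧
    Tendsto (fun b : ℝ => ∫ y, w y * heatK (b ^ 2) (‖x - y‖ ^ 2)) (𝓝[>] 0)
      (𝓝 (8 * √π ^ 3 * w x)) := by
  obtain ⟨M, hM⟩ := (isCompact_closedBall x 1).exists_bound_of_continuousOn hwc.continuousOn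
  have hM0 : 0 ≤ M := (norm_nonneg _).trans (hM x (Metric.mem_closedBall_self zero_le_one))
  set B := Metric.closedBall x (1:ℝ)
  have hBm : MeasurableSet B := measurableSet_closedBall
  have hkc : ∀ s, 0 < s → Continuous fun y : E3 => heatK s (‖x - y‖ ^ 2) := fun s hs =>
    continuous_heatK (by fun_prop) (by fun_prop) (fun _ => hs)
  have hB : ∀ s, 0 < s → IntegrableOn (fun y => w y * heatK s (‖x - y‖ ^ 2)) B := fun s hs =>
    (hwc.mul (hkc s hs)).continuousOn.integrableOn_compact (isCompact_closedBall x 1)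
  set K := 245760 * (9 + 8 * ‖x‖ ^ 4) with hK
  have hfar : ∀ s, 0 < s → ∀ y ∈ Bᶜ, ‖w y * heatK s (‖x - y‖ ^ 2)‖ ≤
      s * (K * (|w y| / (1 + ‖y‖ ^ 4))) := by
    intro s hs y hy
    have hy' : 1 < ‖x - y‖ := by
      rw [Set.mem_compl_iff, mem_closedBall_iff_norm'] at hy; linarith
    rw [norm_mul, Real.norm_of_nonneg (heatK_nonneg _ _), Real.norm_eq_abs]
    calc _ ≤ |w y| * (245760 * s * (1 / (‖x - y‖ ^ 2) ^ 2)) := by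
          gcongr; exact heatK_le_far hs (one_le_pow₀ hy'.le)
      _ = |w y| * (245760 * s * (1 / ‖x - y‖ ^ 4)) := by rw [← pow_mul]
      _ ≤ |w y| * (245760 * s * ((9 + 8 * ‖x‖ ^ 4) * (1 / (1 + ‖y‖ ^ 4)))) := by
          gcongr; exact inv_pow_four_far hy'.le
      _ = _ := by rw [hK]; ring
  have hBc : ∀ s, 0 < s → IntegrableOn (fun y => w y * heatK s (‖x - y‖ ^ 2)) Bᶜ := fun s hs => by
    refine Integrable.mono' ((hw.const_mul K).const_mul s).integrableOn
      (hwc.mul (hkc s hs)).aestronglyMeasurable ?_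
    exact (ae_restrict_iff' hBm.compl).2 (Eventually.of_forall (hfar s hs))
  have hint : ∀ s, 0 < s → Integrable fun y => w y * heatK s (‖x - y‖ ^ 2) := fun s hs => by
    rw [← integrableOn_univ, ← Set.union_compl_self B]
    exact (hB s hs).union (hBc s hs)
  refine ⟨hint, ?_⟩
  have hlim2 : Tendsto (fun b : ℝ => ∫ y in Bᶜ, w y * heatK (b ^ 2) (‖x - y‖ ^ 2)) (𝓝[>] 0)
      (𝓝 0) := by
    have h1 : Tendsto (fun b : ℝ => b ^ 2 * ∫ y in Bᶜ, K * (|w y| / (1 + ‖y‖ ^ 4))) (𝓝[>] 0) (𝓝 0) := by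
      have : Continuous fun b : ℝ => b ^ 2 * ∫ y in Bᶜ, K * (|w y| / (1 + ‖y‖ ^ 4)) := by fun_prop
      have h := this.tendsto 0
      simp only [ne_eq, OfNat.ofNat_ne_zero, not_false_eq_true, zero_pow, zero_mul] at h
      exact h.mono_left nhdsWithin_le_nhds
    refine squeeze_zero_norm' ?_ h1
    filter_upwards [self_mem_nhdsWithin] with b hb
    have hb2 : 0 < b ^ 2 := pow_pos hb 2
    rw [← integral_const_mul]
    refine norm_integral_le_of_norm_le ((hw.const_mul K).const_mul (b ^ 2)).integrableOn ?_
    exact (ae_restrict_iff' hBm.compl).2 (Eventually.of_forall (hfar _ hb2))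
  have hlim1 : Tendsto (fun b : ℝ => ∫ y in B, w y * heatK (b ^ 2) (‖x - y‖ ^ 2)) (𝓝[>] 0)
      (𝓝 (8 * √π ^ 3 * w x)) := by
    set W := B.indicator w with hW
    have hWb : ∀ y, ‖W y‖ ≤ M := fun y => by
      classical
      rw [hW, Set.indicator_apply]; split_ifs with h
      · exact hM y h
      · simpa using hM0
    have hWm : Measurable W := hwc.measurable.indicator hBm
    have e : ∀ b : ℝ, 0 < b → ∫ y in B, w y * heatK (b ^ 2) (‖x - y‖ ^ 2) =
        ∫ z, W (x + b • z) * exp (-‖z‖ ^ 2 / (4 * 1 ^ 2)) := by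
      intro b hb
      rw [← integral_indicator hBm]
      have e1 : ∀ z : E3, W (x + b • z) * exp (-‖z‖ ^ 2 / (4 * 1 ^ 2)) =
          (fun y => b ^ 3 * (W (x + y) * heatK (b ^ 2) (‖y‖ ^ 2))) (b • z) := by
        intro z
        simp only [heatK, norm_smul, Real.sqrt_sq hb.le, Real.norm_of_nonneg hb.le]
        have : -(b * ‖z‖) ^ 2 / (4 * b ^ 2) = -‖z‖ ^ 2 / (4 * 1 ^ 2) := by field_simp
        rw [this]; field_simp
      rw [funext e1, Measure.integral_comp_smul volume
        (fun y => b ^ 3 * (W (x + y) * heatK (b ^ 2) (‖y‖ ^ 2))) b, finrank_E3, integral_const_mul, abs_of_pos (by positivity),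
        smul_eq_mul, ← mul_assoc, inv_mul_cancel₀ (by positivity), one_mul,
        ← integral_add_left_eq_self (μ := volume) (B.indicator _) x]
      congr 1; ext y
      classical
      simp only [hW, Set.indicator_apply, sub_add_cancel_left, norm_neg]
      split_ifs <;> simp
    have h8 : 8 * √π ^ 3 * w x = ∫ z : E3, w x * exp (-‖z‖ ^ 2 / (4 * 1 ^ 2)) := by
      rw [integral_const_mul, integral_gaussian_three one_pos]; ring
    rw [h8]
    refine Tendsto.congr' (f₁ := fun b : ℝ => ∫ z, W (x + b • z) * exp (-‖z‖ ^ 2 / (4 * 1 ^ 2))) ?_ ?_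
    · filter_upwards [self_mem_nhdsWithin] with b hb using (e b hb).symm
    refine tendsto_integral_filter_of_dominated_convergence
      (fun z => M * exp (-‖z‖ ^ 2 / (4 * 1 ^ 2))) ?_ ?_ ?_ ?_
    · refine Eventually.of_forall fun b => ?_
      exact (hWm.comp (by fun_prop)).aestronglyMeasurable.mul
        (Continuous.aestronglyMeasurable (by fun_prop))
    · refine Eventually.of_forall fun b => Eventually.of_forall fun z => ?_
      rw [norm_mul, Real.norm_of_nonneg (exp_pos _).le]
      gcongr; exact hWb _
    · refine Integrable.const_mul ?_ M
      refine (gaussian_integrable (q := 1 / 4) (by norm_num)).congr (Eventually.of_forall fun z => ?_)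
      simp only; congr 1; ring
    · refine Eventually.of_forall fun z => Tendsto.mul_const _ ?_
      have hx : W =ᶠ[𝓝 x] w := by
        filter_upwards [Metric.closedBall_mem_nhds x one_pos] with y hy
        exact Set.indicator_of_mem hy w
      have h1 : Tendsto W (𝓝 x) (𝓝 (w x)) := (hwc.tendsto x).congr' hx.symm
      refine h1.comp ?_
      have : Continuous fun b : ℝ => x + b • z := by fun_prop
      have h := this.tendsto 0
      simp only [zero_smul, add_zero] at h
      exact h.mono_left nhdsWithin_le_nhds
  have := hlim1.add hlim2
  rw [add_zero] at this
  refine this.congr' ?_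
  filter_upwards [self_mem_nhdsWithin] with b hb
  exact integral_add_compl hBm (hint _ (pow_pos hb 2))

theorem integral_inv_add_sq {n : ℝ} (hn : 0 < n) : ∫ b : ℝ, (n + b ^ 2)⁻¹ = π * (√n)⁻¹ := by
  have hq : 0 < √n := Real.sqrt_pos.2 hn
  have h := Measure.integral_comp_mul_left (fun b : ℝ => (n + b ^ 2)⁻¹) (√n)
  have e : ∀ b : ℝ, (n + (√n * b) ^ 2)⁻¹ = n⁻¹ * (1 + b ^ 2)⁻¹ := fun b => by
    rw [mul_pow, Real.sq_sqrt hn.le, ← mul_inv]; ring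
  simp only [e] at h
  rw [integral_const_mul, integral_univ_inv_one_add_sq, abs_of_pos (by positivity), smul_eq_mul] at h
  have h2 : √n * √n = n := Real.mul_self_sqrt hn.le
  have h3 : ∫ b : ℝ, (n + b ^ 2)⁻¹ = √n * (n⁻¹ * π) := by rw [h]; field_simp
  rw [h3]; field_simp; rw [pow_two, h2]

theorem integral_heatK_sq {n : ℝ} (hn : 0 < n) : ∫ a : ℝ, heatK (a ^ 2) n = 4 * (1 / n) := by
  have e : ∀ a : ℝ, heatK (a ^ 2) n = (fun r => heatK (r ^ 2) n) |a| := fun a => by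
    simp only [sq_abs]
  rw [integral_congr_ae (Eventually.of_forall e), integral_comp_abs (f := fun r => heatK (r ^ 2) n)]
  have h : IntegrableOn (fun r => heatK (r ^ 2) n) (Set.Ioi 0) ∧
      ∫ r in Set.Ioi 0, heatK (r ^ 2) n = 2 / n * exp 0 - 0 := by
    refine Ioi_ftc_nonneg (F := fun r => 2 / n * exp (-(n / 4) * (r ^ 2)⁻¹)) ?_ ?_ ?_ ?_
    · intro r hr
      have hr : 0 < r := hr
      have h1 := (((hasDerivAt_pow 2 r).inv (by positivity)).const_mul (-(n / 4))).exp.const_mul (2 / n)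
      refine h1.congr_deriv ?_
      simp only [heatK, Real.sqrt_sq hr.le, Pi.inv_apply]
      rw [show -(n / 4) * ((r ^ 2))⁻¹ = -n / (4 * r ^ 2) by field_simp]
      field_simp
      norm_num
    · exact fun r _ => heatK_nonneg _ _
    · have h1 : Tendsto (fun r : ℝ => (r ^ 2)⁻¹) (𝓝[>] 0) atTop := by
        have := tendsto_inv_nhdsGT_zero (𝕜 := ℝ)
        refine ((tendsto_pow_atTop (two_ne_zero)).comp this).congr fun r => ?_
        simp
      have h2 : Tendsto (fun r : ℝ => -(n / 4) * (r ^ 2)⁻¹) (𝓝[>] 0) atBot :=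
        h1.const_mul_atTop_of_neg (by linarith)
      simpa using (tendsto_exp_atBot.comp h2).const_mul (2 / n)
    · have h1 : Tendsto (fun r : ℝ => (r ^ 2)⁻¹) atTop (𝓝 0) :=
        tendsto_inv_atTop_zero.comp (tendsto_pow_atTop two_ne_zero)
      have h2 : Tendsto (fun r : ℝ => -(n / 4) * (r ^ 2)⁻¹) atTop (𝓝 0) := by
        simpa using h1.const_mul (-(n / 4))
      exact ((continuous_exp.tendsto 0).comp h2).const_mul _
  rw [h.2, exp_zero]; ring

theorem heatK_time_le {s n : ℝ} (hs : 0 < s) (hn : 0 < n) (a : ℝ) :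
    heatK (s + a ^ 2) n ≤ 245760 * (√n)⁻¹ * (n + a ^ 2)⁻¹ := by
  have hq : 0 < √n := Real.sqrt_pos.2 hn
  have hq : 0 < √(n + a ^ 2) := Real.sqrt_pos.2 (by positivity)
  calc _ ≤ 245760 * (√(s + a ^ 2 + n))⁻¹ ^ 3 := heatK_le (by positivity) hn.le
    _ ≤ 245760 * (√(n + a ^ 2))⁻¹ ^ (1 + 2) := by
      gcongr 245760 * (√?_)⁻¹ ^ 3; linarith
    _ ≤ 245760 * ((√n)⁻¹ ^ 1 * (n + a ^ 2)⁻¹) := by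
      gcongr; exact sqrt_inv_pow_le hn (sq_nonneg _) 1
    _ = _ := by ring

theorem heatK_time_integrable {s n : ℝ} (hs : 0 < s) (hn : 0 < n) :
    Integrable fun a : ℝ => heatK (s + a ^ 2) n := by
  refine ((integrable_inv_add_sq hn).const_mul (245760 * (√n)⁻¹)).mono' ?_ ?_
  · exact (continuous_heatK (by fun_prop) (by fun_prop) (fun a => by positivity)).aestronglyMeasurable
  · refine Eventually.of_forall fun a => ?_
    rw [Real.norm_of_nonneg (heatK_nonneg _ _)]
    exact heatK_time_le hs hn a

theorem integral_heatK_time_le {s n : ℝ} (hs : 0 < s) (hn : 0 < n) :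
    ∫ a : ℝ, heatK (s + a ^ 2) n ≤ 245760 * π * (1 / n) := by
  calc _ ≤ ∫ a : ℝ, 245760 * (√n)⁻¹ * (n + a ^ 2)⁻¹ :=
        integral_mono (heatK_time_integrable hs hn) ((integrable_inv_add_sq hn).const_mul _)
          (heatK_time_le hs hn)
    _ = 245760 * π * ((√n)⁻¹ * (√n)⁻¹) := by
      rw [integral_const_mul, integral_inv_add_sq hn]; ring
    _ = _ := by rw [← mul_inv, Real.mul_self_sqrt hn.le, one_div]

theorem tendsto_integral_heatK_time {n : ℝ} (hn : 0 < n) :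
    Tendsto (fun b : ℝ => ∫ a : ℝ, heatK (b ^ 2 + a ^ 2) n) (𝓝[>] 0) (𝓝 (4 * (1 / n))) := by
  rw [← integral_heatK_sq hn]
  refine tendsto_integral_filter_of_dominated_convergence
    (fun a => 245760 * (√n)⁻¹ * (n + a ^ 2)⁻¹) ?_ ?_ ((integrable_inv_add_sq hn).const_mul _) ?_
  · filter_upwards [self_mem_nhdsWithin] with b hb
    exact (heatK_time_integrable (pow_pos hb 2) hn).aestronglyMeasurable
  · filter_upwards [self_mem_nhdsWithin] with b hb
    refine Eventually.of_forall fun a => ?_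
    rw [Real.norm_of_nonneg (heatK_nonneg _ _)]
    exact heatK_time_le (pow_pos hb 2) hn a
  · filter_upwards [Measure.ae_ne volume (0 : ℝ)] with a ha
    have ha2 : 0 < a ^ 2 := by positivity
    have : Continuous fun b : ℝ => heatK (b ^ 2 + a ^ 2) n :=
      continuous_heatK (by fun_prop) (by fun_prop) (fun b => by positivity)
    have h := this.tendsto 0
    simp only [ne_eq, OfNat.ofNat_ne_zero, not_false_eq_true, zero_pow, zero_add] at h
    exact h.mono_left nhdsWithin_le_nhds

/-- A weak solution of `(-Δ)^{1/2} w = 2ρ` is, up to a constant, the Riesz potential of `ρ`. -/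
theorem riesz_representation {w ρ : E3 → ℝ} (hwc : Continuous w)
    (hw : Integrable fun y => |w y| / (1 + ‖y‖ ^ 4)) (hρc : Continuous ρ) (hρ : Integrable ρ)
    (heq : ∀ φ : SchwartzMap E3 ℝ, ∫ y, w y * halfLap φ y = 2 * ∫ y, ρ y * φ y) (x x' : E3) :
    w x - w x' = 1 / π ^ 2 * ((∫ y, ρ y * (1 / ‖x - y‖ ^ 2)) - ∫ y, ρ y * (1 / ‖x' - y‖ ^ 2)) := by
  have hL : Tendsto (fun b : ℝ => √π * ((∫ y, w y * heatK (b ^ 2) (‖x - y‖ ^ 2)) -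
      ∫ y, w y * heatK (b ^ 2) (‖x' - y‖ ^ 2))) (𝓝[>] 0)
      (𝓝 (√π * (8 * √π ^ 3 * w x - 8 * √π ^ 3 * w x'))) :=
    ((heat_recover hwc hw x).2.sub (heat_recover hwc hw x').2).const_mul _
  have hR : ∀ x : E3, (∀ b : ℝ, 0 < b → Integrable fun y => ρ y * ∫ a : ℝ,
      heatK (b ^ 2 + a ^ 2) (‖x - y‖ ^ 2)) ∧ Tendsto (fun b : ℝ => ∫ y, ρ y * ∫ a : ℝ,
      heatK (b ^ 2 + a ^ 2) (‖x - y‖ ^ 2)) (𝓝[>] 0) (𝓝 (∫ y, ρ y * (4 * (1 / ‖x - y‖ ^ 2)))) := by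
    intro x
    have hm : ∀ b : ℝ, 0 < b → AEStronglyMeasurable (fun y => ρ y * ∫ a : ℝ,
        heatK (b ^ 2 + a ^ 2) (‖x - y‖ ^ 2)) volume := by
      intro b hb
      refine hρc.aestronglyMeasurable.mul ?_
      have : Continuous fun p : E3 × ℝ => heatK (b ^ 2 + p.2 ^ 2) (‖x - p.1‖ ^ 2) :=
        continuous_heatK (by fun_prop) (by fun_prop) (fun p => by positivity)
      exact this.aestronglyMeasurable.integral_prod_right'
    have hb : ∀ b : ℝ, 0 < b → ∀ᵐ y, ‖ρ y * ∫ a : ℝ, heatK (b ^ 2 + a ^ 2) (‖x - y‖ ^ 2)‖ ≤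
        245760 * π * ‖ρ y * (1 / ‖x - y‖ ^ 2)‖ := by
      intro b hb
      filter_upwards [Measure.ae_ne volume x] with y hy
      have h0 : 0 < ‖x - y‖ := norm_pos_iff.2 (sub_ne_zero.2 hy.symm)
      rw [norm_mul, norm_mul, Real.norm_of_nonneg (integral_nonneg fun a => heatK_nonneg _ _),
        Real.norm_of_nonneg (by positivity : 0 ≤ 1 / ‖x - y‖ ^ 2)]
      calc _ ≤ ‖ρ y‖ * (245760 * π * (1 / ‖x - y‖ ^ 2)) := by
            gcongr; exact integral_heatK_time_le (pow_pos hb 2) (by positivity)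
        _ = _ := by ring
    have hi := (integrable_mul_inv_sq hρc hρ x).norm.const_mul (245760 * π)
    refine ⟨fun b h => hi.mono' (hm b h) (hb b h), ?_⟩
    refine tendsto_integral_filter_of_dominated_convergence _ ?_ ?_ hi ?_
    · filter_upwards [self_mem_nhdsWithin] with b h using hm b h
    · filter_upwards [self_mem_nhdsWithin] with b h using hb b h
    · filter_upwards [Measure.ae_ne volume x] with y hy
      have h0 : 0 < ‖x - y‖ := norm_pos_iff.2 (sub_ne_zero.2 hy.symm)
      exact (tendsto_integral_heatK_time (by positivity)).const_mul _
  have hE := ((hR x).2.sub (hR x').2).const_mul 2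
  have hu : √π * (8 * √π ^ 3 * w x - 8 * √π ^ 3 * w x') =
      2 * ((∫ y, ρ y * (4 * (1 / ‖x - y‖ ^ 2))) - ∫ y, ρ y * (4 * (1 / ‖x' - y‖ ^ 2))) := by
    refine tendsto_nhds_unique hL (hE.congr' ?_)
    filter_upwards [self_mem_nhdsWithin] with b hb
    have hb2 : 0 < b ^ 2 := pow_pos hb 2
    have h := smoothed_identity hwc hw hρc hρ heq hb2 x x'
    rw [← integral_sub ((heat_recover hwc hw x).1 _ hb2) ((heat_recover hwc hw x').1 _ hb2),
      ← integral_sub ((hR x).1 b hb) ((hR x').1 b hb)]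
    simp_rw [← mul_sub]
    rw [h]
    congr 1
    refine integral_congr_ae ?_
    filter_upwards [Measure.ae_ne volume x, Measure.ae_ne volume x'] with y hy hy'
    have h0 : 0 < ‖x - y‖ := norm_pos_iff.2 (sub_ne_zero.2 hy.symm)
    have h0' : 0 < ‖x' - y‖ := norm_pos_iff.2 (sub_ne_zero.2 hy'.symm)
    rw [integral_sub (heatK_time_integrable hb2 (by positivity))
      (heatK_time_integrable hb2 (by positivity))]
  have e : ∀ x : E3, ∫ y, ρ y * (4 * (1 / ‖x - y‖ ^ 2)) = 4 * ∫ y, ρ y * (1 / ‖x - y‖ ^ 2) := by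
    intro x
    rw [← integral_const_mul]; congr 1; ext y; ring
  rw [e, e] at hu
  have hp : √π ^ 2 = π := Real.sq_sqrt pi_pos.le
  have hp4 : √π * √π ^ 3 = π ^ 2 := by
    calc _ = (√π ^ 2) ^ 2 := by ring
      _ = _ := by rw [hp]
  have : 8 * π ^ 2 * (w x - w x') =
      8 * ((∫ y, ρ y * (1 / ‖x - y‖ ^ 2)) - ∫ y, ρ y * (1 / ‖x' - y‖ ^ 2)) := by
    rw [← hp4]; linarith
  have hpi := pi_pos
  field_simp
  field_simp at this
  linarith

noncomputable def kap (y : E3) : ℝ := max 0 (1 - ‖y‖ ^ 2)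

noncomputable def Psi (y : E3) : ℝ := kap y ^ 2 / 4

/-- The measure `dr dy` on `(0, R] × ℝ³`. -/
noncomputable def strip (R : ℝ) : Measure (ℝ × E3) :=
  (volume.restrict (Set.Ioc 0 R)).prod volume

theorem kap_nonneg (y : E3) : 0 ≤ kap y := le_max_left _ _
theorem kap_le_one (y : E3) : kap y ≤ 1 := max_le zero_le_one (by nlinarith [sq_nonneg ‖y‖])
theorem continuous_kap : Continuous kap := by unfold kap; fun_prop
theorem Psi_nonneg (y : E3) : 0 ≤ Psi y := by unfold Psi; positivity
theorem continuous_Psi : Continuous Psi := (continuous_kap.pow 2).div_const 4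

theorem kap_eq_zero {y : E3} (h : 1 ≤ ‖y‖) : kap y = 0 := max_eq_left (by nlinarith)

theorem Psi_eq_zero {y : E3} (h : 1 ≤ ‖y‖) : Psi y = 0 := by simp [Psi, kap_eq_zero h]

theorem integrable_of_ball {f : E3 → ℝ} (hf : Continuous f) (h0 : ∀ y, 1 ≤ ‖y‖ → f y = 0) :
    Integrable f := by
  refine hf.integrable_of_hasCompactSupport ?_
  refine HasCompactSupport.intro (isCompact_closedBall (0 : E3) 1) fun y hy => h0 y ?_
  rw [mem_closedBall_zero_iff] at hy; linarith

theorem integrable_kap : Integrable kap := integrable_of_ball continuous_kap fun _ => kap_eq_zero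
theorem integrable_Psi : Integrable Psi := integrable_of_ball continuous_Psi fun _ => Psi_eq_zero

theorem integral_pos_of_zero {f : E3 → ℝ} (hf : Continuous f) (h : ∀ y, 0 ≤ f y)
    (hi : Integrable f) (h0 : 0 < f 0) : 0 < ∫ y, f y := by
  refine (integral_pos_iff_support_of_nonneg h hi).2 ?_
  exact (hf.isOpen_support).measure_pos _ ⟨0, h0.ne'⟩

theorem integral_kap_pos : 0 < ∫ y, kap y :=
  integral_pos_of_zero continuous_kap kap_nonneg integrable_kap (by simp [kap])

theorem integral_Psi_pos : 0 < ∫ y, Psi y :=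
  integral_pos_of_zero continuous_Psi Psi_nonneg integrable_Psi (by simp [Psi, kap])

theorem hasDerivAt_max_sq (t : ℝ) : HasDerivAt (fun t : ℝ => (max 0 t) ^ 2) (2 * max 0 t) t := by
  rcases lt_trichotomy t 0 with h | h | h
  · rw [max_eq_left h.le, mul_zero]
    refine (hasDerivAt_const t (0:ℝ)).congr_of_eventuallyEq ?_
    filter_upwards [gt_mem_nhds h] with s hs
    simp [max_eq_left (le_of_lt hs)]
  · subst h
    rw [hasDerivAt_iff_isLittleO]
    simp only [max_self, mul_zero, smul_zero, sub_zero, ne_eq, OfNat.ofNat_ne_zero,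
      not_false_eq_true, zero_pow]
    refine Asymptotics.IsBigO.trans_isLittleO (g := fun t : ℝ => t ^ 2) ?_ ?_
    · refine Asymptotics.IsBigO.of_bound 1 (Eventually.of_forall fun s => ?_)
      rw [Real.norm_of_nonneg (by positivity), Real.norm_of_nonneg (by positivity), one_mul,
        ← sq_abs s]
      have : max 0 s ≤ |s| := max_le (abs_nonneg s) (le_abs_self s)
      gcongr
    · exact Asymptotics.isLittleO_pow_id one_lt_two
  · rw [max_eq_right h.le]
    have h1 : HasDerivAt (fun t : ℝ => t ^ 2) (2 * t) t := by simpa using hasDerivAt_pow 2 t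
    refine h1.congr_of_eventuallyEq ?_
    filter_upwards [lt_mem_nhds h] with s hs
    simp [max_eq_right (le_of_lt hs)]

theorem hasFDerivAt_Psi (y : E3) : HasFDerivAt Psi (-(kap y) • innerSL ℝ y) y := by
  have h1 : HasFDerivAt (fun y : E3 => 1 - ‖y‖ ^ 2) (-(2 • innerSL ℝ y)) y := by
    have h := (hasStrictFDerivAt_norm_sq y).hasFDerivAt
    exact h.const_sub 1
  have h2 := ((hasDerivAt_max_sq (1 - ‖y‖ ^ 2)).comp_hasFDerivAt y h1).mul_const (1 / 4 : ℝ)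
  have e : Psi = fun y : E3 => (max 0 (1 - ‖y‖ ^ 2)) ^ 2 * (1 / 4) := by
    ext y; simp only [Psi, kap]; ring
  rw [e]
  refine h2.congr_fderiv ?_
  ext v
  simp only [kap, smul_eq_mul, _root_.smul_apply,
    _root_.neg_apply, nsmul_eq_mul, Nat.cast_ofNat]
  simp
  ring

theorem fderiv_eq_sum (f : E3 → ℝ) (z y : E3) :
    fderiv ℝ f z y = ∑ i, y i * fderiv ℝ f z (EuclideanSpace.single i 1) := by
  conv_lhs => rw [← (EuclideanSpace.basisFun (Fin 3) ℝ).sum_repr y]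
  simp

theorem integrable_strip {h : ℝ × E3 → ℝ} (hc : Continuous h) (h0 : ∀ q, 1 ≤ ‖q.2‖ → h q = 0)
    (R : ℝ) : Integrable h (strip R) := by
  have h1 : IntegrableOn h (Set.Icc 0 R ×ˢ Metric.closedBall 0 1) (volume.prod volume) :=
    hc.continuousOn.integrableOn_compact (isCompact_Icc.prod (isCompact_closedBall 0 1))
  have e : strip R = (volume.prod volume).restrict (Set.Ioc 0 R ×ˢ Set.univ) := by
    rw [← Measure.prod_restrict, Measure.restrict_univ]; rfl
  rw [e]
  change IntegrableOn h _ _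
  refine h1.of_forall_sdiff_eq_zero (measurableSet_Ioc.prod MeasurableSet.univ) ?_
  rintro ⟨r, y⟩ ⟨hq1, hq2⟩
  refine h0 _ ?_
  by_contra hlt
  push Not at hlt
  exact hq2 ⟨Set.Ioc_subset_Icc_self hq1.1, by rw [mem_closedBall_zero_iff]; exact hlt.le⟩

theorem parts_ball {G : E3 → ℝ} (hG : ContDiff ℝ 1 G) (i : Fin 3) :
    ∫ y : E3, kap y * (y i * G y) = ∫ y, fderiv ℝ G y (EuclideanSpace.single i 1) * Psi y := by
  have hP : ∀ y, fderiv ℝ Psi y (EuclideanSpace.single i 1) = -(kap y * y i) := by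
    intro y
    rw [(hasFDerivAt_Psi y).fderiv]
    simp [EuclideanSpace.inner_single_right]
  have hc : Continuous fun y => fderiv ℝ G y (EuclideanSpace.single i 1) :=
    (hG.continuous_fderiv one_ne_zero).clm_apply continuous_const
  have h := integral_mul_fderiv_eq_neg_fderiv_mul_of_integrable (μ := (volume : Measure E3))
    (f := G) (g := Psi) (v := EuclideanSpace.single i 1) ?_ ?_ ?_
    (fun y _ => (hG.differentiable one_ne_zero) y) (fun y _ => (hasFDerivAt_Psi y).differentiableAt)
  · simp only [hP, mul_neg, integral_neg, neg_inj] at h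
    rw [← h]; congr 1; ext y; ring
  · exact integrable_of_ball (hc.mul continuous_Psi) fun y hy => by rw [Psi_eq_zero hy, mul_zero]
  · simp only [hP]
    refine integrable_of_ball (hG.continuous.mul (continuous_kap.mul (by fun_prop)).neg)
      fun y hy => by rw [kap_eq_zero hy]; ring
  · exact integrable_of_ball (hG.continuous.mul continuous_Psi) fun y hy => by
      rw [Psi_eq_zero hy, mul_zero]

theorem continuous_lap {f : E3 → ℝ} (hf : ContDiff ℝ 2 f) : Continuous (lap f) := by
  unfold lap
  refine continuous_finsetSum _ fun i _ => ?_
  have h1 : ContDiff ℝ 1 (fun y => fderiv ℝ f y (EuclideanSpace.single i 1)) :=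
    (hf.fderiv_right (by norm_num)).clm_apply contDiff_const
  exact (h1.continuous_fderiv one_ne_zero).clm_apply continuous_const

theorem parts_lap {f : E3 → ℝ} (hf : ContDiff ℝ 2 f) (x : E3) (r : ℝ) :
    ∫ y, fderiv ℝ f (x + r • y) y * kap y = ∫ y, r * (lap f (x + r • y) * Psi y) := by
  have hi1 : ∀ i : Fin 3, ContDiff ℝ 1 (fun y => fderiv ℝ f y (EuclideanSpace.single i 1)) :=
    fun i => (hf.fderiv_right (by norm_num)).clm_apply contDiff_const
  have hG : ∀ i : Fin 3, ContDiff ℝ 1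
      (fun y => fderiv ℝ f (x + r • y) (EuclideanSpace.single i 1)) := fun i =>
    (hi1 i).comp (by fun_prop)
  have hd : ∀ (i : Fin 3) (y : E3), fderiv ℝ (fun y => fderiv ℝ f (x + r • y)
      (EuclideanSpace.single i 1)) y (EuclideanSpace.single i 1) = r * fderiv ℝ (fun y => fderiv ℝ f y
        (EuclideanSpace.single i 1)) (x + r • y) (EuclideanSpace.single i 1) := by
    intro i y
    have h1 : HasFDerivAt (fun y : E3 => x + r • y) (r • ContinuousLinearMap.id ℝ E3) y :=
      ((hasFDerivAt_id y).const_smul r).const_add x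
    have h2 := (((hi1 i).differentiable one_ne_zero) (x + r • y)).hasFDerivAt.comp y h1
    have h3 := h2.fderiv
    simp only [Function.comp_def] at h3
    rw [h3]; simp
  have e1 : ∀ y, fderiv ℝ f (x + r • y) y * kap y =
      ∑ i, kap y * (y i * fderiv ℝ f (x + r • y) (EuclideanSpace.single i 1)) := by
    intro y; rw [fderiv_eq_sum, Finset.sum_mul]
    refine Finset.sum_congr rfl fun i _ => by ring
  have e2 : ∀ y, r * (lap f (x + r • y) * Psi y) = ∑ i, (fderiv ℝ (fun y => fderiv ℝ f (x + r • y)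
      (EuclideanSpace.single i 1)) y (EuclideanSpace.single i 1)) * Psi y := by
    intro y; simp only [hd, lap]
    rw [Finset.sum_mul, Finset.mul_sum]
    refine Finset.sum_congr rfl fun i _ => by ring
  simp_rw [e1, e2]
  rw [integral_finsetSum, integral_finsetSum]
  · exact Finset.sum_congr rfl fun i _ => parts_ball (hG i) i
  · intro i _
    exact integrable_of_ball ((((hG i).continuous_fderiv one_ne_zero).clm_apply
      continuous_const).mul continuous_Psi) fun y hy => by rw [Psi_eq_zero hy, mul_zero]
  · intro i _
    exact integrable_of_ball (continuous_kap.mul (Continuous.mul (by fun_prop) (hG i).continuous))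
      fun y hy => by rw [kap_eq_zero hy, zero_mul]

/-- A mean value formula for `C²` functions with weight `1 - |y|²` on balls. -/
theorem ball_mean {f : E3 → ℝ} (hf : ContDiff ℝ 2 f) (x : E3) {R : ℝ} (hR : 0 ≤ R) :
    ∫ y, f (x + R • y) * kap y = (∫ y, kap y) * f x +
      ∫ q, q.1 * (lap f (x + q.1 • q.2) * Psi q.2) ∂(strip R) := by
  have hf1 : ContDiff ℝ 1 f := hf.of_le (by norm_num)
  have hc1 : Continuous fun q : ℝ × E3 => fderiv ℝ f (x + q.1 • q.2) q.2 * kap q.2 := by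
    refine Continuous.mul ?_ (continuous_kap.comp continuous_snd)
    exact ((hf1.continuous_fderiv one_ne_zero).comp (by fun_prop)).clm_apply continuous_snd
  have hI1 := integrable_strip hc1 (fun q hq => by rw [kap_eq_zero hq, mul_zero]) R
  have hc2 : Continuous fun q : ℝ × E3 => q.1 * (lap f (x + q.1 • q.2) * Psi q.2) :=
    continuous_fst.mul (((continuous_lap hf).comp (by fun_prop)).mul
      (continuous_Psi.comp continuous_snd))
  have hI2 := integrable_strip hc2 (fun q hq => by rw [Psi_eq_zero hq]; ring) R
  have h1 : ∫ q, q.1 * (lap f (x + q.1 • q.2) * Psi q.2) ∂(strip R) =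
      ∫ q, fderiv ℝ f (x + q.1 • q.2) q.2 * kap q.2 ∂(strip R) := by
    unfold strip at *
    rw [integral_prod _ hI2, integral_prod _ hI1]
    refine integral_congr_ae (Eventually.of_forall fun r => ?_)
    exact (parts_lap hf x r).symm
  rw [h1]
  unfold strip at *
  rw [integral_prod_symm _ hI1]
  have h2 : ∀ y : E3, ∫ r in Set.Ioc 0 R, fderiv ℝ f (x + r • y) y * kap y =
      f (x + R • y) * kap y - kap y * f x := by
    intro y
    rw [integral_mul_const, ← intervalIntegral.integral_of_le hR,
      intervalIntegral.integral_eq_sub_of_hasDerivAt (f := fun r => f (x + r • y))]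
    · simp; ring
    · intro r _
      have h1 : HasDerivAt (fun r : ℝ => x + r • y) y r := by
        simpa using ((hasDerivAt_id r).smul_const y).const_add x
      exact ((hf1.differentiable one_ne_zero) _).hasFDerivAt.comp_hasDerivAt r h1
    · refine Continuous.intervalIntegrable ?_ _ _
      exact ((hf1.continuous_fderiv one_ne_zero).comp (by fun_prop)).clm_apply continuous_const
  simp_rw [h2]
  rw [integral_sub, integral_mul_const]
  · ring
  · exact integrable_of_ball ((hf.continuous.comp (by fun_prop)).mul continuous_kap)
      fun y hy => by rw [kap_eq_zero hy, mul_zero]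
  · exact integrable_kap.mul_const _

/-- The regularised logarithm `½ log (|z|² + e²)`. -/
noncomputable def logE (e : ℝ) (z : E3) : ℝ := 1 / 2 * log (‖z‖ ^ 2 + e ^ 2)

theorem contDiff_logE {e : ℝ} (he : e ≠ 0) {n : WithTop ℕ∞} : ContDiff ℝ n (logE e) := by
  unfold logE
  refine contDiff_const.mul (ContDiff.log ?_ fun z => by positivity)
  exact (contDiff_norm_sq ℝ).add contDiff_const

theorem hasFDerivAt_logE {e : ℝ} (he : e ≠ 0) (z : E3) :
    HasFDerivAt (logE e) ((‖z‖ ^ 2 + e ^ 2)⁻¹ • innerSL ℝ z) z := by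
  have h1 : HasFDerivAt (fun z : E3 => ‖z‖ ^ 2 + e ^ 2) (2 • innerSL ℝ z) z :=
    (hasStrictFDerivAt_norm_sq z).hasFDerivAt.add_const _
  have h2 := (h1.log (by positivity)).const_mul (1 / 2 : ℝ)
  refine h2.congr_fderiv ?_
  ext v
  simp
  ring

theorem lap_logE {e : ℝ} (he : e ≠ 0) (z : E3) :
    lap (logE e) z = (‖z‖ ^ 2 + 3 * e ^ 2) / (‖z‖ ^ 2 + e ^ 2) ^ 2 := by
  have h1 : ∀ (i : Fin 3), (fun y => fderiv ℝ (logE e) y (EuclideanSpace.single i 1)) =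
      fun y => (‖y‖ ^ 2 + e ^ 2)⁻¹ * y i := by
    intro i; ext y
    rw [(hasFDerivAt_logE he y).fderiv]
    simp [EuclideanSpace.inner_single_right]
  have h2 : ∀ i : Fin 3, fderiv ℝ (fun y : E3 => (‖y‖ ^ 2 + e ^ 2)⁻¹ * y i) z
      (EuclideanSpace.single i 1) = (‖z‖ ^ 2 + e ^ 2)⁻¹ - 2 * z i ^ 2 / (‖z‖ ^ 2 + e ^ 2) ^ 2 := by
    intro i
    have hn : HasFDerivAt (fun z : E3 => ‖z‖ ^ 2 + e ^ 2) (2 • innerSL ℝ z) z :=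
      (hasStrictFDerivAt_norm_sq z).hasFDerivAt.add_const _
    have hN : ‖z‖ ^ 2 + e ^ 2 ≠ 0 := by positivity
    have hi : HasFDerivAt (fun y : E3 => y i) (EuclideanSpace.proj i : E3 →L[ℝ] ℝ) z :=
      (EuclideanSpace.proj i : E3 →L[ℝ] ℝ).hasFDerivAt
    have hinv := (hasDerivAt_inv hN).comp_hasFDerivAt z hn
    have := (hinv.mul hi).fderiv
    simp only [Function.comp_def] at this
    rw [show (fun y : E3 => (‖y‖ ^ 2 + e ^ 2)⁻¹ * y i) = (fun x : E3 => (‖x‖ ^ 2 + e ^ 2)⁻¹) *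
      fun y => y i from rfl, this]
    simp [EuclideanSpace.inner_single_right]
    field_simp
    ring
  unfold lap
  simp_rw [h1, h2]
  have h3 : ‖z‖ ^ 2 = ∑ i, z i ^ 2 := by
    rw [EuclideanSpace.norm_sq_eq]; simp
  have hN : ‖z‖ ^ 2 + e ^ 2 ≠ 0 := by positivity
  rw [Finset.sum_sub_distrib, ← Finset.sum_div, ← Finset.mul_sum, ← h3]
  simp
  field_simp
  ring

instance (R : ℝ) : SFinite (strip R) := by unfold strip; infer_instance

theorem ae_strip_ne (R : ℝ) (a : E3) : ∀ᵐ q ∂(strip R), 0 < q.1 ∧ a + q.1 • q.2 ≠ 0 := by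
  have hm : MeasurableSet {q : ℝ × E3 | ¬ (0 < q.1 ∧ a + q.1 • q.2 ≠ 0)} := by
    refine MeasurableSet.compl (MeasurableSet.inter ?_ ?_)
    · exact (isOpen_lt continuous_const continuous_fst).measurableSet
    · refine IsOpen.measurableSet ?_
      exact isOpen_ne_fun (by fun_prop) continuous_const
  rw [ae_iff]
  unfold strip
  rw [Measure.measure_prod_null hm]
  refine (ae_restrict_iff' measurableSet_Ioc).2 (Eventually.of_forall fun r hr => ?_)
  refine measure_mono_null (t := {-(r⁻¹ • a)}) ?_ (measure_singleton _)
  intro y hy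
  have hr0 : 0 < r := hr.1
  simp only [Set.mem_preimage, Set.mem_ofPred_eq, hr0, true_and, not_not] at hy
  have : r • y = -a := by rw [eq_neg_iff_add_eq_zero, add_comm]; exact hy
  rw [Set.mem_singleton_iff, ← smul_neg, ← this, smul_smul, inv_mul_cancel₀ hr0.ne', one_smul]

noncomputable def kR (R : ℝ) (a : E3) : ℝ :=
  ∫ q, q.1 * (1 / ‖a + q.1 • q.2‖ ^ 2 * Psi q.2) ∂(strip R)

theorem abs_log_le {t : ℝ} (ht : 0 < t) : |log t| ≤ 2 + t ^ 2 + 1 / t ^ 2 := by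
  have h1 := Real.log_le_sub_one_of_pos ht
  have h2 := Real.log_le_sub_one_of_pos (inv_pos.2 ht)
  rw [Real.log_inv] at h2
  have h3 : 1 / t ^ 2 = t⁻¹ ^ 2 := by simp
  rw [abs_le]; constructor
  · nlinarith [sq_nonneg (t⁻¹ - 1), sq_nonneg t]
  · nlinarith [sq_nonneg (t - 1), sq_nonneg t⁻¹]

theorem abs_logE_le {e : ℝ} (he1 : |e| ≤ 1) {z : E3} (hz : z ≠ 0) :
    |logE e z| ≤ 2 + 2 * ‖z‖ ^ 2 + 1 / ‖z‖ ^ 2 := by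
  have h0 : 0 < ‖z‖ := norm_pos_iff.2 hz
  have he2 : e ^ 2 ≤ 1 := by rw [← sq_abs]; nlinarith [abs_nonneg e]
  have h1 := abs_log_le h0
  have h2 : log ‖z‖ ≤ logE e z := by
    unfold logE
    have : log (‖z‖ ^ 2) ≤ log (‖z‖ ^ 2 + e ^ 2) := Real.log_le_log (by positivity) (by nlinarith)
    rw [Real.log_pow] at this; push_cast at this; linarith
  have h3 : logE e z ≤ ‖z‖ ^ 2 := by
    unfold logE
    have := Real.log_le_sub_one_of_pos (show 0 < ‖z‖ ^ 2 + e ^ 2 by positivity)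
    nlinarith [sq_nonneg ‖z‖]
  have h4 : 0 ≤ 1 / ‖z‖ ^ 2 := by positivity
  have h5 := (abs_le.1 h1).1
  rw [abs_le]; constructor <;> nlinarith

theorem integrable_kap_log_bound (a : E3) {R : ℝ} (hR : 0 < R) :
    Integrable fun y => (2 + 2 * ‖a + R • y‖ ^ 2 + 1 / ‖a + R • y‖ ^ 2) * kap y := by
  have h1 : Integrable fun y => (2 + 2 * ‖a + R • y‖ ^ 2) * kap y :=
    integrable_of_ball (Continuous.mul (by fun_prop) continuous_kap) fun y hy => by
      rw [kap_eq_zero hy, mul_zero]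
  have h2 := (integrable_mul_inv_sq continuous_kap integrable_kap (-(R⁻¹ • a))).const_mul (1 / R ^ 2)
  refine (h1.add h2).congr (Eventually.of_forall fun y => ?_)
  have : ‖a + R • y‖ = R * ‖-(R⁻¹ • a) - y‖ := by
    have h : a + R • y = (-R) • (-(R⁻¹ • a) - y) := by
      rw [smul_sub, neg_smul, smul_neg, smul_smul, mul_inv_cancel₀ hR.ne']
      simp
    rw [h, norm_smul, norm_neg, Real.norm_of_nonneg hR.le]
  simp only [Pi.add_apply]
  rw [add_mul _ _ (kap y)]
  rw [this, mul_pow]; field_simp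

theorem lap_logE_le {e : ℝ} {z : E3} (hz : z ≠ 0) (he : e ≠ 0) :
    0 ≤ lap (logE e) z ∧ lap (logE e) z ≤ 3 * (1 / ‖z‖ ^ 2) := by
  have h0 : 0 < ‖z‖ := norm_pos_iff.2 hz
  rw [lap_logE he]
  refine ⟨by positivity, ?_⟩
  rw [← mul_div_assoc, div_le_div_iff₀ (by positivity) (by positivity)]
  nlinarith [sq_nonneg (‖z‖ ^ 2), sq_nonneg (e ^ 2), mul_nonneg (sq_nonneg ‖z‖) (sq_nonneg e)]

theorem tendsto_lap_logE {z : E3} (hz : z ≠ 0) :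
    Tendsto (fun e : ℝ => lap (logE e) z) (𝓝[>] 0) (𝓝 (1 / ‖z‖ ^ 2)) := by
  have h0 : 0 < ‖z‖ := norm_pos_iff.2 hz
  have hc : ContinuousAt (fun e : ℝ => (‖z‖ ^ 2 + 3 * e ^ 2) / (‖z‖ ^ 2 + e ^ 2) ^ 2) 0 := by
    refine ContinuousAt.div (by fun_prop) (by fun_prop) (by positivity)
  have h := hc.tendsto
  have e1 : (‖z‖ ^ 2 + 3 * (0:ℝ) ^ 2) / (‖z‖ ^ 2 + 0 ^ 2) ^ 2 = 1 / ‖z‖ ^ 2 := by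
    field_simp; ring
  rw [e1] at h
  refine (h.mono_left nhdsWithin_le_nhds).congr' ?_
  filter_upwards [self_mem_nhdsWithin] with e he
  exact (lap_logE (ne_of_gt he) z).symm

theorem tendsto_logE {z : E3} (hz : z ≠ 0) :
    Tendsto (fun e : ℝ => logE e z) (𝓝[>] 0) (𝓝 (log ‖z‖)) := by
  have h0 : 0 < ‖z‖ := norm_pos_iff.2 hz
  have hc : ContinuousAt (fun e : ℝ => logE e z) 0 := by
    unfold logE
    refine ContinuousAt.mul continuousAt_const (ContinuousAt.log (by fun_prop) (by positivity))
  have h := hc.tendsto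
  have e1 : logE 0 z = log ‖z‖ := by
    unfold logE
    rw [zero_pow two_ne_zero, add_zero, Real.log_pow]; push_cast; ring
  rw [e1] at h
  exact h.mono_left nhdsWithin_le_nhds

theorem ae_ne_affine (a : E3) {R : ℝ} (hR : R ≠ 0) : ∀ᵐ y : E3, a + R • y ≠ 0 := by
  filter_upwards [Measure.ae_ne volume (-(R⁻¹ • a))] with y hy h
  refine hy ?_
  have : R • y = -a := by rw [eq_neg_iff_add_eq_zero, add_comm]; exact h
  rw [← smul_neg, ← this, smul_smul, inv_mul_cancel₀ hR, one_smul]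

theorem integrable_log_kap (a : E3) {R : ℝ} (hR : 0 < R) :
    Integrable fun y => log ‖a + R • y‖ * kap y := by
  refine (integrable_kap_log_bound a hR).mono' ?_ ?_
  · exact (Measurable.mul (by fun_prop) continuous_kap.measurable).aestronglyMeasurable
  · filter_upwards [ae_ne_affine a hR.ne'] with y hy
    have h0 : 0 < ‖a + R • y‖ := norm_pos_iff.2 hy
    rw [norm_mul, Real.norm_of_nonneg (kap_nonneg y), Real.norm_eq_abs]
    have := abs_log_le h0
    have := kap_nonneg y
    gcongr
    nlinarith [sq_nonneg ‖a + R • y‖]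

theorem logE_sub_le {e : ℝ} (he : e ≠ 0) {a : E3} (ha : a ≠ 0) {R : ℝ} (hR : 0 < R) (y : E3) :
    logE e (a + R • y) * kap y ≤ (logE e a + log (1 + R / ‖a‖)) * kap y := by
  have h0 : 0 < ‖a‖ := norm_pos_iff.2 ha
  by_cases hy : 1 ≤ ‖y‖
  · simp [kap_eq_zero hy]
  push Not at hy
  refine mul_le_mul_of_nonneg_right ?_ (kap_nonneg y)
  have h1 : ‖a + R • y‖ ≤ ‖a‖ + R := by
    refine (norm_add_le _ _).trans ?_
    rw [norm_smul, Real.norm_of_nonneg hR.le]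
    nlinarith
  have h : 0 < ‖a + R • y‖ ^ 2 + e ^ 2 := by positivity
  · unfold logE
    have h2 : ‖a + R • y‖ ^ 2 + e ^ 2 ≤ (1 + R / ‖a‖) ^ 2 * (‖a‖ ^ 2 + e ^ 2) := by
      have e1 : (1 + R / ‖a‖) ^ 2 * ‖a‖ ^ 2 = (‖a‖ + R) ^ 2 := by field_simp
      have e2 : e ^ 2 ≤ (1 + R / ‖a‖) ^ 2 * e ^ 2 := by
        have : 1 ≤ (1 + R / ‖a‖) ^ 2 := one_le_pow₀ (by linarith [show 0 < R / ‖a‖ by positivity])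
        nlinarith [sq_nonneg e]
      have e3 : ‖a + R • y‖ ^ 2 ≤ (‖a‖ + R) ^ 2 := by gcongr
      linarith
    have h3 := Real.log_le_log h h2
    rw [Real.log_mul (by positivity) (by positivity), Real.log_pow] at h3
    push_cast at h3
    linarith

theorem integral_lap_logE_le {e : ℝ} (he : e ≠ 0) {a : E3} (ha : a ≠ 0) {R : ℝ} (hR : 0 < R) :
    ∫ q, q.1 * (lap (logE e) (a + q.1 • q.2) * Psi q.2) ∂(strip R) ≤
      (∫ y, kap y) * log (1 + R / ‖a‖) := by
  have h := ball_mean (contDiff_logE he) a hR.le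
  have h2 : ∫ y, logE e (a + R • y) * kap y ≤ ∫ y, (logE e a + log (1 + R / ‖a‖)) * kap y := by
    refine integral_mono ?_ (integrable_kap.const_mul _) (logE_sub_le he ha hR)
    exact integrable_of_ball (((contDiff_logE (n := 0) he).continuous.comp (by fun_prop)).mul
      continuous_kap) fun y hy => by rw [kap_eq_zero hy, mul_zero]
  rw [integral_const_mul] at h2
  linarith

theorem integrable_of_tendsto_liminf {α : Type*} [MeasurableSpace α] {μ : Measure α}
    {G : ℕ → α → ℝ} {f : α → ℝ} (hGf : ∀ᵐ x ∂μ, Tendsto (fun n => G n x) atTop (𝓝 (f x)))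
    (hG : ∀ n, AEStronglyMeasurable (G n) μ)
    (hG' : liminf (fun n => ∫⁻ x, ‖G n x‖ₑ ∂μ) atTop ≠ ⊤) : Integrable f μ := by
  refine ⟨aestronglyMeasurable_of_tendsto_ae _ hG hGf, lt_of_le_of_lt ?_ hG'.lt_top⟩
  calc ∫⁻ x, ‖f x‖ₑ ∂μ = ∫⁻ x, liminf (fun n => ‖G n x‖ₑ) atTop ∂μ :=
        lintegral_congr_ae (by filter_upwards [hGf] with x hx using hx.enorm.liminf_eq.symm)
    _ ≤ _ := lintegral_liminf_le' fun n => (hG n).aemeasurable.enorm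

theorem integrable_kR {a : E3} (ha : a ≠ 0) {R : ℝ} (hR : 0 < R) :
    Integrable (fun q : ℝ × E3 => q.1 * (1 / ‖a + q.1 • q.2‖ ^ 2 * Psi q.2)) (strip R) := by
  set F : ℝ → ℝ × E3 → ℝ := fun e q => q.1 * (lap (logE e) (a + q.1 • q.2) * Psi q.2) with hF
  have hc : ∀ e : ℝ, e ≠ 0 → Continuous (F e) := fun e he =>
    continuous_fst.mul (((continuous_lap (contDiff_logE he)).comp (by fun_prop)).mul
      (continuous_Psi.comp continuous_snd))
  have hi : ∀ e : ℝ, e ≠ 0 → Integrable (F e) (strip R) := fun e he =>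
    integrable_strip (hc e he) (fun q hq => by simp [hF, Psi_eq_zero hq]) R
  have hn : Tendsto (fun n : ℕ => 1 / ((n : ℝ) + 1)) atTop (𝓝[>] 0) := by
    refine tendsto_nhdsWithin_iff.2 ⟨tendsto_one_div_add_atTop_nhds_zero_nat, ?_⟩
    exact Eventually.of_forall fun n => Set.mem_Ioi.2 (by positivity)
  have hn0 : ∀ n : ℕ, 1 / ((n : ℝ) + 1) ≠ 0 := fun n => by positivity
  refine integrable_of_tendsto_liminf (G := fun n : ℕ => F (1 / ((n : ℝ) + 1))) ?_
    (fun n => (hc _ (hn0 n)).aestronglyMeasurable) ?_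
  · filter_upwards [ae_strip_ne R a] with q hq
    exact (((tendsto_lap_logE hq.2).comp hn).mul_const _).const_mul _
  · refine ne_top_of_le_ne_top (b := ENNReal.ofReal ((∫ y, kap y) * log (1 + R / ‖a‖)))
      ENNReal.ofReal_ne_top ?_
    refine liminf_le_of_le (by isBoundedDefault) ?_
    intro b hb
    obtain ⟨n, hn⟩ := hb.exists
    refine hn.trans ?_
    have h0 : ∀ᵐ q ∂(strip R), 0 ≤ F (1 / ((n : ℝ) + 1)) q := by
      filter_upwards [ae_strip_ne R a] with q hq
      exact mul_nonneg hq.1.le (mul_nonneg (lap_logE_le hq.2 (hn0 n)).1 (Psi_nonneg _))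
    calc _ = ∫⁻ q, ENNReal.ofReal (F (1 / ((n : ℝ) + 1)) q) ∂(strip R) := by
          refine lintegral_congr_ae ?_
          filter_upwards [h0] with q hq
          rw [Real.enorm_eq_ofReal hq]
      _ = ENNReal.ofReal (∫ q, F (1 / ((n : ℝ) + 1)) q ∂(strip R)) :=
          (ofReal_integral_eq_lintegral_ofReal (hi _ (hn0 n)) h0).symm
      _ ≤ _ := ENNReal.ofReal_le_ofReal (integral_lap_logE_le (hn0 n) ha hR)

theorem kR_eq {a : E3} (ha : a ≠ 0) {R : ℝ} (hR : 0 < R) :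
    kR R a = (∫ y, log ‖a + R • y‖ * kap y) - (∫ y, kap y) * log ‖a‖ := by
  have h1 : Tendsto (fun e : ℝ => ∫ q, q.1 * (lap (logE e) (a + q.1 • q.2) * Psi q.2) ∂(strip R))
      (𝓝[>] 0) (𝓝 (kR R a)) := by
    refine tendsto_integral_filter_of_dominated_convergence _ ?_ ?_
      ((integrable_kR ha hR).const_mul 3) ?_
    · filter_upwards [self_mem_nhdsWithin] with e he
      exact (continuous_fst.mul (((continuous_lap (contDiff_logE (ne_of_gt he))).comp
        (by fun_prop)).mul (continuous_Psi.comp continuous_snd))).aestronglyMeasurable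
    · filter_upwards [self_mem_nhdsWithin] with e he
      filter_upwards [ae_strip_ne R a] with q hq
      have h := lap_logE_le hq.2 (ne_of_gt he)
      have hp := Psi_nonneg q.2
      have hq1 := hq.1
      rw [Real.norm_of_nonneg (mul_nonneg hq1.le (mul_nonneg h.1 hp))]
      calc _ ≤ q.1 * (3 * (1 / ‖a + q.1 • q.2‖ ^ 2) * Psi q.2) := by gcongr; exact h.2
        _ = _ := by ring
    · filter_upwards [ae_strip_ne R a] with q hq
      exact ((tendsto_lap_logE hq.2).mul_const _).const_mul _
  have h2 : Tendsto (fun e : ℝ => (∫ y, logE e (a + R • y) * kap y) - (∫ y, kap y) * logE e a)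
      (𝓝[>] 0) (𝓝 ((∫ y, log ‖a + R • y‖ * kap y) - (∫ y, kap y) * log ‖a‖)) := by
    refine Tendsto.sub ?_ ((tendsto_logE ha).const_mul _)
    refine tendsto_integral_filter_of_dominated_convergence _ ?_ ?_
      (integrable_kap_log_bound a hR) ?_
    · filter_upwards [self_mem_nhdsWithin] with e he
      exact (((contDiff_logE (n := 0) (ne_of_gt he)).continuous.comp (by fun_prop)).mul
        continuous_kap).aestronglyMeasurable
    · filter_upwards [Ioc_mem_nhdsGT one_pos] with e he
      filter_upwards [ae_ne_affine a hR.ne'] with y hy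
      have h := abs_logE_le (e := e) (by rw [abs_of_pos he.1]; exact he.2) hy
      have := kap_nonneg y
      rw [norm_mul, Real.norm_of_nonneg this, Real.norm_eq_abs]
      gcongr
    · filter_upwards [ae_ne_affine a hR.ne'] with y hy
      exact (tendsto_logE hy).mul_const _
  refine tendsto_nhds_unique h1 (h2.congr' ?_)
  filter_upwards [self_mem_nhdsWithin] with e he
  rw [ball_mean (contDiff_logE (ne_of_gt he)) a hR.le]
  ring

theorem kR_nonneg (R : ℝ) (a : E3) : 0 ≤ kR R a := by
  refine integral_nonneg_of_ae ?_
  filter_upwards [ae_strip_ne R a] with q hq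
  exact mul_nonneg hq.1.le (mul_nonneg (by positivity) (Psi_nonneg _))

theorem kR_le {a : E3} (ha : a ≠ 0) {R : ℝ} (hR : 0 < R) :
    kR R a ≤ (∫ y, kap y) * log (1 + R / ‖a‖) := by
  have h0 : 0 < ‖a‖ := norm_pos_iff.2 ha
  rw [kR_eq ha hR]
  have h2 : ∫ y, log ‖a + R • y‖ * kap y ≤ ∫ y, (log ‖a‖ + log (1 + R / ‖a‖)) * kap y := by
    refine integral_mono_ae (integrable_log_kap a hR) (integrable_kap.const_mul _) ?_
    filter_upwards [ae_ne_affine a hR.ne'] with y hy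
    by_cases hy1 : 1 ≤ ‖y‖
    · simp [kap_eq_zero hy1]
    push Not at hy1
    refine mul_le_mul_of_nonneg_right ?_ (kap_nonneg y)
    rw [← Real.log_mul h0.ne' (by positivity)]
    refine Real.log_le_log (norm_pos_iff.2 hy) ?_
    refine (norm_add_le _ _).trans ?_
    rw [norm_smul, Real.norm_of_nonneg hR.le]
    field_simp
    nlinarith
  rw [integral_const_mul] at h2
  linarith

theorem integrable_mul_kR {ρ : E3 → ℝ} (hρc : Continuous ρ) (hρ : Integrable ρ) {R : ℝ} (hR : 0 < R)
    (x : E3) : Integrable fun z => ρ z * kR R (x - z) := by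
  have hZ := integral_kap_pos
  refine (((integrable_mul_inv_sq hρc hρ x).norm.add hρ.norm).const_mul
    ((∫ y, kap y) * R)).mono' ?_ ?_
  · refine hρc.aestronglyMeasurable.mul ?_
    have hm : StronglyMeasurable fun p : E3 × (ℝ × E3) =>
        p.2.1 * (1 / ‖x - p.1 + p.2.1 • p.2.2‖ ^ 2 * Psi p.2.2) := by
      have := continuous_Psi.measurable
      exact Measurable.stronglyMeasurable (by fun_prop)
    exact hm.integral_prod_right'.aestronglyMeasurable
  · filter_upwards [Measure.ae_ne volume x] with z hz
    have hxz : x - z ≠ 0 := sub_ne_zero.2 hz.symm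
    have h0 : 0 < ‖x - z‖ := norm_pos_iff.2 hxz
    have h1 := kR_le hxz hR
    have h2 := Real.log_le_sub_one_of_pos (show 0 < 1 + R / ‖x - z‖ by positivity)
    have h3 : 1 / ‖x - z‖ ≤ 1 / ‖x - z‖ ^ 2 + 1 := by
      have : 1 / ‖x - z‖ ^ 2 = (1 / ‖x - z‖) ^ 2 := by simp
      rw [this]; nlinarith [sq_nonneg (1 / ‖x - z‖ - 1), sq_nonneg (1 / ‖x - z‖)]
    have h4 : kR R (x - z) ≤ (∫ y, kap y) * R * (1 / ‖x - z‖ ^ 2 + 1) := by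
      calc _ ≤ (∫ y, kap y) * (R / ‖x - z‖) := by
            refine h1.trans ?_; gcongr; linarith
        _ = (∫ y, kap y) * R * (1 / ‖x - z‖) := by ring
        _ ≤ _ := by gcongr
    rw [norm_mul, Real.norm_of_nonneg (kR_nonneg _ _)]
    simp only [Pi.add_apply, norm_mul]
    rw [Real.norm_of_nonneg (show 0 ≤ 1 / ‖x - z‖ ^ 2 by positivity)]
    calc _ ≤ ‖ρ z‖ * ((∫ y, kap y) * R * (1 / ‖x - z‖ ^ 2 + 1)) := by gcongr
      _ = _ := by ring

/-- If `-Δu` is a Riesz potential plus a constant, then `u` satisfies a mean value identity. -/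
theorem mean_identity {u ρ : E3 → ℝ} {c : ℝ} (hu : ContDiff ℝ 2 u) (hρc : Continuous ρ)
    (hρ : Integrable ρ)
    (hlap : ∀ x, -lap u x = 1 / π ^ 2 * (∫ y, ρ y * (1 / ‖x - y‖ ^ 2)) + c)
    {R : ℝ} (hR : 0 < R) (x : E3) :
    (∫ y, kap y) * u x = (∫ y, u (x + R • y) * kap y) +
      1 / π ^ 2 * (∫ z, ρ z * kR R (x - z)) + c * R ^ 2 / 2 * ∫ y, Psi y := by
  have h := ball_mean hu x hR.le
  set G : ℝ × E3 → E3 → ℝ := fun q z => ρ z * (q.1 * (1 / ‖x - z + q.1 • q.2‖ ^ 2 * Psi q.2)) with hG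
  have hGm : AEStronglyMeasurable (Function.uncurry G) ((strip R).prod volume) := by
    have := continuous_Psi.measurable
    have := hρc.measurable
    refine Measurable.aestronglyMeasurable ?_
    simp only [hG, Function.uncurry_def]
    fun_prop
  have hGi : Integrable (Function.uncurry G) ((strip R).prod volume) := by
    rw [integrable_prod_iff' hGm]
    constructor
    · filter_upwards [Measure.ae_ne volume x] with z hz
      exact (integrable_kR (sub_ne_zero.2 hz.symm) hR).const_mul (ρ z)
    · refine (integrable_mul_kR hρc hρ hR x).norm.congr (Eventually.of_forall fun z => ?_)
      simp only [Function.uncurry, hG, norm_mul (ρ z)]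
      rw [integral_const_mul, Real.norm_of_nonneg (kR_nonneg _ _)]
      congr 1
      refine integral_congr_ae ?_
      filter_upwards [ae_strip_ne R (x - z)] with q hq
      rw [Real.norm_of_nonneg]
      exact mul_nonneg hq.1.le (mul_nonneg (by positivity) (Psi_nonneg _))
  have hsw := integral_integral_swap hGi
  have e1 : ∀ z, ∫ q, G q z ∂(strip R) = ρ z * kR R (x - z) := fun z => integral_const_mul _ _
  simp_rw [e1] at hsw
  have e2 : ∀ q : ℝ × E3, q.1 * (lap u (x + q.1 • q.2) * Psi q.2) =
      -(1 / π ^ 2 * ∫ z, G q z) - c * (q.1 * Psi q.2) := by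
    intro q
    have h1 : ∫ z, G q z = (q.1 * Psi q.2) * ∫ y, ρ y * (1 / ‖x + q.1 • q.2 - y‖ ^ 2) := by
      rw [← integral_const_mul]; congr 1; ext z
      simp only [hG]
      rw [show x - z + q.1 • q.2 = x + q.1 • q.2 - z by abel]; ring
    rw [h1]
    have := hlap (x + q.1 • q.2)
    rw [show lap u (x + q.1 • q.2) = -(1 / π ^ 2 * (∫ y, ρ y * (1 / ‖x + q.1 • q.2 - y‖ ^ 2)) + c) by
      rw [← this]; ring]
    ring
  have hi1 : Integrable (fun q => -(1 / π ^ 2 * ∫ z, G q z)) (strip R) :=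
    (hGi.integral_prod_left.const_mul _).neg
  have hi2 : Integrable (fun q : ℝ × E3 => c * (q.1 * Psi q.2)) (strip R) :=
    (integrable_strip (continuous_fst.mul (continuous_Psi.comp continuous_snd))
      (fun q hq => by simp [Psi_eq_zero hq]) R).const_mul c
  have e3 : ∫ q : ℝ × E3, q.1 * Psi q.2 ∂(strip R) = R ^ 2 / 2 * ∫ y, Psi y := by
    unfold strip
    rw [integral_prod_mul (fun r : ℝ => r) Psi, ← intervalIntegral.integral_of_le hR.le, integral_id]
    ring
  rw [integral_congr_ae (Eventually.of_forall e2), integral_sub hi1 hi2, integral_neg,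
    integral_const_mul, integral_const_mul, hsw, e3] at h
  rw [h]; ring

/-- `-Δu` equals the Riesz potential of `e^{3u}` plus the constant `c`. -/
structure IsRep (u : E3 → ℝ) (c : ℝ) : Prop where
  smooth : ContDiff ℝ 2 u
  int : Integrable fun x => exp (3 * u x)
  lap_eq : ∀ x, -lap u x = 1 / π ^ 2 * (∫ y, exp (3 * u y) * (1 / ‖x - y‖ ^ 2)) + c

theorem IsRep.cont {u : E3 → ℝ} {c : ℝ} (h : IsRep u c) : Continuous fun x => exp (3 * u x) := by
  have := h.smooth.continuous
  fun_prop

theorem le_exp_three (t : ℝ) : t ≤ exp (3 * t) := by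
  rcases le_or_gt 0 t with h | h
  · have := Real.add_one_le_exp (3 * t); linarith
  · exact h.le.trans (exp_pos _).le

theorem exp_three_mass_pos {u : E3 → ℝ} {c : ℝ} (h : IsRep u c) : 0 < ∫ x, exp (3 * u x) :=
  integral_pos_of_zero h.cont (fun _ => (exp_pos _).le) h.int (exp_pos _)

theorem mean_le_mass {u : E3 → ℝ} {c : ℝ} (h : IsRep u c) {R : ℝ} (hR : 0 < R) (x : E3) :
    ∫ y, u (x + R • y) * kap y ≤ (R ^ 3)⁻¹ * ∫ y, exp (3 * u y) := by
  have hi : Integrable fun y : E3 => exp (3 * u (x + R • y)) :=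
    (h.int.comp_add_left x).comp_smul hR.ne'
  calc ∫ y, u (x + R • y) * kap y ≤ ∫ y, exp (3 * u (x + R • y)) := by
        refine integral_mono ?_ hi fun y => ?_
        · exact integrable_of_ball ((h.smooth.continuous.comp (by fun_prop)).mul continuous_kap)
            fun y hy => by rw [kap_eq_zero hy, mul_zero]
        · have h1 := le_exp_three (u (x + R • y))
          have h2 := kap_nonneg y
          have h3 := kap_le_one y
          have h4 := exp_pos (3 * u (x + R • y))
          calc _ ≤ exp (3 * u (x + R • y)) * kap y := by gcongr
            _ ≤ _ := by nlinarith
    _ = _ := by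
        rw [Measure.integral_comp_smul volume (fun y => exp (3 * u (x + y))) R, finrank_E3,
          integral_add_left_eq_self (μ := volume) (fun y => exp (3 * u y)) x,
          abs_of_pos (by positivity), smul_eq_mul]

theorem integrable_mul_log {ρ : E3 → ℝ} (hρc : Continuous ρ) (hρ : Integrable ρ) (x : E3) :
    Integrable fun z => ρ z * log (1 + 1 / ‖x - z‖) := by
  refine ((integrable_mul_inv_sq hρc hρ x).norm.add hρ.norm).mono' ?_ ?_
  · exact hρc.aestronglyMeasurable.mul (Measurable.aestronglyMeasurable (by fun_prop))
  · filter_upwards [Measure.ae_ne volume x] with z hz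
    have h0 : 0 < ‖x - z‖ := norm_pos_iff.2 (sub_ne_zero.2 hz.symm)
    have h2 := Real.log_le_sub_one_of_pos (show 0 < 1 + 1 / ‖x - z‖ by positivity)
    have h1 : 0 ≤ log (1 + 1 / ‖x - z‖) := by
      apply Real.log_nonneg; linarith [show 0 < 1 / ‖x - z‖ by positivity]
    have h3 : 1 / ‖x - z‖ ≤ 1 / ‖x - z‖ ^ 2 + 1 := by
      have : 1 / ‖x - z‖ ^ 2 = (1 / ‖x - z‖) ^ 2 := by simp
      rw [this]; nlinarith [sq_nonneg (1 / ‖x - z‖ - 1), sq_nonneg (1 / ‖x - z‖)]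
    simp only [Pi.add_apply, norm_mul]
    rw [Real.norm_of_nonneg h1, Real.norm_of_nonneg (show 0 ≤ 1 / ‖x - z‖ ^ 2 by positivity)]
    calc _ ≤ ‖ρ z‖ * (1 / ‖x - z‖ ^ 2 + 1) := by gcongr; linarith
      _ = _ := by ring

theorem potential_upper_bound {u : E3 → ℝ} {c : ℝ} (h : IsRep u c) : ∃ C, ∀ x,
    u x ≤ C + 1 / π ^ 2 * ∫ z, exp (3 * u z) * log (1 + 1 / ‖x - z‖) := by
  have hZ := integral_kap_pos
  set Z := ∫ y, kap y
  refine ⟨((∫ y, exp (3 * u y)) + c / 2 * ∫ y, Psi y) / Z, fun x => ?_⟩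
  have h1 := mean_identity h.smooth h.cont h.int h.lap_eq one_pos x
  have h2 := mean_le_mass h one_pos x
  have h3 : ∫ z, exp (3 * u z) * kR 1 (x - z) ≤
      Z * ∫ z, exp (3 * u z) * log (1 + 1 / ‖x - z‖) := by
    rw [← integral_const_mul]
    refine integral_mono_ae (integrable_mul_kR h.cont h.int one_pos x)
      ((integrable_mul_log h.cont h.int x).const_mul _) ?_
    filter_upwards [Measure.ae_ne volume x] with z hz
    have := kR_le (sub_ne_zero.2 hz.symm) one_pos
    have h4 := exp_pos (3 * u z)
    calc _ ≤ exp (3 * u z) * (Z * log (1 + 1 / ‖x - z‖)) := by gcongr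
      _ = _ := by ring
  have h4 : 1 / π ^ 2 * ∫ z, exp (3 * u z) * kR 1 (x - z) ≤
      1 / π ^ 2 * (Z * ∫ z, exp (3 * u z) * log (1 + 1 / ‖x - z‖)) := by gcongr
  rw [div_add' _ _ _ hZ.ne', le_div_iff₀ hZ]
  simp only [one_pow, inv_one, one_mul, mul_one] at h1 h2
  nlinarith

theorem tendsto_integral_ball_zero {ρ : E3 → ℝ} (hρ : Integrable ρ) (r : ℝ) :
    Tendsto (fun x : E3 => ∫ y in Metric.ball x r, ρ y) (comap (fun x : E3 => ‖x‖) atTop) (𝓝 0) := by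
  have e : ∀ x : E3, ∫ y in Metric.ball x r, ρ y = ∫ y, (Metric.ball x r).indicator ρ y :=
    fun x => (integral_indicator measurableSet_ball).symm
  simp_rw [e]
  rw [show (0:ℝ) = ∫ y : E3, (0:ℝ) by simp]
  refine tendsto_integral_filter_of_dominated_convergence (fun y => ‖ρ y‖) ?_ ?_ hρ.norm ?_
  · exact Eventually.of_forall fun x => hρ.aestronglyMeasurable.indicator measurableSet_ball
  · exact Eventually.of_forall fun x => Eventually.of_forall fun y => norm_indicator_le_norm_self _ _
  · refine Eventually.of_forall fun y => ?_
    refine tendsto_const_nhds.congr' ?_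
    filter_upwards [tendsto_comap.eventually_ge_atTop (‖y‖ + r)] with x hx
    rw [Set.indicator_of_notMem]
    rw [Metric.mem_ball, dist_eq_norm, not_lt]
    have := norm_sub_norm_le x y
    rw [norm_sub_rev] at this
    linarith

theorem jensen_sqrt {ρ : E3 → ℝ} (hρc : Continuous ρ) (hρ : Integrable ρ) (h0 : ∀ z, 0 < ρ z)
    (x y : E3) {r : ℝ} (hr : 0 < r) (hm : ∫ z in Metric.ball x r, ρ z ≤ π ^ 2 / 6) :
    exp (3 * (1 / π ^ 2 * ∫ z in Metric.ball x r, ρ z * log (1 + 1 / ‖y - z‖))) ≤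
      (∫ z in Metric.ball x r, ρ z)⁻¹ * ∫ z in Metric.ball x r, ρ z * √(1 + 1 / ‖y - z‖) := by
  set S := Metric.ball x r
  have hS : MeasurableSet S := measurableSet_ball
  set m := ∫ z in S, ρ z with hmdef
  have hm0 : 0 < m := by
    rw [hmdef, setIntegral_pos_iff_support_of_nonneg_ae
      (Eventually.of_forall fun z => (h0 z).le) hρ.integrableOn]
    rw [Function.support_eq_univ fun z => (h0 z).ne', Set.univ_inter]
    exact Metric.measure_ball_pos _ _ hr
  set I := ∫ z in S, ρ z * log (1 + 1 / ‖y - z‖) with hI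
  have hlog : ∀ z : E3, 0 ≤ log (1 + 1 / ‖y - z‖) := fun z => by
    apply Real.log_nonneg; linarith [show 0 ≤ 1 / ‖y - z‖ by positivity]
  have hI0 : 0 ≤ I := integral_nonneg fun z => mul_nonneg (h0 z).le (hlog z)
  have hi1 := (integrable_mul_log hρc hρ y)
  have hi2 : Integrable fun z => ρ z * √(1 + 1 / ‖y - z‖) := by
    refine ((integrable_mul_inv_sq hρc hρ y).norm.add (hρ.norm.const_mul 2)).mono' ?_ ?_
    · exact hρc.aestronglyMeasurable.mul (Measurable.aestronglyMeasurable (by fun_prop))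
    · refine Eventually.of_forall fun z => ?_
      have a0 : 0 ≤ 1 / ‖y - z‖ := by positivity
      have h3 : √(1 + 1 / ‖y - z‖) ≤ 1 / ‖y - z‖ ^ 2 + 2 := by
        rw [Real.sqrt_le_left (by positivity)]
        have : 1 / ‖y - z‖ ^ 2 = (1 / ‖y - z‖) ^ 2 := by simp
        rw [this]; nlinarith [sq_nonneg (1 / ‖y - z‖ - 1), sq_nonneg (1 / ‖y - z‖),
          sq_nonneg ((1 / ‖y - z‖) ^ 2)]
      simp only [Pi.add_apply, norm_mul]
      rw [Real.norm_of_nonneg (Real.sqrt_nonneg _),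
        Real.norm_of_nonneg (show 0 ≤ 1 / ‖y - z‖ ^ 2 by positivity)]
      calc _ ≤ ‖ρ z‖ * (1 / ‖y - z‖ ^ 2 + 2) := by gcongr
        _ = _ := by ring
  set A := I / (2 * m) with hA
  have h1 : exp (3 * (1 / π ^ 2 * I)) ≤ exp A := by
    rw [Real.exp_le_exp, hA, le_div_iff₀ (by positivity)]
    have : m / π ^ 2 ≤ 1 / 6 := by rw [div_le_iff₀ (by positivity)]; linarith
    calc _ = 6 * (m / π ^ 2) * I := by ring
      _ ≤ 6 * (1 / 6) * I := by gcongr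
      _ = I := by ring
  refine h1.trans ?_
  rw [← div_eq_inv_mul, le_div_iff₀ hm0]
  have h2 : ∫ z in S, exp A * (ρ z * (1 - A) + 1 / 2 * (ρ z * log (1 + 1 / ‖y - z‖))) ≤
      ∫ z in S, ρ z * √(1 + 1 / ‖y - z‖) := by
    refine integral_mono ?_ hi2.integrableOn fun z => ?_
    · exact ((hρ.mul_const _).add (hi1.const_mul _)).const_mul _ |>.integrableOn
    · have a1 : 0 < 1 + 1 / ‖y - z‖ := by positivity
      have a2 : √(1 + 1 / ‖y - z‖) = exp (1 / 2 * log (1 + 1 / ‖y - z‖)) := by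
        rw [Real.sqrt_eq_rpow, Real.rpow_def_of_pos a1, mul_comm]
      have a3 := Real.add_one_le_exp (1 / 2 * log (1 + 1 / ‖y - z‖) - A)
      simp only
      rw [a2]
      have a4 : exp (1 / 2 * log (1 + 1 / ‖y - z‖)) =
        exp A * exp (1 / 2 * log (1 + 1 / ‖y - z‖) - A) := by rw [← Real.exp_add]; congr 1; ring
      rw [a4]
      have := h0 z
      calc _ = ρ z * (exp A * (1 / 2 * log (1 + 1 / ‖y - z‖) - A + 1)) := by ring
        _ ≤ _ := by gcongr
  refine le_trans (le_of_eq ?_) h2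
  rw [integral_const_mul, integral_add (hρ.mul_const _).integrableOn
    (hi1.const_mul _).integrableOn, integral_mul_const, integral_const_mul, ← hI, ← hmdef]
  have : I = 2 * m * A := by rw [hA]; field_simp
  rw [this]; ring

noncomputable def kappa (δ : ℝ) (z : E3) : ℝ :=
  (Metric.ball (0 : E3) δ).indicator (fun z => 1 / ‖z‖ ^ 2 * √(1 + 1 / ‖z‖)) z

theorem kappa_nonneg (δ : ℝ) (z : E3) : 0 ≤ kappa δ z :=
  Set.indicator_nonneg (fun z _ => by positivity) z

theorem measurable_kappa (δ : ℝ) : Measurable (kappa δ) :=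
  Measurable.indicator (by fun_prop) measurableSet_ball

theorem integrable_kappa_one : Integrable (kappa 1) := by
  set f : ℝ → ℝ := (Set.Iio 1).indicator (fun r => 1 / r ^ 2 * √(1 + 1 / r))
  have e : kappa 1 = fun z => f ‖z‖ := by
    ext z
    by_cases h : ‖z‖ < 1
    · simp [kappa, f, h]
    · simp [kappa, f, h]
  rw [e]
  refine integrable_radial ?_
  have h1 : IntegrableOn (fun r : ℝ => 1 + r ^ (-(1/2) : ℝ)) (Set.Ioo 0 1) := by
    refine Integrable.add (by simp) ?_
    have := (intervalIntegral.intervalIntegrable_rpow' (a := 0) (b := 1)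
      (show (-1 : ℝ) < -(1/2) by norm_num)).1
    exact this.mono_set Set.Ioo_subset_Ioc_self
  have h2 : Integrable ((Set.Ioo 0 1).indicator fun r : ℝ => 1 + r ^ (-(1/2) : ℝ)) :=
    h1.integrable_indicator measurableSet_Ioo
  refine h2.integrableOn.mono' ?_ ?_
  · refine Measurable.aestronglyMeasurable ?_
    exact (by fun_prop : Measurable fun r : ℝ => r ^ 2).mul
      (Measurable.indicator (by fun_prop) measurableSet_Iio)
  · refine (ae_restrict_iff' measurableSet_Ioi).2 (Eventually.of_forall fun r hr => ?_)
    have hr : 0 < r := hr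
    by_cases h : r < 1
    · simp only [f]
      rw [Set.indicator_of_mem (Set.mem_Iio.2 h), Set.indicator_of_mem (Set.mem_Ioo.2 ⟨hr, h⟩)]
      rw [Real.norm_of_nonneg (by positivity), ← mul_assoc, mul_one_div_cancel (by positivity),
        one_mul]
      have : r ^ (-(1/2) : ℝ) = √(1 / r) := by
        rw [Real.rpow_neg hr.le, ← Real.sqrt_eq_rpow, one_div, Real.sqrt_inv]
      rw [this]
      have h0 : 0 ≤ 1 / r := by positivity
      rw [Real.sqrt_le_left (by positivity)]
      nlinarith [Real.sq_sqrt h0, Real.sqrt_nonneg (1 / r)]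
    · simp only [f]
      rw [Set.indicator_of_notMem (by simpa using h : r ∉ Set.Iio (1 : ℝ)), mul_zero, norm_zero]
      exact Set.indicator_nonneg (fun s hs => by have := hs.1; positivity) r

theorem kappa_le_one {δ : ℝ} (hδ : δ ≤ 1) (z : E3) : kappa δ z ≤ kappa 1 z :=
  Set.indicator_le_indicator_of_subset (Metric.ball_subset_ball hδ) (fun z => by positivity) z

theorem integrable_kappa {δ : ℝ} (hδ : δ ≤ 1) : Integrable (kappa δ) := by
  refine integrable_kappa_one.mono' (measurable_kappa δ).aestronglyMeasurable ?_
  refine Eventually.of_forall fun z => ?_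
  rw [Real.norm_of_nonneg (kappa_nonneg _ _)]
  exact kappa_le_one hδ z

theorem tendsto_integral_kappa : Tendsto (fun δ => ∫ z, kappa δ z) (𝓝[>] 0) (𝓝 0) := by
  rw [show 𝓝 (0:ℝ) = 𝓝 (∫ z : E3, (0:ℝ)) by simp]
  refine tendsto_integral_filter_of_dominated_convergence (kappa 1) ?_ ?_ integrable_kappa_one ?_
  · exact Eventually.of_forall fun δ => (measurable_kappa δ).aestronglyMeasurable
  · filter_upwards [Ioc_mem_nhdsGT one_pos] with δ hδ
    refine Eventually.of_forall fun z => ?_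
    rw [Real.norm_of_nonneg (kappa_nonneg _ _)]
    exact kappa_le_one hδ.2 z
  · filter_upwards [Measure.ae_ne volume (0:E3)] with z hz
    refine tendsto_const_nhds.congr' ?_
    filter_upwards [Ioo_mem_nhdsGT (norm_pos_iff.2 hz)] with δ hδ
    rw [kappa, Set.indicator_of_notMem]
    simp [hδ.2.le]

theorem sqrt_kernel_le {δ : ℝ} {a : E3} (ha : ‖a‖ < δ) (b : E3) :
    1 / ‖a‖ ^ 2 * √(1 + 1 / ‖b‖) ≤ kappa δ a + kappa δ b := by
  have ka : kappa δ a = 1 / ‖a‖ ^ 2 * √(1 + 1 / ‖a‖) := by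
    rw [kappa, Set.indicator_of_mem (by simpa using ha)]
  have a0 := norm_nonneg a
  have b0 := norm_nonneg b
  rcases a0.eq_or_lt with h | h
  · rw [← h]
    simpa using add_nonneg (kappa_nonneg δ a) (kappa_nonneg δ b)
  rcases b0.eq_or_lt with hb | hb
  · refine le_trans ?_ (le_add_of_nonneg_right (kappa_nonneg δ b))
    rw [ka, ← hb]
    gcongr 1 / ‖a‖ ^ 2 * √(1 + ?_)
    simp
  rcases le_or_gt ‖a‖ ‖b‖ with hab | hab
  · refine le_trans ?_ (le_add_of_nonneg_right (kappa_nonneg δ b))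
    rw [ka]
    gcongr
  · refine le_trans ?_ (le_add_of_nonneg_left (kappa_nonneg δ a))
    have kb : kappa δ b = 1 / ‖b‖ ^ 2 * √(1 + 1 / ‖b‖) := by
      rw [kappa, Set.indicator_of_mem (by simpa using hab.trans ha)]
    rw [kb]
    gcongr

theorem density_le_local {u : E3 → ℝ} {c : ℝ} (h : IsRep u c) : ∃ K, 0 < K ∧ ∀ x y : E3,
    dist y x < 1 → (∫ z in Metric.ball x 2, exp (3 * u z)) ≤ π ^ 2 / 6 →
    exp (3 * u y) ≤ K * ((∫ z in Metric.ball x 2, exp (3 * u z))⁻¹ *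
      ∫ z in Metric.ball x 2, exp (3 * u z) * √(1 + 1 / ‖y - z‖)) := by
  obtain ⟨C, hC⟩ := potential_upper_bound h
  set M := ∫ z, exp (3 * u z)
  refine ⟨exp (3 * (C + 1 / π ^ 2 * M)), exp_pos _, fun x y hy hm => ?_⟩
  have hj := jensen_sqrt h.cont h.int (fun z => exp_pos _) x y two_pos hm
  refine le_trans ?_ (mul_le_mul_of_nonneg_left hj (exp_pos _).le)
  rw [← Real.exp_add, Real.exp_le_exp]
  have hi := integrable_mul_log h.cont h.int y
  have h1 := hC y
  rw [← integral_add_compl (measurableSet_ball (x := x) (ε := 2)) hi] at h1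
  have h2 : ∫ z in (Metric.ball x 2)ᶜ, exp (3 * u z) * log (1 + 1 / ‖y - z‖) ≤ M := by
    refine le_trans ?_ (setIntegral_le_integral (s := (Metric.ball x 2)ᶜ) h.int
      (Eventually.of_forall fun z => (exp_pos _).le))
    refine setIntegral_mono_on hi.integrableOn h.int.integrableOn
      measurableSet_ball.compl fun z hz => ?_
    have h3 : 1 ≤ ‖y - z‖ := by
      rw [Set.mem_compl_iff, Metric.mem_ball, not_lt] at hz
      have := dist_triangle z y x
      rw [← dist_eq_norm, dist_comm]; linarith
    have h4 : log (1 + 1 / ‖y - z‖) ≤ 1 := by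
      have := Real.log_le_sub_one_of_pos (show 0 < 1 + 1 / ‖y - z‖ by positivity)
      have : 1 / ‖y - z‖ ≤ 1 := by rw [div_le_one (by linarith)]; exact h3
      linarith
    have := exp_pos (3 * u z)
    nlinarith
  have h5 : 1 / π ^ 2 * ∫ z in (Metric.ball x 2)ᶜ, exp (3 * u z) * log (1 + 1 / ‖y - z‖) ≤
    1 / π ^ 2 * M := by gcongr
  linarith

theorem near_potential_le {u : E3 → ℝ} {c : ℝ} (h : IsRep u c) : ∃ K, 0 < K ∧ ∀ x : E3,
    (∫ z in Metric.ball x 2, exp (3 * u z)) ≤ π ^ 2 / 6 → ∀ δ : ℝ, δ ≤ 1 →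
    ∫ y in Metric.ball x δ, exp (3 * u y) * (1 / ‖x - y‖ ^ 2) ≤ K * ∫ z, kappa δ z := by
  obtain ⟨K, hK, hd⟩ := density_le_local h
  refine ⟨2 * K, by positivity, fun x hm δ hδ => ?_⟩
  set S := Metric.ball x 2
  have hS : MeasurableSet S := measurableSet_ball
  set m := ∫ z in S, exp (3 * u z) with hmdef
  have hm0 : 0 < m := by
    rw [hmdef, setIntegral_pos_iff_support_of_nonneg_ae
      (Eventually.of_forall fun z => (exp_pos _).le) h.int.integrableOn]
    rw [Function.support_eq_univ fun z => (exp_pos _).ne', Set.univ_inter]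
    exact Metric.measure_ball_pos _ _ two_pos
  set f : E3 → ℝ := S.indicator fun z => exp (3 * u z) with hf
  have hfi : Integrable f := h.int.indicator hS
  have hk := integrable_kappa hδ
  have hconv : Integrable (fun p : E3 × E3 => f p.2 * kappa δ (p.1 - p.2))
      ((volume : Measure E3).prod volume) := by
    simpa using hfi.convolution_integrand (ContinuousLinearMap.mul ℝ ℝ) hk
  have hIconv : ∫ y, ∫ z, f z * kappa δ (y - z) = m * ∫ z, kappa δ z := by
    rw [integral_integral_swap hconv]
    have : ∀ z, ∫ y, f z * kappa δ (y - z) = f z * ∫ y, kappa δ y := fun z => by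
      rw [integral_const_mul, integral_sub_right_eq_self]
    rw [integral_congr_ae (Eventually.of_forall this), integral_mul_const, hf,
      integral_indicator hS]
  have hkx : Integrable fun y => kappa δ (x - y) := hk.comp_sub_left x
  rw [← integral_indicator measurableSet_ball]
  have key : ∫ y, (Metric.ball x δ).indicator (fun y => exp (3 * u y) * (1 / ‖x - y‖ ^ 2)) y ≤
      ∫ y, (K * kappa δ (x - y) + K * m⁻¹ * ∫ z, f z * kappa δ (y - z)) := by
    refine integral_mono_ae ((integrable_mul_inv_sq h.cont h.int x).indicator measurableSet_ball)
      ((hkx.const_mul _).add (hconv.integral_prod_left.const_mul _)) ?_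
    filter_upwards [hconv.prod_right_ae] with y hy
    by_cases hyx : y ∈ Metric.ball x δ
    · rw [Set.indicator_of_mem hyx]
      have hlt : ‖x - y‖ < δ := by rwa [← dist_eq_norm, dist_comm]
      have h1 := hd x y (lt_of_lt_of_le hyx hδ) hm
      have h2 : (∫ z in S, exp (3 * u z) * √(1 + 1 / ‖y - z‖)) * (1 / ‖x - y‖ ^ 2) ≤
          m * kappa δ (x - y) + ∫ z, f z * kappa δ (y - z) := by
        have e1 : m * kappa δ (x - y) = ∫ z, f z * kappa δ (x - y) := by
          rw [integral_mul_const, hf, integral_indicator hS]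
        rw [e1, ← integral_add (hfi.mul_const _) hy, ← integral_mul_const, 
          ← integral_indicator hS]
        refine integral_mono_of_nonneg (Eventually.of_forall fun z =>
          Set.indicator_nonneg (fun z _ => by positivity) z) ((hfi.mul_const _).add hy)
          (Eventually.of_forall fun z => ?_)
        simp only
        by_cases hz : z ∈ S
        · rw [Set.indicator_of_mem hz, hf, Set.indicator_of_mem hz]
          have := sqrt_kernel_le hlt (y - z)
          have h0 := exp_pos (3 * u z)
          calc _ = exp (3 * u z) * (1 / ‖x - y‖ ^ 2 * √(1 + 1 / ‖y - z‖)) := by ring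
            _ ≤ exp (3 * u z) * (kappa δ (x - y) + kappa δ (y - z)) := by gcongr
            _ = _ := by ring
        · rw [Set.indicator_of_notMem hz, hf, Set.indicator_of_notMem hz]; simp
      calc _ ≤ K * (m⁻¹ * ∫ z in S, exp (3 * u z) * √(1 + 1 / ‖y - z‖)) * (1 / ‖x - y‖ ^ 2) := by
            gcongr
        _ = K * m⁻¹ * ((∫ z in S, exp (3 * u z) * √(1 + 1 / ‖y - z‖)) * (1 / ‖x - y‖ ^ 2)) := by
            ring
        _ ≤ K * m⁻¹ * (m * kappa δ (x - y) + ∫ z, f z * kappa δ (y - z)) := by gcongr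
        _ = _ := by field_simp
    · rw [Set.indicator_of_notMem hyx]
      have h1 := kappa_nonneg δ (x - y)
      have h2 : 0 ≤ ∫ z, f z * kappa δ (y - z) := integral_nonneg fun z =>
        mul_nonneg (Set.indicator_nonneg (fun z _ => (exp_pos _).le) z) (kappa_nonneg _ _)
      exact add_nonneg (mul_nonneg hK.le h1)
        (mul_nonneg (mul_nonneg hK.le (inv_nonneg.2 hm0.le)) h2)
  refine key.trans (le_of_eq ?_)
  rw [integral_add (hkx.const_mul _) (hconv.integral_prod_left.const_mul _), integral_const_mul,
    integral_const_mul, hIconv, integral_sub_left_eq_self _ volume x]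
  field_simp; ring

theorem tendsto_far_potential {ρ : E3 → ℝ} (hρ : Integrable ρ) {δ : ℝ} (hδ : 0 < δ) :
    Tendsto (fun x : E3 => ∫ y in (Metric.ball x δ)ᶜ, ρ y * (1 / ‖x - y‖ ^ 2))
      (comap (fun x : E3 => ‖x‖) atTop) (𝓝 0) := by
  have e : ∀ x : E3, ∫ y in (Metric.ball x δ)ᶜ, ρ y * (1 / ‖x - y‖ ^ 2) =
      ∫ y, (Metric.ball x δ)ᶜ.indicator (fun y => ρ y * (1 / ‖x - y‖ ^ 2)) y :=
    fun x => (integral_indicator measurableSet_ball.compl).symm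
  simp_rw [e]
  rw [show (0:ℝ) = ∫ y : E3, (0:ℝ) by simp]
  refine tendsto_integral_filter_of_dominated_convergence (fun y => ‖ρ y‖ * (1 / δ ^ 2)) ?_ ?_
    (hρ.norm.mul_const _) ?_
  · exact Eventually.of_forall fun x => (hρ.aestronglyMeasurable.mul
      (Measurable.aestronglyMeasurable (by fun_prop))).indicator measurableSet_ball.compl
  · refine Eventually.of_forall fun x => Eventually.of_forall fun y => ?_
    by_cases hy : y ∈ (Metric.ball x δ)ᶜ
    · rw [Set.indicator_of_mem hy, norm_mul, Real.norm_of_nonneg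
        (show 0 ≤ 1 / ‖x - y‖ ^ 2 by positivity)]
      have : δ ≤ ‖x - y‖ := by
        rw [Set.mem_compl_iff, Metric.mem_ball, not_lt] at hy
        rwa [← dist_eq_norm, dist_comm]
      gcongr
    · rw [Set.indicator_of_notMem hy, norm_zero]; positivity
  · refine Eventually.of_forall fun y => ?_
    have h1 : Tendsto (fun x : E3 => ‖x - y‖) (comap (fun x : E3 => ‖x‖) atTop) atTop := by
      refine tendsto_atTop_mono (fun x => norm_sub_norm_le x y) ?_
      exact tendsto_atTop_add_const_right _ (-‖y‖) tendsto_comap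
    have h2 : Tendsto (fun x : E3 => ‖ρ y‖ * (1 / ‖x - y‖ ^ 2))
        (comap (fun x : E3 => ‖x‖) atTop) (𝓝 (‖ρ y‖ * 0)) := by
      refine Tendsto.const_mul _ ?_
      simp_rw [one_div]
      exact tendsto_inv_atTop_zero.comp ((tendsto_pow_atTop two_ne_zero).comp h1)
    rw [mul_zero] at h2
    refine squeeze_zero_norm (fun x => ?_) h2
    refine (norm_indicator_le_norm_self _ _).trans (le_of_eq ?_)
    rw [norm_mul, Real.norm_of_nonneg (show 0 ≤ 1 / ‖x - y‖ ^ 2 by positivity)]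

theorem IsRep.tendsto_lap {u : E3 → ℝ} {c : ℝ} (h : IsRep u c) :
    Tendsto (lap u) (comap (fun x : E3 => ‖x‖) atTop) (𝓝 (-c)) := by
  obtain ⟨K, hK, hn⟩ := near_potential_le h
  have h0 : Tendsto (fun x : E3 => ∫ y, exp (3 * u y) * (1 / ‖x - y‖ ^ 2))
      (comap (fun x : E3 => ‖x‖) atTop) (𝓝 0) := by
    refine tendsto_order.2 ⟨fun a ha => Eventually.of_forall fun x => lt_of_lt_of_le ha
      (integral_nonneg fun y => by positivity), fun a ha => ?_⟩
    obtain ⟨δ, hδ1, hδ⟩ : ∃ δ : ℝ, K * ∫ z, kappa δ z < a / 2 ∧ δ ∈ Set.Ioc (0:ℝ) 1 := by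
      have := tendsto_integral_kappa.const_mul K
      rw [mul_zero] at this
      exact ((this.eventually_lt_const (half_pos ha)).and
        (Ioc_mem_nhdsGT one_pos)).exists
    have hfar := (tendsto_far_potential h.int hδ.1).eventually_lt_const (half_pos ha)
    have hm := (tendsto_integral_ball_zero h.int 2).eventually_le_const
      (show (0:ℝ) < π ^ 2 / 6 by positivity)
    filter_upwards [hfar, hm] with x h1 h2
    rw [← integral_add_compl (measurableSet_ball (x := x) (ε := δ))
      (integrable_mul_inv_sq h.cont h.int x)]
    linarith [hn x h2 δ hδ.2]
  have h1 : lap u = fun x =>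
      -(1 / π ^ 2 * ∫ y, exp (3 * u y) * (1 / ‖x - y‖ ^ 2)) - c := by
    ext x; linarith [h.lap_eq x]
  rw [h1]
  have := (h0.const_mul (1 / π ^ 2)).neg.sub_const c
  simpa using this

theorem nonpos_of_quadratic_le {e a b T₀ : ℝ} (h : ∀ T, T₀ ≤ T → e * T ^ 2 ≤ a + b * T) :
    e ≤ 0 := by
  by_contra! he
  set T := max T₀ (1 + (|a| + |b|) / e)
  have h1 := h T (le_max_left _ _)
  have h2 : 1 + (|a| + |b|) / e ≤ T := le_max_right _ _
  have h3 : 0 ≤ (|a| + |b|) / e := by positivity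
  have h4 : e + (|a| + |b|) ≤ e * T := by
    calc _ = e * (1 + (|a| + |b|) / e) := by field_simp
      _ ≤ _ := by gcongr
  have h5 : 1 ≤ T := by linarith
  have h6 : (e + (|a| + |b|)) * T ≤ e * T * T := by gcongr
  nlinarith [le_abs_self a, le_abs_self b, abs_nonneg a, abs_nonneg b]

theorem log_le_two_sqrt {t : ℝ} (ht : 0 < t) : log t ≤ 2 * √t := by
  have h := Real.log_le_sub_one_of_pos (Real.sqrt_pos.2 ht)
  have h2 : log t = 2 * log √t := by rw [Real.log_sqrt ht.le]; ring
  linarith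

/-- The renormalised logarithmic kernel. -/
noncomputable def logL (x y : E3) : ℝ := log (1 + ‖y‖) - log ‖x - y‖

theorem logL_lower (x y : E3) : -log (1 + ‖x‖) ≤ logL x y := by
  rw [logL]
  have h0 : 0 ≤ log (1 + ‖x‖) := Real.log_nonneg (by linarith [norm_nonneg x])
  have h1 : 0 ≤ log (1 + ‖y‖) := Real.log_nonneg (by linarith [norm_nonneg y])
  rcases (norm_nonneg (x - y)).eq_or_lt with h | h
  · rw [← h, Real.log_zero]; linarith
  · have h2 : log ‖x - y‖ ≤ log ((1 + ‖x‖) * (1 + ‖y‖)) := by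
      refine Real.log_le_log h ?_
      nlinarith [norm_sub_le x y, norm_nonneg x, norm_nonneg y,
        mul_nonneg (norm_nonneg x) (norm_nonneg y)]
    rw [Real.log_mul (by positivity) (by positivity)] at h2
    linarith

theorem logL_upper (x y : E3) : logL x y ≤ log (2 + ‖x‖) + log (1 + 1 / ‖x - y‖) := by
  rw [logL]
  rcases (norm_nonneg (x - y)).eq_or_lt with h | h
  · have : x = y := sub_eq_zero.1 (norm_eq_zero.1 h.symm)
    subst this
    have : log (1 + ‖x‖) ≤ log (2 + ‖x‖) := Real.log_le_log (by positivity) (by linarith)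
    simpa using this
  · rw [← Real.log_mul (by positivity) (by positivity), sub_le_iff_le_add,
      ← Real.log_mul (by positivity) h.ne']
    refine Real.log_le_log (by positivity) ?_
    have e : (2 + ‖x‖) * (1 + 1 / ‖x - y‖) * ‖x - y‖ = (2 + ‖x‖) * (‖x - y‖ + 1) := by
      field_simp
    rw [e]
    have h1 : ‖y‖ ≤ ‖x‖ + ‖x - y‖ := by
      have := norm_sub_norm_le y x; rw [norm_sub_rev] at this; linarith
    nlinarith [norm_nonneg x, mul_nonneg (norm_nonneg x) h.le]

theorem abs_logL_le (x y : E3) : |logL x y| ≤ log (2 + ‖x‖) + log (1 + 1 / ‖x - y‖) := by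
  have h0 : 0 ≤ log (1 + 1 / ‖x - y‖) := by
    apply Real.log_nonneg; linarith [show 0 ≤ 1 / ‖x - y‖ by positivity]
  have h1 : log (1 + ‖x‖) ≤ log (2 + ‖x‖) :=
    Real.log_le_log (by positivity) (by linarith)
  exact abs_le.2 ⟨by linarith [logL_lower x y], logL_upper x y⟩

theorem log_one_add_inv_le (z : E3) : log (1 + 1 / ‖z‖) ≤ kappa 1 z + 1 := by
  rcases (norm_nonneg z).eq_or_lt with h | h
  · rw [← h]; simpa using add_nonneg (kappa_nonneg 1 z) zero_le_one
  have h1 := Real.log_le_sub_one_of_pos (show 0 < 1 + 1 / ‖z‖ by positivity)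
  rcases lt_or_ge ‖z‖ 1 with h2 | h2
  · have k : kappa 1 z = 1 / ‖z‖ ^ 2 * √(1 + 1 / ‖z‖) := by
      rw [kappa, Set.indicator_of_mem (by simpa using h2)]
    have h3 : 1 ≤ √(1 + 1 / ‖z‖) := by
      rw [Real.one_le_sqrt]; linarith [show 0 ≤ 1 / ‖z‖ by positivity]
    have h4 : 1 / ‖z‖ ≤ 1 / ‖z‖ ^ 2 := by
      rw [div_le_div_iff₀ h (by positivity)]; nlinarith
    have h5 : 0 ≤ 1 / ‖z‖ ^ 2 := by positivity
    rw [k]; nlinarith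
  · have : 1 / ‖z‖ ≤ 1 := by rw [div_le_one h]; exact h2
    linarith [kappa_nonneg 1 z]

theorem measurable_logL : Measurable fun p : E3 × E3 => logL p.1 p.2 := by
  unfold logL; fun_prop

noncomputable def pot (ρ : E3 → ℝ) (x : E3) : ℝ := 1 / π ^ 2 * ∫ y, ρ y * logL x y

theorem integrable_mul_logL {ρ : E3 → ℝ} (hρc : Continuous ρ) (hρ : Integrable ρ) (x : E3) : Integrable fun y => ρ y * logL x y := by
  refine ((hρ.norm.const_mul (log (2 + ‖x‖))).add (integrable_mul_log hρc hρ x).norm).mono'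
    (hρc.aestronglyMeasurable.mul ?_) ?_
  · exact (measurable_logL.comp (by fun_prop : Measurable fun y => (x, y))).aestronglyMeasurable
  · refine Eventually.of_forall fun y => ?_
    have h1 := abs_logL_le x y
    have h0 : 0 ≤ log (1 + 1 / ‖x - y‖) := by
      apply Real.log_nonneg; linarith [show 0 ≤ 1 / ‖x - y‖ by positivity]
    simp only [Pi.add_apply, norm_mul]
    rw [Real.norm_of_nonneg h0]
    calc _ ≤ ‖ρ y‖ * (log (2 + ‖x‖) + log (1 + 1 / ‖x - y‖)) := by gcongr; exact h1
      _ = _ := by ring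

theorem pot_lower {ρ : E3 → ℝ} (hρc : Continuous ρ) (hρ : Integrable ρ)
    (h0 : ∀ y, 0 ≤ ρ y) (x : E3) :
    -(1 / π ^ 2 * (∫ y, ρ y) * log (1 + ‖x‖)) ≤ pot ρ x := by
  have : ∫ y, ρ y * -log (1 + ‖x‖) ≤ ∫ y, ρ y * logL x y :=
    integral_mono (hρ.mul_const _) (integrable_mul_logL hρc hρ x) fun y =>
      mul_le_mul_of_nonneg_left (logL_lower x y) (h0 y)
  rw [integral_mul_const] at this
  rw [pot]
  have h2 := mul_le_mul_of_nonneg_left this (show 0 ≤ 1 / π ^ 2 by positivity)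
  linarith

theorem integrable_pot_prod {ρ : E3 → ℝ} (hρc : Continuous ρ) (hρ : Integrable ρ)
    (x : E3) {R : ℝ} (hR : 0 < R) :
    Integrable (fun p : E3 × E3 => ρ p.2 * logL (x + R • p.1) p.2 * kap p.1)
      ((volume : Measure E3).prod volume) := by
  set A := log (2 + (‖x‖ + R)) with hA
  have i1 : Integrable (fun p : E3 × E3 => kap p.1 * ((A + 1) * ‖ρ p.2‖))
      ((volume : Measure E3).prod volume) := integrable_kap.mul_prod (hρ.norm.const_mul _)
  have i2 : Integrable (fun p : E3 × E3 => ‖ρ p.2‖ * kappa 1 (x + R • p.1 - p.2))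
      ((volume : Measure E3).prod volume) := by
    have hm : AEStronglyMeasurable (fun p : E3 × E3 => ‖ρ p.2‖ * kappa 1 (x + R • p.1 - p.2))
      ((volume : Measure E3).prod volume) := by
      refine Measurable.aestronglyMeasurable (Measurable.mul ?_ ?_)
      · exact (hρc.measurable.comp measurable_snd).norm
      · exact (measurable_kappa 1).comp (by fun_prop)
    have e : ∀ y w : E3, x + R • w - y = x - y + R • w := fun y w => by abel
    rw [integrable_prod_iff' hm]
    constructor
    · refine Eventually.of_forall fun y => ?_
      simp only [e]
      refine Integrable.const_mul ?_ _
      exact (integrable_kappa_one.comp_add_left (x - y)).comp_smul hR.ne'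
    · have e2 : ∀ y : E3, ∫ w, ‖‖ρ y‖ * kappa 1 (x + R • w - y)‖ =
          ‖ρ y‖ * ((R ^ 3)⁻¹ * ∫ w, kappa 1 w) := fun y => by
        simp only [norm_mul, norm_norm, e, Real.norm_of_nonneg (kappa_nonneg 1 _)]
        rw [integral_const_mul,
          Measure.integral_comp_smul volume (fun w => kappa 1 (x - y + w)) R, finrank_E3,
          integral_add_left_eq_self (μ := volume) (kappa 1) (x - y), abs_of_pos (by positivity),
          smul_eq_mul]
      simp only [e2]
      exact hρ.norm.mul_const _
  refine (i1.add i2).mono' ?_ ?_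
  · refine Measurable.aestronglyMeasurable (Measurable.mul (Measurable.mul ?_ ?_) ?_)
    · exact hρc.measurable.comp measurable_snd
    · exact measurable_logL.comp (by fun_prop : Measurable fun p : E3 × E3 =>
        (x + R • p.1, p.2))
    · exact continuous_kap.measurable.comp measurable_fst
  · refine Eventually.of_forall fun p => ?_
    obtain ⟨w, y⟩ := p
    simp only [Pi.add_apply, norm_mul]
    rw [Real.norm_of_nonneg (kap_nonneg w)]
    have hk0 := kappa_nonneg 1 (x + R • w - y)
    rcases le_or_gt 1 ‖w‖ with hw | hw
    · rw [kap_eq_zero hw]; simp only [mul_zero, zero_mul, zero_add]; positivity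
    have h1 := abs_logL_le (x + R • w) y
    have h2 := log_one_add_inv_le (x + R • w - y)
    have h3 : log (2 + ‖x + R • w‖) ≤ A := by
      refine Real.log_le_log (by positivity) ?_
      have := norm_add_le x (R • w)
      rw [norm_smul, Real.norm_of_nonneg hR.le] at this
      nlinarith
    have hk1 := kap_nonneg w
    have hk2 := kap_le_one w
    calc ‖ρ y‖ * ‖logL (x + R • w) y‖ * kap w
        ≤ ‖ρ y‖ * (A + 1 + kappa 1 (x + R • w - y)) * kap w := by
          gcongr; rw [Real.norm_eq_abs]; linarith
      _ = kap w * ((A + 1) * ‖ρ y‖) + ‖ρ y‖ * kappa 1 (x + R • w - y) * kap w := by ring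
      _ ≤ _ := by
          have : 0 ≤ ‖ρ y‖ * kappa 1 (x + R • w - y) := by positivity
          nlinarith

theorem integrable_pot_kap {ρ : E3 → ℝ} (hρc : Continuous ρ) (hρ : Integrable ρ)
    (x : E3) {R : ℝ} (hR : 0 < R) :
    Integrable fun w => pot ρ (x + R • w) * kap w := by
  have := (integrable_pot_prod hρc hρ x hR).integral_prod_left.const_mul (1 / π ^ 2)
  refine this.congr (Eventually.of_forall fun w => ?_)
  simp only [pot]
  rw [integral_mul_const]; ring

theorem pot_mean {ρ : E3 → ℝ} (hρc : Continuous ρ) (hρ : Integrable ρ)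
    (x : E3) {R : ℝ} (hR : 0 < R) :
    ∫ w, pot ρ (x + R • w) * kap w =
      (∫ y, kap y) * pot ρ x - 1 / π ^ 2 * ∫ z, ρ z * kR R (x - z) := by
  have e1 : ∀ w, pot ρ (x + R • w) * kap w =
      1 / π ^ 2 * ∫ y, ρ y * logL (x + R • w) y * kap w := fun w => by
    rw [integral_mul_const, pot]; ring
  rw [integral_congr_ae (Eventually.of_forall e1), integral_const_mul,
    integral_integral_swap (integrable_pot_prod hρc hρ x hR)]
  have e2 : ∀ᵐ y, ∫ w, ρ y * logL (x + R • w) y * kap w =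
      (∫ y, kap y) * (ρ y * logL x y) - ρ y * kR R (x - y) := by
    filter_upwards [Measure.ae_ne volume x] with y hy
    have hl := integrable_log_kap (x - y) hR
    have e3 : ∀ w, ρ y * logL (x + R • w) y * kap w =
        ρ y * (log (1 + ‖y‖) * kap w - log ‖x - y + R • w‖ * kap w) := fun w => by
      rw [logL, show x + R • w - y = x - y + R • w by abel]; ring
    rw [integral_congr_ae (Eventually.of_forall e3), integral_const_mul,
      integral_sub (integrable_kap.const_mul _) hl, integral_const_mul,
      kR_eq (sub_ne_zero.2 hy.symm) hR, logL]
    ring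
  rw [integral_congr_ae e2, integral_sub ((integrable_mul_logL hρc hρ x).const_mul _)
    (integrable_mul_kR hρc hρ hR x), integral_const_mul, pot]
  ring

theorem kap_sub_le {h : E3} (hh : ‖h‖ ≤ 1) (w : E3) :
    |kap w - kap (w - h)| ≤ 20 / 3 * ‖h‖ * kap ((1 / 4 : ℝ) • w) := by
  have h0 := norm_nonneg h
  have hq : kap ((1 / 4 : ℝ) • w) = max 0 (1 - (‖w‖ / 4) ^ 2) := by
    rw [kap, norm_smul, Real.norm_of_nonneg (by norm_num)]; ring_nf
  have t1 : ‖w‖ ≤ ‖w - h‖ + ‖h‖ := by simpa using norm_add_le (w - h) h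
  have t2 : ‖w - h‖ ≤ ‖w‖ + ‖h‖ := norm_sub_le w h
  rcases le_or_gt ‖w‖ 2 with hw | hw
  · have h1 : 3 / 4 ≤ kap ((1 / 4 : ℝ) • w) := by
      rw [hq]; refine le_max_of_le_right ?_; nlinarith [norm_nonneg w]
    have h2 : |kap w - kap (w - h)| ≤ 5 * ‖h‖ := by
      refine (abs_max_sub_max_le_max _ _ _ _).trans (max_le (by simp) ?_)
      rw [abs_le]
      constructor <;> nlinarith [norm_nonneg w, norm_nonneg (w - h)]
    nlinarith
  · rw [kap_eq_zero (by linarith), kap_eq_zero (by linarith), sub_zero, abs_zero]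
    exact mul_nonneg (by positivity) (kap_nonneg _)

theorem liouville_step {p : E3 → ℝ} {Z : ℝ}
    (hi : ∀ x, ∀ R : ℝ, 0 < R → Integrable fun w => p (x + R • w) * kap w)
    (hm : ∀ x, ∀ R : ℝ, 0 < R → ∫ w, p (x + R • w) * kap w = Z * p x)
    (hZ : Z = ∫ y, kap y) {x z : E3} {R L : ℝ} (hR : 0 < R) (hxz : ‖z - x‖ ≤ R)
    (hL : ∀ w : E3, ‖w‖ < 4 → p (x + R • w) ≤ L) :
    p z - p x ≤ 1280 / 3 * (‖z - x‖ / R) * (L - p x) := by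
  have hZ0 : 0 < Z := hZ ▸ integral_kap_pos
  set h : E3 := (1 / R) • (z - x) with hh
  have hn : ‖h‖ = ‖z - x‖ / R := by
    rw [hh, norm_smul, Real.norm_of_nonneg (by positivity)]; ring
  have hRh : R • h = z - x := by rw [hh, smul_smul, mul_one_div_cancel hR.ne', one_smul]
  have i1 := hi x R hR
  have i2 : Integrable fun w => p (x + R • w) * kap (w - h) := by
    refine ((hi z R hR).comp_sub_right h).congr (Eventually.of_forall fun w => ?_)
    simp only
    rw [smul_sub, hRh]; congr 2; abel
  have m2 : ∫ w, p (x + R • w) * kap (w - h) = Z * p z := by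
    rw [← hm z R hR, ← integral_sub_right_eq_self (fun w => p (z + R • w) * kap w) h]
    refine integral_congr_ae (Eventually.of_forall fun w => ?_)
    simp only
    rw [smul_sub, hRh]; congr 2; abel
  have e4 : ∀ w : E3, x + (4 * R) • ((1 / 4 : ℝ) • w) = x + R • w := fun w => by
    rw [smul_smul]; congr 2; ring
  have i3 : Integrable fun w => p (x + R • w) * kap ((1 / 4 : ℝ) • w) := by
    refine ((hi x (4 * R) (by positivity)).comp_smul (show (1 / 4 : ℝ) ≠ 0 by norm_num)).congr
      (Eventually.of_forall fun w => ?_)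
    simp only [e4]
  have k3 : Integrable fun w => kap ((1 / 4 : ℝ) • w) :=
    integrable_kap.comp_smul (by norm_num)
  have s4 : ∀ f : E3 → ℝ, ∫ w, f ((1 / 4 : ℝ) • w) = 64 * ∫ w, f w := fun f => by
    rw [Measure.integral_comp_smul volume f, finrank_E3, smul_eq_mul]
    norm_num
  have m3 : ∫ w, p (x + R • w) * kap ((1 / 4 : ℝ) • w) = 64 * (Z * p x) := by
    rw [← hm x (4 * R) (by positivity), ← s4]
    simp only [e4]
  have k4 : ∫ w, kap ((1 / 4 : ℝ) • w) = 64 * Z := by rw [s4 kap, hZ]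
  have k2 : Integrable fun w => kap (w - h) := integrable_kap.comp_sub_right h
  have j1 : Integrable fun w => L * kap w - p (x + R • w) * kap w :=
    (integrable_kap.const_mul L).sub i1
  have j2 : Integrable fun w => L * kap (w - h) - p (x + R • w) * kap (w - h) :=
    (k2.const_mul L).sub i2
  have key : ∫ w, ((L * kap w - p (x + R • w) * kap w) -
      (L * kap (w - h) - p (x + R • w) * kap (w - h))) ≤
      ∫ w, 20 / 3 * ‖h‖ * (L * kap ((1 / 4 : ℝ) • w) - p (x + R • w) * kap ((1 / 4 : ℝ) • w)) := by
    refine integral_mono (j1.sub j2)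
      (((k3.const_mul L).sub i3).const_mul _) fun w => ?_
    simp only
    have h1 := (abs_le.1 (kap_sub_le (by rw [hn, div_le_one hR]; exact hxz) w)).2
    rcases lt_or_ge ‖w‖ 4 with hw | hw
    · have := mul_le_mul_of_nonneg_left h1 (sub_nonneg.2 (hL w hw))
      linarith
    · have hk : kap ((1 / 4 : ℝ) • w) = 0 := by
        refine kap_eq_zero ?_
        rw [norm_smul, Real.norm_of_nonneg (by norm_num)]; linarith
      have h2 := (abs_le.1 (kap_sub_le (by rw [hn, div_le_one hR]; exact hxz) w))
      rw [hk, mul_zero] at h2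
      have h3 : kap w - kap (w - h) = 0 := by linarith [h2.1, h2.2]
      have h4 : kap w = kap (w - h) := by linarith
      rw [hk, h4]; simp
  rw [integral_sub j1 j2,
    integral_sub (integrable_kap.const_mul L) i1, integral_sub (k2.const_mul L) i2,
    integral_const_mul, integral_const_mul, integral_const_mul,
    integral_sub (k3.const_mul L) i3, integral_const_mul, m2, m3, k4, hm x R hR,
    integral_sub_right_eq_self kap h, hn] at key
  refine le_of_mul_le_mul_left ?_ hZ0
  linarith

theorem liouville {p : E3 → ℝ} {C A : ℝ} (hA : 0 ≤ A)
    (hi : ∀ x, ∀ R : ℝ, 0 < R → Integrable fun w => p (x + R • w) * kap w)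
    (hm : ∀ x, ∀ R : ℝ, 0 < R → ∫ w, p (x + R • w) * kap w = (∫ y, kap y) * p x)
    (hC : ∀ x, p x ≤ C + A * √(2 + ‖x‖)) (x z : E3) : p x = p z := by
  suffices H : ∀ x z, p z - p x ≤ 0 by linarith [H x z, H z x]
  intro x z
  refine nonpos_of_quadratic_le (a := 1280 / 3 * ‖z - x‖ * (C + A * √(2 + ‖x‖) - p x))
    (b := 1280 / 3 * ‖z - x‖ * (A * 2)) (T₀ := 1 + ‖z - x‖) fun T hT => ?_
  have hd := norm_nonneg (z - x)
  have hT1 : 1 ≤ T := by linarith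
  have h1 := liouville_step hi hm rfl (x := x) (z := z) (R := T ^ 2)
    (L := C + A * (√(2 + ‖x‖) + 2 * T)) (by positivity) (by nlinarith) fun w hw => by
      refine (hC _).trans ?_
      gcongr
      rw [Real.sqrt_le_left (by positivity)]
      have h2 := norm_add_le x ((T ^ 2) • w)
      rw [norm_smul, Real.norm_of_nonneg (by positivity)] at h2
      have h3 := Real.sq_sqrt (show 0 ≤ 2 + ‖x‖ by positivity)
      have h4 : 0 ≤ √(2 + ‖x‖) * T := by positivity
      have h5 : T ^ 2 * ‖w‖ ≤ T ^ 2 * 4 := by gcongr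
      nlinarith
  have h2 := mul_le_mul_of_nonneg_right h1 (show 0 ≤ T ^ 2 by positivity)
  refine h2.trans (le_of_eq ?_)
  field_simp
  ring

theorem IsRep.sub_pot_mean {u : E3 → ℝ} {c : ℝ} (h : IsRep u c) (x : E3) {R : ℝ} (hR : 0 < R) :
    Integrable (fun w => (u (x + R • w) - pot (fun y => exp (3 * u y)) (x + R • w)) * kap w) ∧
    ∫ w, (u (x + R • w) - pot (fun y => exp (3 * u y)) (x + R • w)) * kap w =
      (∫ y, kap y) * (u x - pot (fun y => exp (3 * u y)) x) - c * R ^ 2 / 2 * ∫ y, Psi y := by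
  have i1 : Integrable fun w => u (x + R • w) * kap w :=
    integrable_of_ball ((h.smooth.continuous.comp (by fun_prop)).mul continuous_kap)
      fun y hy => by rw [kap_eq_zero hy, mul_zero]
  have i2 := integrable_pot_kap h.cont h.int x hR
  have h1 := mean_identity h.smooth h.cont h.int h.lap_eq hR x
  have h2 := pot_mean h.cont h.int x hR
  simp only [sub_mul]
  refine ⟨i1.sub i2, ?_⟩
  rw [integral_sub i1 i2, h2]
  linarith

theorem IsRep.mean_upper {u : E3 → ℝ} {c : ℝ} (h : IsRep u c) (x : E3) {R : ℝ} (hR : 1 ≤ R) :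
    (∫ y, kap y) * (u x - pot (fun y => exp (3 * u y)) x) ≤
      (∫ y, exp (3 * u y)) + c * R ^ 2 / 2 * (∫ y, Psi y) +
      (∫ y, kap y) * (1 / π ^ 2 * (∫ y, exp (3 * u y))) * log (1 + ‖x‖ + R) := by
  have hR0 : 0 < R := by linarith
  have i1 : Integrable fun w => u (x + R • w) * kap w :=
    integrable_of_ball ((h.smooth.continuous.comp (by fun_prop)).mul continuous_kap)
      fun y hy => by rw [kap_eq_zero hy, mul_zero]
  have i2 := integrable_pot_kap h.cont h.int x hR0
  obtain ⟨-, h1⟩ := h.sub_pot_mean x hR0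
  simp only [sub_mul] at h1
  rw [integral_sub i1 i2] at h1
  have hM := exp_three_mass_pos h
  set M := ∫ y, exp (3 * u y)
  have h2 : ∫ w, u (x + R • w) * kap w ≤ M := by
    refine (mean_le_mass h hR0 x).trans ?_
    have : (R ^ 3)⁻¹ ≤ 1 := inv_le_one_of_one_le₀ (one_le_pow₀ hR)
    nlinarith
  have h3 : ∫ w, -(1 / π ^ 2 * M * log (1 + ‖x‖ + R)) * kap w ≤
      ∫ w, pot (fun y => exp (3 * u y)) (x + R • w) * kap w := by
    refine integral_mono (integrable_kap.const_mul _) i2 fun w => ?_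
    rcases le_or_gt 1 ‖w‖ with hw | hw
    · simp [kap_eq_zero hw]
    refine mul_le_mul_of_nonneg_right ?_ (kap_nonneg w)
    refine le_trans ?_ (pot_lower h.cont h.int (fun y => (exp_pos _).le) _)
    have : ‖x + R • w‖ ≤ ‖x‖ + R := by
      refine (norm_add_le _ _).trans ?_
      rw [norm_smul, Real.norm_of_nonneg hR0.le]
      nlinarith
    have h4 : log (1 + ‖x + R • w‖) ≤ log (1 + ‖x‖ + R) :=
      Real.log_le_log (by positivity) (by linarith)
    have : 0 ≤ 1 / π ^ 2 * M := by positivity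
    nlinarith
  rw [integral_const_mul] at h3
  linarith

theorem IsRep.nonneg {u : E3 → ℝ} {c : ℝ} (h : IsRep u c) : 0 ≤ c := by
  have hP := integral_Psi_pos
  have hZ := integral_kap_pos
  have hM := exp_three_mass_pos h
  have : -c / 2 * ∫ y, Psi y ≤ 0 := by
    refine nonpos_of_quadratic_le (T₀ := 1)
      (a := (∫ y, exp (3 * u y)) - (∫ y, kap y) * (u 0 - pot (fun y => exp (3 * u y)) 0))
      (b := (∫ y, kap y) * (1 / π ^ 2 * (∫ y, exp (3 * u y)))) fun T hT => ?_
    have h1 := h.mean_upper 0 hT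
    have h2 := Real.log_le_sub_one_of_pos (show 0 < 1 + T by linarith)
    rw [norm_zero, add_zero] at h1
    have h3 : 0 ≤ (∫ y, kap y) * (1 / π ^ 2 * (∫ y, exp (3 * u y))) := by positivity
    nlinarith
  nlinarith

theorem IsRep.eq_pot_add {u : E3 → ℝ} (h : IsRep u 0) (x z : E3) :
    u x - pot (fun y => exp (3 * u y)) x = u z - pot (fun y => exp (3 * u y)) z := by
  have hM := exp_three_mass_pos h
  have hZ := integral_kap_pos
  refine liouville (p := fun x => u x - pot (fun y => exp (3 * u y)) x)
    (C := (∫ y, exp (3 * u y)) / ∫ y, kap y) (A := 1 / π ^ 2 * (∫ y, exp (3 * u y)) * 2)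
    (by positivity) (fun x R hR => (h.sub_pot_mean x hR).1)
    (fun x R hR => by rw [(h.sub_pot_mean x hR).2]; ring) (fun x => ?_) x z
  have h1 := h.mean_upper x le_rfl
  have h2 := log_le_two_sqrt (show 0 < 2 + ‖x‖ by positivity)
  rw [show 1 + ‖x‖ + 1 = 2 + ‖x‖ by ring] at h1
  refine le_of_mul_le_mul_left ?_ hZ
  have h3 : (∫ y, kap y) * (1 / π ^ 2 * (∫ y, exp (3 * u y))) * log (2 + ‖x‖) ≤
    (∫ y, kap y) * (1 / π ^ 2 * (∫ y, exp (3 * u y))) * (2 * √(2 + ‖x‖)) := by gcongr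
  refine h1.trans ?_
  rw [mul_add, mul_div_cancel₀ _ hZ.ne']
  linarith

theorem contDiff_Psi : ContDiff ℝ 1 Psi := by
  rw [contDiff_one_iff_hasFDerivAt]
  refine ⟨_, ?_, hasFDerivAt_Psi⟩
  exact (continuous_kap.neg).smul (innerSL ℝ).continuous

/-- Divergence of a vector field on `ℝ³`. -/
noncomputable def divg (X : E3 → E3) (x : E3) : ℝ :=
  ∑ i : Fin 3, fderiv ℝ X x (EuclideanSpace.single i 1) i

theorem continuous_divg {X : E3 → E3} (hX : ContDiff ℝ 1 X) : Continuous (divg X) := by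
  refine continuous_finsetSum _ fun i _ => ?_
  have h1 : Continuous fun x => fderiv ℝ X x (EuclideanSpace.single i 1) :=
    (hX.continuous_fderiv one_ne_zero).clm_apply continuous_const
  exact (EuclideanSpace.proj (𝕜 := ℝ) i).continuous.comp h1

theorem divg_eq_zero {X : E3 → E3} {x : E3} (h : x ∉ tsupport X) : divg X x = 0 := by
  have : fderiv ℝ X x = 0 := by
    by_contra h2
    exact h (support_fderiv_subset ℝ h2)
  simp [divg, this]

theorem hasCompactSupport_divg {X : E3 → E3} (h : HasCompactSupport X) :
    HasCompactSupport (divg X) :=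
  HasCompactSupport.intro h fun _ hx => divg_eq_zero hx

theorem integral_fderiv_apply {X : E3 → E3} (hX : ContDiff ℝ 1 X) (hs : HasCompactSupport X)
    {g : E3 → ℝ} (hg : ContDiff ℝ 1 g) :
    ∫ x, fderiv ℝ g x (X x) = -∫ x, divg X x * g x := by
  have hXi : ∀ i : Fin 3, ContDiff ℝ 1 fun x => X x i := fun i =>
    (EuclideanSpace.proj (𝕜 := ℝ) i).contDiff.comp hX
  have hsi : ∀ i : Fin 3, HasCompactSupport fun x => X x i := fun i =>
    hs.comp_left (g := fun v : E3 => v i) rfl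
  have hgc := hg.continuous
  have hdg : ∀ i : Fin 3, Continuous fun x => fderiv ℝ g x (EuclideanSpace.single i 1) := fun i =>
    (hg.continuous_fderiv one_ne_zero).clm_apply continuous_const
  have hdX : ∀ i : Fin 3, Continuous fun x =>
      fderiv ℝ (fun x => X x i) x (EuclideanSpace.single i 1) := fun i =>
    ((hXi i).continuous_fderiv one_ne_zero).clm_apply continuous_const
  have hdXs : ∀ i : Fin 3, HasCompactSupport fun x =>
      fderiv ℝ (fun x => X x i) x (EuclideanSpace.single i 1) := fun i =>
    (hsi i).fderiv_apply ℝ _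
  have e1 : ∀ x, fderiv ℝ g x (X x) =
      ∑ i : Fin 3, X x i * fderiv ℝ g x (EuclideanSpace.single i 1) := fun x =>
    fderiv_eq_sum g x (X x)
  have e2 : ∀ x, divg X x * g x =
      ∑ i : Fin 3, fderiv ℝ (fun x => X x i) x (EuclideanSpace.single i 1) * g x := fun x => by
    rw [divg, Finset.sum_mul]
    refine Finset.sum_congr rfl fun i _ => ?_
    have h1 : HasFDerivAt (fun x => X x i)
        ((EuclideanSpace.proj (𝕜 := ℝ) i : E3 →L[ℝ] ℝ).comp (fderiv ℝ X x)) x :=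
      (EuclideanSpace.proj (𝕜 := ℝ) i : E3 →L[ℝ] ℝ).hasFDerivAt.comp x
        (hX.differentiable one_ne_zero x).hasFDerivAt
    rw [h1.fderiv]; rfl
  rw [integral_congr_ae (Eventually.of_forall e1), integral_congr_ae (Eventually.of_forall e2),
    integral_finsetSum, integral_finsetSum, ← Finset.sum_neg_distrib]
  · refine Finset.sum_congr rfl fun i _ => ?_
    refine integral_mul_fderiv_eq_neg_fderiv_mul_of_integrable ?_ ?_ ?_
      (fun x _ => (hXi i).differentiable one_ne_zero x)
      (fun x _ => hg.differentiable one_ne_zero x)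
    · exact ((hdX i).mul hgc).integrable_of_hasCompactSupport ((hdXs i).mul_right)
    · exact ((hXi i).continuous.mul (hdg i)).integrable_of_hasCompactSupport ((hsi i).mul_right)
    · exact ((hXi i).continuous.mul hgc).integrable_of_hasCompactSupport ((hsi i).mul_right)
  · exact fun i _ => ((hdX i).mul hgc).integrable_of_hasCompactSupport ((hdXs i).mul_right)
  · exact fun i _ =>
      ((hXi i).continuous.mul (hdg i)).integrable_of_hasCompactSupport ((hsi i).mul_right)

theorem integrable_log_sub {F : E3 → ℝ} (hF : Continuous F) (hs : HasCompactSupport F) (y : E3) :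
    Integrable fun x => ‖F x‖ * (2 + 2 * ‖x - y‖ ^ 2 + 1 / ‖x - y‖ ^ 2) := by
  have h1 : Integrable fun x => ‖F x‖ * (2 + 2 * ‖x - y‖ ^ 2) := by
    refine Continuous.integrable_of_hasCompactSupport (by fun_prop) ?_
    exact hs.norm.mul_right
  have h2 := integrable_mul_inv_sq hF.norm (hF.norm.integrable_of_hasCompactSupport hs.norm) y
  refine (h1.add h2).congr (Eventually.of_forall fun x => ?_)
  simp only [Pi.add_apply]
  rw [norm_sub_rev y x]; ring

theorem integrable_mul_log_sub {F : E3 → ℝ} (hF : Continuous F) (hs : HasCompactSupport F)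
    (y : E3) : Integrable fun x => F x * log ‖x - y‖ := by
  refine (integrable_log_sub hF hs y).mono' (hF.aestronglyMeasurable.mul
    (Measurable.aestronglyMeasurable (by fun_prop))) ?_
  filter_upwards [Measure.ae_ne volume y] with x hx
  have h0 : 0 < ‖x - y‖ := norm_pos_iff.2 (sub_ne_zero.2 hx)
  rw [norm_mul, Real.norm_eq_abs (log _)]
  gcongr
  refine (abs_log_le h0).trans ?_
  nlinarith [sq_nonneg ‖x - y‖]

theorem integral_divg_log {X : E3 → E3} (hX : ContDiff ℝ 1 X) (hs : HasCompactSupport X) (y : E3) :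
    ∫ x, divg X x * log ‖x - y‖ = -∫ x, inner ℝ (x - y) (X x) * (1 / ‖x - y‖ ^ 2) := by
  have hne : ∀ᵐ x : E3, x - y ≠ 0 := by
    filter_upwards [Measure.ae_ne volume y] with x hx using sub_ne_zero.2 hx
  have h1 : ∀ e : ℝ, e ≠ 0 → ∫ x, divg X x * logE e (x - y) =
      -∫ x, inner ℝ (x - y) (X x) * (1 / (‖x - y‖ ^ 2 + e ^ 2)) := fun e he => by
    have hg : ContDiff ℝ 1 fun x => logE e (x - y) :=
      (contDiff_logE he).comp (contDiff_id.sub contDiff_const)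
    rw [eq_comm, neg_eq_iff_eq_neg, ← integral_fderiv_apply hX hs hg]
    refine integral_congr_ae (Eventually.of_forall fun x => ?_)
    have hd : HasFDerivAt (fun x => logE e (x - y))
        ((‖x - y‖ ^ 2 + e ^ 2)⁻¹ • innerSL ℝ (x - y)) x := by
      exact (hasFDerivAt_logE he (x - y)).comp x ((hasFDerivAt_id x).sub_const y)
    simp only
    rw [hd.fderiv, one_div, mul_comm]
    rfl
  have hcd := continuous_divg hX
  have hsd := hasCompactSupport_divg hs
  have t1 : Tendsto (fun e : ℝ => ∫ x, divg X x * logE e (x - y)) (𝓝[>] 0)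
      (𝓝 (∫ x, divg X x * log ‖x - y‖)) := by
    refine tendsto_integral_filter_of_dominated_convergence _ ?_ ?_
      (integrable_log_sub hcd hsd y) ?_
    · filter_upwards [self_mem_nhdsWithin] with e he
      have he : 0 < e := he
      have : Continuous (logE e) := (contDiff_logE (n := 1) he.ne').continuous
      exact (hcd.mul (this.comp (by fun_prop))).aestronglyMeasurable
    · filter_upwards [Ioc_mem_nhdsGT one_pos] with e he
      filter_upwards [hne] with x hx
      rw [norm_mul, Real.norm_eq_abs (logE _ _)]
      gcongr
      exact abs_logE_le (by rw [abs_of_pos he.1]; exact he.2) hx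
    · filter_upwards [hne] with x hx using (tendsto_logE hx).const_mul _
  have t2 : Tendsto (fun e : ℝ => ∫ x, inner ℝ (x - y) (X x) * (1 / (‖x - y‖ ^ 2 + e ^ 2)))
      (𝓝[>] 0) (𝓝 (∫ x, inner ℝ (x - y) (X x) * (1 / ‖x - y‖ ^ 2))) := by
    have hXc := hX.continuous
    have hF : Continuous fun x => inner ℝ (x - y) (X x) := by fun_prop
    have hFs : HasCompactSupport fun x => inner ℝ (x - y) (X x) :=
      hs.mono fun x hx h0 => hx (by simp [h0])
    refine tendsto_integral_filter_of_dominated_convergence _ ?_ ?_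
      (integrable_log_sub hF hFs y) ?_
    · exact Eventually.of_forall fun e =>
        hF.aestronglyMeasurable.mul (Measurable.aestronglyMeasurable (by fun_prop))
    · refine Eventually.of_forall fun e => ?_
      filter_upwards [hne] with x hx
      have h0 : 0 < ‖x - y‖ := norm_pos_iff.2 hx
      rw [norm_mul, Real.norm_of_nonneg (show 0 ≤ 1 / (‖x - y‖ ^ 2 + e ^ 2) by positivity)]
      gcongr
      have : 1 / (‖x - y‖ ^ 2 + e ^ 2) ≤ 1 / ‖x - y‖ ^ 2 := by
        gcongr; nlinarith [sq_nonneg e]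
      nlinarith [sq_nonneg ‖x - y‖]
    · filter_upwards [hne] with x hx
      have h0 : 0 < ‖x - y‖ := norm_pos_iff.2 hx
      refine Tendsto.const_mul _ ?_
      have hc : ContinuousAt (fun e : ℝ => 1 / (‖x - y‖ ^ 2 + e ^ 2)) 0 := by
        refine ContinuousAt.div continuousAt_const (by fun_prop) (by positivity)
      have := hc.tendsto.mono_left (nhdsWithin_le_nhds (s := Set.Ioi (0:ℝ)))
      simpa using this
  refine tendsto_nhds_unique t1 (t2.neg.congr' ?_)
  filter_upwards [self_mem_nhdsWithin] with e he
  exact (h1 e (ne_of_gt he)).symm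

theorem integrable_prod_kappa {F ρ : E3 → ℝ} (hF : Continuous F) (hs : HasCompactSupport F)
    (hρ : Integrable ρ) (A : ℝ) :
    Integrable (fun p : E3 × E3 => ‖F p.1‖ * ‖ρ p.2‖ * (A + kappa 1 (p.1 - p.2)))
      ((volume : Measure E3).prod volume) := by
  obtain ⟨B, hB⟩ := hs.exists_bound_of_continuous hF
  have h1 : Integrable (fun p : E3 × E3 => ‖F p.1‖ * (A * ‖ρ p.2‖))
      ((volume : Measure E3).prod volume) :=
    (hF.norm.integrable_of_hasCompactSupport hs.norm).mul_prod (hρ.norm.const_mul A)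
  have h2 : Integrable (fun p : E3 × E3 => ‖ρ p.2‖ * kappa 1 (p.1 - p.2))
      ((volume : Measure E3).prod volume) := by
    simpa using hρ.norm.convolution_integrand (ContinuousLinearMap.mul ℝ ℝ) integrable_kappa_one
  have h3 : Integrable (fun p : E3 × E3 => ‖F p.1‖ * (‖ρ p.2‖ * kappa 1 (p.1 - p.2)))
      ((volume : Measure E3).prod volume) := by
    refine (h2.const_mul B).mono' ?_ (Eventually.of_forall fun p => ?_)
    · exact (hF.comp continuous_fst).norm.aestronglyMeasurable.mul h2.aestronglyMeasurable
    · have := hB p.1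
      have h4 := kappa_nonneg 1 (p.1 - p.2)
      rw [Real.norm_of_nonneg (by positivity)]
      gcongr
  refine (h1.add h3).congr (Eventually.of_forall fun p => ?_)
  simp only [Pi.add_apply]; ring

theorem inv_norm_le (z : E3) : 1 / ‖z‖ ≤ 1 + kappa 1 z := by
  rcases (norm_nonneg z).eq_or_lt with h | h
  · rw [← h]; simpa using add_nonneg zero_le_one (kappa_nonneg 1 z)
  rcases lt_or_ge ‖z‖ 1 with h2 | h2
  · have k : kappa 1 z = 1 / ‖z‖ ^ 2 * √(1 + 1 / ‖z‖) := by
      rw [kappa, Set.indicator_of_mem (by simpa using h2)]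
    have h3 : 1 ≤ √(1 + 1 / ‖z‖) := by
      rw [Real.one_le_sqrt]; linarith [show 0 ≤ 1 / ‖z‖ by positivity]
    have h4 : 1 / ‖z‖ ≤ 1 / ‖z‖ ^ 2 := by
      rw [div_le_div_iff₀ h (by positivity)]; nlinarith
    have h5 : 0 ≤ 1 / ‖z‖ ^ 2 := by positivity
    rw [k]; nlinarith
  · have : 1 / ‖z‖ ≤ 1 := by rw [div_le_one h]; exact h2
    linarith [kappa_nonneg 1 z]

theorem integral_mul_pot {F ρ : E3 → ℝ} (hF : Continuous F) (hs : HasCompactSupport F)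
    (hρc : Continuous ρ) (hρ : Integrable ρ) :
    ∫ x, F x * pot ρ x = 1 / π ^ 2 * ∫ y, ρ y * ∫ x, F x * logL x y := by
  obtain ⟨r, hr⟩ := hs.isCompact.isBounded.subset_closedBall (0 : E3)
  have hi : Integrable (fun p : E3 × E3 => F p.1 * (ρ p.2 * logL p.1 p.2))
      ((volume : Measure E3).prod volume) := by
    refine (integrable_prod_kappa hF hs hρ (log (2 + r) + 1)).mono' ?_ ?_
    · exact (hF.comp continuous_fst).aestronglyMeasurable.mul
        ((hρc.comp continuous_snd).aestronglyMeasurable.mul measurable_logL.aestronglyMeasurable)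
    · refine Eventually.of_forall fun p => ?_
      by_cases hp : F p.1 = 0
      · simp [hp]
      have h1 : ‖p.1‖ ≤ r := by
        have := hr (subset_tsupport F hp)
        rwa [mem_closedBall_zero_iff] at this
      have h2 := abs_logL_le p.1 p.2
      have h3 := log_one_add_inv_le (p.1 - p.2)
      have h4 : log (2 + ‖p.1‖) ≤ log (2 + r) :=
        Real.log_le_log (by positivity) (by linarith)
      rw [norm_mul, norm_mul, ← mul_assoc, Real.norm_eq_abs (logL _ _)]
      gcongr
      linarith
  have e1 : ∀ x, F x * pot ρ x = 1 / π ^ 2 * ∫ y, F x * (ρ y * logL x y) := fun x => by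
    rw [integral_const_mul, pot]; ring
  rw [integral_congr_ae (Eventually.of_forall e1), integral_const_mul, integral_integral_swap hi]
  congr 1
  refine integral_congr_ae (Eventually.of_forall fun y => ?_)
  simp only
  rw [← integral_const_mul]
  congr 1; ext x; ring

theorem virial_symm {ρ : E3 → ℝ} {ξ : E3 → E3} (hρc : Continuous ρ) (hρi : Integrable ρ)
    (hξc : Continuous ξ) (hs : HasCompactSupport ξ) :
    2 * ∫ y, ρ y * ∫ x, inner ℝ (x - y) (ρ x • ξ x) * (1 / ‖x - y‖ ^ 2) =
      ∫ p : E3 × E3, ρ p.1 * ρ p.2 *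
      (inner ℝ (p.1 - p.2) (ξ p.1 - ξ p.2) * (1 / ‖p.1 - p.2‖ ^ 2))
        ∂((volume : Measure E3).prod volume) := by
  let G : E3 × E3 → ℝ := fun p => ρ p.1 * ρ p.2 *
    (inner ℝ (p.1 - p.2) (ξ p.1) * (1 / ‖p.1 - p.2‖ ^ 2))
  have hGi : Integrable G ((volume : Measure E3).prod volume) := by
    have hXc : Continuous fun x => ρ x • ξ x := hρc.smul hξc
    have hXs : HasCompactSupport fun x => ρ x • ξ x := hs.mono fun x hx h0 => hx (by simp [h0])
    refine (integrable_prod_kappa hXc.norm hXs.norm hρi 1).mono' ?_ ?_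
    · refine AEStronglyMeasurable.mul ?_ (AEStronglyMeasurable.mul ?_
        (Measurable.aestronglyMeasurable (by fun_prop)))
      · exact Continuous.aestronglyMeasurable (by fun_prop)
      · exact Continuous.aestronglyMeasurable (by fun_prop)
    · refine Eventually.of_forall fun p => ?_
      have h1 := norm_inner_le_norm (𝕜 := ℝ) (p.1 - p.2) (ξ p.1)
      have h2 := inv_norm_le (p.1 - p.2)
      have h3 : ‖ρ p.1 • ξ p.1‖ = ‖ρ p.1‖ * ‖ξ p.1‖ := norm_smul _ _
      have h4 : 0 ≤ 1 / ‖p.1 - p.2‖ ^ 2 := by positivity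
      rw [norm_norm, h3]
      simp only [G, norm_mul]
      rw [Real.norm_of_nonneg h4]
      calc ‖ρ p.1‖ * ‖ρ p.2‖ * (‖inner ℝ (p.1 - p.2) (ξ p.1)‖ * (1 / ‖p.1 - p.2‖ ^ 2))
          ≤ ‖ρ p.1‖ * ‖ρ p.2‖ * (‖p.1 - p.2‖ * ‖ξ p.1‖ * (1 / ‖p.1 - p.2‖ ^ 2)) := by gcongr
        _ = ‖ρ p.1‖ * ‖ξ p.1‖ * ‖ρ p.2‖ * (1 / ‖p.1 - p.2‖) := by
          rcases (norm_nonneg (p.1 - p.2)).eq_or_lt with h0 | h0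
          · rw [← h0]; simp
          · field_simp
        _ ≤ _ := by gcongr
  have s4 : ∫ y, ρ y * ∫ x, inner ℝ (x - y) (ρ x • ξ x) * (1 / ‖x - y‖ ^ 2) =
      ∫ p, G p ∂((volume : Measure E3).prod volume) := by
    rw [integral_prod_symm _ hGi]
    refine integral_congr_ae (Eventually.of_forall fun y => ?_)
    simp only
    rw [← integral_const_mul]
    congr 1; ext x
    simp only [G]
    rw [inner_smul_right]; ring
  have s5 : ∫ p, G p ∂((volume : Measure E3).prod volume) =
      ∫ p, G p.swap ∂((volume : Measure E3).prod volume) :=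
    (integral_prod_swap G).symm
  have s6 : ∫ p : E3 × E3, ρ p.1 * ρ p.2 *
      (inner ℝ (p.1 - p.2) (ξ p.1 - ξ p.2) * (1 / ‖p.1 - p.2‖ ^ 2))
        ∂((volume : Measure E3).prod volume) =
      2 * ∫ p, G p ∂((volume : Measure E3).prod volume) := by
    rw [two_mul]
    conv_rhs => arg 2; rw [s5]
    have hGs : Integrable (fun p : E3 × E3 => G p.swap) ((volume : Measure E3).prod volume) :=
      hGi.swap
    rw [← integral_add hGi hGs]
    congr 1; ext p
    simp only [G, Prod.fst_swap, Prod.snd_swap]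
    rw [norm_sub_rev p.2 p.1, inner_sub_right, ← neg_sub p.1 p.2, inner_neg_left]
    ring
  rw [s6, s4]

theorem IsRep.virial {u : E3 → ℝ} (h : IsRep u 0) {ξ : E3 → E3} (hξ : ContDiff ℝ 1 ξ)
    (hs : HasCompactSupport ξ) :
    ∫ x, divg ξ x * exp (3 * u x) = 3 / (2 * π ^ 2) * ∫ p : E3 × E3,
      exp (3 * u p.1) * exp (3 * u p.2) *
        (inner ℝ (p.1 - p.2) (ξ p.1 - ξ p.2) * (1 / ‖p.1 - p.2‖ ^ 2))
        ∂((volume : Measure E3).prod volume) := by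
  have hu1 : ContDiff ℝ 1 u := h.smooth.of_le (by norm_num)
  have hud : Differentiable ℝ u := hu1.differentiable one_ne_zero
  set ρ : E3 → ℝ := fun x => exp (3 * u x) with hρdef
  have hρ1 : ContDiff ℝ 1 ρ := (contDiff_const.mul hu1).exp
  have hρc : Continuous ρ := h.cont
  have hρi : Integrable ρ := h.int
  set X : E3 → E3 := fun x => ρ x • ξ x with hX
  have hXd : ContDiff ℝ 1 X := hρ1.smul hξ
  have hXs : HasCompactSupport X := hs.mono fun x hx h0 => hx (by simp [hX, h0])
  have hdρ : ∀ x, fderiv ℝ ρ x (ξ x) = 3 * fderiv ℝ u x (X x) := fun x => by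
    have : HasFDerivAt ρ (exp (3 * u x) • ((3 : ℝ) • fderiv ℝ u x)) x :=
      ((hud x).hasFDerivAt.const_mul 3).exp
    rw [this.fderiv, hX, map_smul]
    simp [hρdef]; ring
  have s1 : ∫ x, divg ξ x * ρ x = -(3 * ∫ x, fderiv ℝ u x (X x)) := by
    have := integral_fderiv_apply hξ hs hρ1
    rw [integral_congr_ae (Eventually.of_forall hdρ), integral_const_mul] at this
    linarith
  have hdX := continuous_divg hXd
  have hdXs := hasCompactSupport_divg hXs
  have s0 : ∫ x, divg X x = 0 := by
    have := integral_fderiv_apply hXd hXs (g := fun _ => (1:ℝ)) contDiff_const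
    simpa using this
  have s2 : ∫ x, fderiv ℝ u x (X x) = -∫ x, divg X x * pot ρ x := by
    have := integral_fderiv_apply hXd hXs (g := fun x => u x - (u 0 - pot ρ 0))
      (hu1.sub contDiff_const)
    simp only [fderiv_sub_const] at this
    rw [this]
    congr 2
    ext x
    have := h.eq_pot_add x 0
    rw [← this]; ring
  have s3 : ∀ y, ∫ x, divg X x * logL x y =
      ∫ x, inner ℝ (x - y) (X x) * (1 / ‖x - y‖ ^ 2) := fun y => by
    have e : ∀ x, divg X x * logL x y = divg X x * log (1 + ‖y‖) - divg X x * log ‖x - y‖ :=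
      fun x => by rw [logL]; ring
    rw [integral_congr_ae (Eventually.of_forall e), integral_sub
      ((hdX.integrable_of_hasCompactSupport hdXs).mul_const _) (integrable_mul_log_sub hdX hdXs y),
      integral_mul_const, s0, integral_divg_log hXd hXs]
    ring
  rw [integral_mul_pot hdX hdXs hρc hρi] at s2
  simp only [s3] at s2
  have s4 := virial_symm hρc hρi hξ.continuous hs
  rw [s1, ← s4, s2]
  simp only [hX]
  ring

noncomputable def xi (y : E3) : E3 := Psi y • y

theorem contDiff_xi : ContDiff ℝ 1 xi := contDiff_Psi.smul contDiff_id

theorem hasCompactSupport_xi : HasCompactSupport xi := by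
  refine HasCompactSupport.intro (isCompact_closedBall (0 : E3) 1) fun x hx => ?_
  rw [mem_closedBall_zero_iff, not_le] at hx
  rw [xi, Psi_eq_zero hx.le, zero_smul]

theorem Psi_zero : Psi 0 = 1 / 4 := by simp [Psi, kap]

theorem divg_xi_zero : divg xi 0 = 3 / 4 := by
  have h : HasFDerivAt xi (Psi 0 • ContinuousLinearMap.id ℝ E3 +
      (-(kap 0) • innerSL ℝ (0 : E3)).smulRight (0 : E3)) 0 :=
    (hasFDerivAt_Psi 0).smul (hasFDerivAt_id 0)
  rw [divg, h.fderiv]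
  simp [Psi_zero]
  norm_num

theorem divg_scale (R : ℝ) (hR : 0 < R) (x : E3) :
    divg (fun x => R • xi (R⁻¹ • x)) x = divg xi (R⁻¹ • x) := by
  have h : HasFDerivAt (fun x => R • xi (R⁻¹ • x)) (fderiv ℝ xi (R⁻¹ • x)) x := by
    have h1 := (contDiff_xi.differentiable one_ne_zero (R⁻¹ • x)).hasFDerivAt
    have h2 := (h1.comp x ((hasFDerivAt_id x).const_smul R⁻¹)).const_smul R
    refine h2.congr_fderiv ?_
    ext1 v
    simp [smul_smul, hR.ne']
  rw [divg, divg, h.fderiv]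

theorem ae_prod_ne : ∀ᵐ p : E3 × E3 ∂((volume : Measure E3).prod volume), p.1 ≠ p.2 := by
  rw [Measure.ae_prod_iff_ae_ae]
  · refine Eventually.of_forall fun x => ?_
    filter_upwards [Measure.ae_ne volume x] with y hy using hy.symm
  · exact (isOpen_ne_fun continuous_fst continuous_snd).measurableSet

theorem tendsto_inv_smul (x : E3) : Tendsto (fun R : ℝ => R⁻¹ • x) atTop (𝓝 0) := by
  have := (tendsto_inv_atTop_zero (𝕜 := ℝ)).smul_const x
  rwa [zero_smul] at this

theorem tendsto_integral_divg_xi {ρ : E3 → ℝ} (hρc : Continuous ρ) (hρ : Integrable ρ) :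
    Tendsto (fun R : ℝ => ∫ x, divg (fun x => R • xi (R⁻¹ • x)) x * ρ x) atTop
      (𝓝 (∫ x, 3 / 4 * ρ x)) := by
  have hcd := continuous_divg contDiff_xi
  obtain ⟨B, hB⟩ := (hasCompactSupport_divg hasCompactSupport_xi).exists_bound_of_continuous hcd
  refine tendsto_integral_filter_of_dominated_convergence (fun x => B * ‖ρ x‖) ?_ ?_
    (hρ.norm.const_mul B) ?_
  · filter_upwards [eventually_gt_atTop 0] with R hR
    simp only [divg_scale R hR]
    exact ((hcd.comp (by fun_prop)).mul hρc).aestronglyMeasurable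
  · filter_upwards [eventually_gt_atTop 0] with R hR
    refine Eventually.of_forall fun x => ?_
    rw [divg_scale R hR, norm_mul]
    gcongr
    exact hB _
  · refine Eventually.of_forall fun x => Tendsto.mul_const _ ?_
    rw [← divg_xi_zero]
    refine ((hcd.tendsto 0).comp (tendsto_inv_smul x)).congr' ?_
    filter_upwards [eventually_gt_atTop 0] with R hR
    exact (divg_scale R hR x).symm

theorem tendsto_integral_inner_xi {G : E3 × E3 → ℝ}
    (hG : Integrable G ((volume : Measure E3).prod volume)) :
    Tendsto (fun R : ℝ => ∫ p : E3 × E3, G p *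
        (inner ℝ (p.1 - p.2) (R • xi (R⁻¹ • p.1) - R • xi (R⁻¹ • p.2)) * (1 / ‖p.1 - p.2‖ ^ 2))
        ∂((volume : Measure E3).prod volume)) atTop
      (𝓝 (∫ p : E3 × E3, G p * (1 / 4) ∂((volume : Measure E3).prod volume))) := by
  obtain ⟨L, hL⟩ := contDiff_xi.lipschitzWith_of_hasCompactSupport hasCompactSupport_xi one_ne_zero
  refine tendsto_integral_filter_of_dominated_convergence
    (fun p => ‖G p‖ * L) ?_ ?_ (hG.norm.mul_const _) ?_
  · have := contDiff_xi.continuous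
    refine Eventually.of_forall fun R => AEStronglyMeasurable.mul hG.aestronglyMeasurable
      (AEStronglyMeasurable.mul (Continuous.aestronglyMeasurable (by fun_prop))
      (Measurable.aestronglyMeasurable (by fun_prop)))
  · filter_upwards [eventually_gt_atTop 0] with R hR
    filter_upwards [ae_prod_ne] with p hp
    have h0 : 0 < ‖p.1 - p.2‖ := norm_pos_iff.2 (sub_ne_zero.2 hp)
    have h1 := norm_inner_le_norm (𝕜 := ℝ) (p.1 - p.2) (R • xi (R⁻¹ • p.1) - R • xi (R⁻¹ • p.2))
    have h2 : ‖R • xi (R⁻¹ • p.1) - R • xi (R⁻¹ • p.2)‖ ≤ L * ‖p.1 - p.2‖ := by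
      have := hL.dist_le_mul (R⁻¹ • p.1) (R⁻¹ • p.2)
      rw [dist_eq_norm, dist_eq_norm, ← smul_sub, norm_smul, norm_inv,
        Real.norm_of_nonneg hR.le] at this
      rw [← smul_sub, norm_smul, Real.norm_of_nonneg hR.le]
      calc _ ≤ R * (L * (R⁻¹ * ‖p.1 - p.2‖)) := by gcongr
        _ = _ := by field_simp
    rw [norm_mul, norm_mul (inner ℝ _ _), Real.norm_of_nonneg (show 0 ≤ 1 / ‖p.1 - p.2‖ ^ 2 by positivity)]
    gcongr
    calc _ ≤ ‖p.1 - p.2‖ * (L * ‖p.1 - p.2‖) * (1 / ‖p.1 - p.2‖ ^ 2) := by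
          gcongr; exact h1.trans (by gcongr)
      _ = L := by field_simp
  · filter_upwards [ae_prod_ne] with p hp
    have h0 : 0 < ‖p.1 - p.2‖ := norm_pos_iff.2 (sub_ne_zero.2 hp)
    refine Tendsto.const_mul _ ?_
    have hx : ∀ x : E3, Tendsto (fun R : ℝ => R • xi (R⁻¹ • x)) atTop (𝓝 ((1 / 4 : ℝ) • x)) :=
      fun x => by
        have h1 := ((continuous_Psi.tendsto 0).comp (tendsto_inv_smul x)).smul_const x
        rw [Psi_zero] at h1
        refine h1.congr' ?_
        filter_upwards [eventually_gt_atTop 0] with R hR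
        simp only [Function.comp, xi]
        rw [smul_smul, smul_smul]; congr 1; field_simp
    have h2 : (1 / 4 : ℝ) = inner ℝ (p.1 - p.2) ((1 / 4 : ℝ) • p.1 - (1 / 4 : ℝ) • p.2) *
        (1 / ‖p.1 - p.2‖ ^ 2) := by
      rw [← smul_sub, inner_smul_right, real_inner_self_eq_norm_sq]; field_simp
    rw [h2]
    exact (tendsto_const_nhds.inner ((hx p.1).sub (hx p.2))).mul_const _

/-- Pohozaev: the total volume of a solution with vanishing constant is `2π²`. -/
theorem IsRep.mass {u : E3 → ℝ} (h : IsRep u 0) : ∫ x, exp (3 * u x) = 2 * π ^ 2 := by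
  have hM := exp_three_mass_pos h
  have hv : ∀ R : ℝ, 0 < R →
      ∫ x, divg (fun x => R • xi (R⁻¹ • x)) x * exp (3 * u x) =
      3 / (2 * π ^ 2) * ∫ p : E3 × E3, exp (3 * u p.1) * exp (3 * u p.2) *
        (inner ℝ (p.1 - p.2) (R • xi (R⁻¹ • p.1) - R • xi (R⁻¹ • p.2)) * (1 / ‖p.1 - p.2‖ ^ 2))
        ∂((volume : Measure E3).prod volume) := fun R hR => by
    have c1 : ContDiff ℝ 1 (fun x : E3 => R • xi (R⁻¹ • x)) :=
      (contDiff_xi.comp ((contDiff_id (𝕜 := ℝ) (E := E3)).const_smul R⁻¹)).const_smul R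
    suffices c2 : HasCompactSupport (fun x : E3 => R • xi (R⁻¹ • x)) from h.virial c1 c2
    refine HasCompactSupport.intro (isCompact_closedBall (0 : E3) R) fun x hx => ?_
    rw [mem_closedBall_zero_iff, not_le] at hx
    rw [xi, Psi_eq_zero, zero_smul, smul_zero]
    rw [norm_smul, norm_inv, Real.norm_of_nonneg hR.le, inv_mul_eq_div, le_div_iff₀ hR]
    linarith
  have hρρ : Integrable (fun p : E3 × E3 => exp (3 * u p.1) * exp (3 * u p.2))
      ((volume : Measure E3).prod volume) := h.int.mul_prod h.int
  have t1 := tendsto_integral_divg_xi h.cont h.int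
  have t2 := tendsto_integral_inner_xi hρρ
  have h3 := tendsto_nhds_unique t1 ((t2.const_mul (3 / (2 * π ^ 2))).congr' (by
    filter_upwards [eventually_gt_atTop 0] with R hR
    exact (hv R hR).symm))
  rw [integral_const_mul, integral_mul_const,
    integral_prod_mul (fun x => exp (3 * u x)) (fun x => exp (3 * u x))] at h3
  set M := ∫ x, exp (3 * u x)
  field_simp at h3
  nlinarith

/-- The integral equation `f(x) = -(1/π²) ∫ log|x-y| e^{3f(y)} dy + const` with mass `2π²`. -/
structure IsCrit (f : E3 → ℝ) : Prop where
  diff : Differentiable ℝ f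
  int : Integrable fun x => exp (3 * f x)
  mass : ∫ x, exp (3 * f x) = 2 * π ^ 2
  rep : ∀ x z, f x - f z =
    1 / π ^ 2 * ∫ y, exp (3 * f y) * (log ‖z - y‖ - log ‖x - y‖)

theorem IsCrit.cont {f : E3 → ℝ} (h : IsCrit f) : Continuous f := h.diff.continuous

theorem IsCrit.cont_exp {f : E3 → ℝ} (h : IsCrit f) : Continuous fun x => exp (3 * f x) :=
  continuous_exp.comp (continuous_const.mul h.cont)

theorem integrable_mul_log_sub_log {ρ : E3 → ℝ} (hρc : Continuous ρ) (hρ : Integrable ρ)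
    (x z : E3) : Integrable fun y => ρ y * (log ‖z - y‖ - log ‖x - y‖) := by
  refine ((integrable_mul_logL hρc hρ x).sub (integrable_mul_logL hρc hρ z)).congr
    (Eventually.of_forall fun y => ?_)
  simp only [logL, Pi.sub_apply]
  ring

theorem IsRep.isCrit {u : E3 → ℝ} (h : IsRep u 0) : IsCrit u where
  diff := h.smooth.differentiable two_ne_zero
  int := h.int
  mass := h.mass
  rep x z := by
    have h1 := h.eq_pot_add x z
    have h2 : u x - u z = pot (fun y => exp (3 * u y)) x - pot (fun y => exp (3 * u y)) z := by
      linarith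
    rw [h2, pot, pot, ← mul_sub, ← integral_sub (integrable_mul_logL h.cont h.int x)
      (integrable_mul_logL h.cont h.int z)]
    congr 2; ext y
    simp only [logL]; ring

theorem IsCrit.translate {f : E3 → ℝ} (h : IsCrit f) (c : E3) : IsCrit fun x => f (x + c) where
  diff := h.diff.comp (differentiable_id.add_const c)
  int := h.int.comp_add_right c
  mass := by rw [integral_add_right_eq_self (μ := volume) (fun x => exp (3 * f x)) c, h.mass]
  rep x z := by
    rw [h.rep, ← integral_add_right_eq_self (μ := volume) _ c]
    congr 2; ext y
    rw [add_sub_add_right_eq_sub, add_sub_add_right_eq_sub]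

theorem IsCrit.lower {f : E3 → ℝ} (h : IsCrit f) : ∃ C, ∀ x, C - 2 * log (1 + ‖x‖) ≤ f x := by
  refine ⟨f 0 - pot (fun y => exp (3 * f y)) 0, fun x => ?_⟩
  have h1 := h.rep x 0
  have h2 := pot_lower h.cont_exp h.int (fun y => (exp_pos _).le) x
  have h3 : 1 / π ^ 2 * ∫ y, exp (3 * f y) * (log ‖0 - y‖ - log ‖x - y‖) =
      pot (fun y => exp (3 * f y)) x - pot (fun y => exp (3 * f y)) 0 := by
    rw [pot, pot, ← mul_sub, ← integral_sub (integrable_mul_logL h.cont_exp h.int x)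
      (integrable_mul_logL h.cont_exp h.int 0)]
    congr 2; ext y
    simp only [logL]; ring
  rw [h.mass] at h2
  have h4 : 1 / π ^ 2 * (2 * π ^ 2) * log (1 + ‖x‖) = 2 * log (1 + ‖x‖) := by field_simp
  linarith

noncomputable def inv3 (l : ℝ) (x : E3) : E3 := EuclideanGeometry.inversion (0 : E3) l x

theorem inv3_eq (l : ℝ) (x : E3) : inv3 l x = (l / ‖x‖) ^ 2 • x := by
  simp [inv3, EuclideanGeometry.inversion]

theorem norm_inv3 (l : ℝ) (x : E3) : ‖inv3 l x‖ = l ^ 2 / ‖x‖ := by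
  have := EuclideanGeometry.dist_inversion_center (0 : E3) x l
  rwa [dist_zero_right, dist_zero_right] at this

theorem inv3_inv3 {l : ℝ} (hl : 0 < l) (x : E3) : inv3 l (inv3 l x) = x :=
  EuclideanGeometry.inversion_inversion 0 hl.ne' x

theorem inv3_ne_zero {l : ℝ} (hl : 0 < l) {x : E3} (hx : x ≠ 0) : inv3 l x ≠ 0 := by
  rw [← norm_pos_iff, norm_inv3]
  have := norm_pos_iff.2 hx
  positivity

theorem continuousAt_inv3 {l : ℝ} {x : E3} (hx : x ≠ 0) :
    ContinuousAt (fun p : ℝ × E3 => inv3 p.1 p.2) (l, x) := by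
  simp only [inv3_eq]
  have : ‖(l, x).2‖ ≠ 0 := norm_ne_zero_iff.2 hx
  fun_prop (disch := assumption)

/-- The Kelvin transform of `f` with respect to the sphere of radius `l` about the origin. -/
noncomputable def kel (l : ℝ) (f : E3 → ℝ) (x : E3) : ℝ := f (inv3 l x) + 2 * log (l / ‖x‖)

theorem exp_kel {l : ℝ} (hl : 0 < l) (f : E3 → ℝ) {x : E3} (hx : x ≠ 0) :
    exp (3 * kel l f x) = (l / ‖x‖) ^ 6 * exp (3 * f (inv3 l x)) := by
  have h0 := norm_pos_iff.2 hx
  have : 3 * kel l f x = log ((l / ‖x‖) ^ 6) + 3 * f (inv3 l x) := by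
    rw [kel, log_pow]; push_cast; ring
  rw [this, exp_add, exp_log (by positivity)]

theorem continuousAt_kel {f : E3 → ℝ} (hf : Continuous f) {l : ℝ} (hl : 0 < l) {x : E3}
    (hx : x ≠ 0) : ContinuousAt (fun p : ℝ × E3 => kel p.1 f p.2) (l, x) := by
  have h1 : ContinuousAt (fun p : ℝ × E3 => f (inv3 p.1 p.2)) (l, x) :=
    ContinuousAt.comp hf.continuousAt (continuousAt_inv3 hx)
  have h2 : ‖(l, x).2‖ ≠ 0 := norm_ne_zero_iff.2 hx
  have h3 : (l, x).1 / ‖(l, x).2‖ ≠ 0 := div_ne_zero hl.ne' h2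
  have h4 : ContinuousAt (fun p : ℝ × E3 => log (p.1 / ‖p.2‖)) (l, x) :=
    ContinuousAt.log (by fun_prop (disch := assumption)) h3
  exact h1.add (h4.const_mul 2)

theorem continuousOn_kel {f : E3 → ℝ} (hf : Continuous f) {l : ℝ} (hl : 0 < l) :
    ContinuousOn (kel l f) {0}ᶜ := fun x hx =>
  ((continuousAt_kel hf hl hx).comp (f := fun x : E3 => (l, x))
    (by fun_prop)).continuousWithinAt

/-- The punctured ball. -/
def pball (l : ℝ) : Set E3 := {y | y ≠ 0 ∧ ‖y‖ < l}

theorem isOpen_pball (l : ℝ) : IsOpen (pball l) :=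
  isOpen_ne.inter (isOpen_lt continuous_norm continuous_const)

theorem measurableSet_pball (l : ℝ) : MeasurableSet (pball l) := (isOpen_pball l).measurableSet

theorem pball_compl_ae (l : ℝ) :
    ((pball l)ᶜ : Set E3) =ᵐ[volume] {y : E3 | l < ‖y‖} := by
  have h1 : volume (Metric.sphere (0 : E3) l) = 0 := Measure.addHaar_sphere _ _ _
  have h2 : ∀ᵐ y : E3, y ∉ Metric.sphere (0 : E3) l := measure_eq_zero_iff_ae_notMem.1 h1
  filter_upwards [h2, Measure.ae_ne volume (0 : E3)] with y hy hy0
  rw [mem_sphere_zero_iff_norm] at hy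
  refine propext ⟨fun h => ?_, fun h h' => absurd h'.2 (not_lt.2 (le_of_lt h))⟩
  have : ¬ ‖y‖ < l := fun h' => h ⟨hy0, h'⟩
  exact lt_of_le_of_ne (not_lt.1 this) (Ne.symm hy)

theorem image_inv3_pball {l : ℝ} (hl : 0 < l) : inv3 l '' pball l = {y : E3 | l < ‖y‖} := by
  ext y
  constructor
  · rintro ⟨x, ⟨hx0, hx⟩, rfl⟩
    have := norm_pos_iff.2 hx0
    show l < ‖_‖
    rw [norm_inv3, lt_div_iff₀ this]
    nlinarith
  · intro hy
    have hy' : l < ‖y‖ := hy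
    have hy0 : y ≠ 0 := norm_pos_iff.1 (hl.trans hy')
    refine ⟨inv3 l y, ⟨inv3_ne_zero hl hy0, ?_⟩, inv3_inv3 hl y⟩
    rw [norm_inv3, div_lt_iff₀ (hl.trans hy')]
    nlinarith

noncomputable def inv3Deriv (l : ℝ) (x : E3) : E3 →L[ℝ] E3 :=
  (l / ‖x‖) ^ 2 • ((Submodule.span ℝ {x})ᗮ.reflection : E3 →L[ℝ] E3)

theorem hasFDerivAt_inv3 {l : ℝ} {x : E3} (hx : x ≠ 0) :
    HasFDerivAt (inv3 l) (inv3Deriv l x) x := by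
  have := EuclideanGeometry.hasFDerivAt_inversion (c := (0 : E3)) (R := l) hx
  rw [dist_zero_right, sub_zero] at this
  exact this

theorem abs_det_inv3Deriv (l : ℝ) (x : E3) : |(inv3Deriv l x).det| = (l / ‖x‖) ^ 6 := by
  have h : (inv3Deriv l x).det = ((l / ‖x‖) ^ 2) ^ 3 *
      LinearMap.det ((Submodule.span ℝ {x})ᗮ.reflection).toLinearMap := by
    have := LinearMap.det_smul ((l / ‖x‖) ^ 2) ((Submodule.span ℝ {x})ᗮ.reflection).toLinearMap
    rw [finrank_E3] at this
    exact this
  rw [h, Submodule.det_reflection, abs_mul, abs_pow (-1 : ℝ), abs_neg, abs_one, one_pow, mul_one,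
    abs_of_nonneg (by positivity)]
  ring

theorem injOn_inv3 {l : ℝ} (hl : 0 < l) (s : Set E3) : Set.InjOn (inv3 l) s :=
  (EuclideanGeometry.inversion_injective (0 : E3) hl.ne').injOn

theorem setIntegral_inversion {l : ℝ} (hl : 0 < l) (g : E3 → ℝ) :
    ∫ y in (pball l)ᶜ, g y = ∫ y in pball l, (l / ‖y‖) ^ 6 * g (inv3 l y) := by
  rw [setIntegral_congr_set (pball_compl_ae l), ← image_inv3_pball hl,
    integral_image_eq_integral_abs_det_fderiv_smul volume (measurableSet_pball l)
      (fun x hx => (hasFDerivAt_inv3 hx.1).hasFDerivWithinAt) (injOn_inv3 hl _)]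
  simp only [abs_det_inv3Deriv, smul_eq_mul]

theorem integrableOn_inversion {l : ℝ} (hl : 0 < l) {g : E3 → ℝ} (hg : Integrable g) :
    IntegrableOn (fun y => (l / ‖y‖) ^ 6 * g (inv3 l y)) (pball l) := by
  have := (integrableOn_image_iff_integrableOn_abs_det_fderiv_smul volume (measurableSet_pball l)
      (fun x hx => (hasFDerivAt_inv3 (l := l) hx.1).hasFDerivWithinAt) (injOn_inv3 hl _) g).1
      hg.integrableOn
  simpa only [abs_det_inv3Deriv, smul_eq_mul] using this

/-- The reflected logarithmic kernel. -/
noncomputable def refK (l : ℝ) (x y : E3) : ℝ :=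
  log ‖inv3 l x - y‖ - log ‖x - y‖ + (log ‖x‖ - log l)

theorem inv3_sub_ne_zero {l : ℝ} {x y : E3} (hx : x ∈ pball l) (hy : y ∈ pball l) :
    inv3 l x - y ≠ 0 := by
  have hl : 0 < l := (norm_nonneg x).trans_lt hx.2
  intro h
  have h1 : l < ‖inv3 l x‖ := (image_inv3_pball hl).subset ⟨x, hx, rfl⟩
  rw [sub_eq_zero.1 h] at h1
  exact absurd h1 (not_lt.2 hy.2.le)

theorem refK_inv3 {l : ℝ} {x y : E3} (hx : x ∈ pball l) (hy : y ∈ pball l) (hxy : x ≠ y) :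
    refK l x (inv3 l y) = -refK l x y := by
  have hl : 0 < l := (norm_nonneg x).trans_lt hx.2
  have hx0 := norm_pos_iff.2 hx.1
  have hy0 := norm_pos_iff.2 hy.1
  have h1 := EuclideanGeometry.dist_inversion_inversion hx.1 hy.1 l
  have h2 := EuclideanGeometry.dist_inversion_mul_dist_center_eq (R := l) hx.1 hy.1
  rw [dist_zero_right, dist_zero_right, dist_eq_norm, dist_eq_norm] at h1 h2
  change ‖inv3 l x - inv3 l y‖ = _ at h1
  change ‖inv3 l x - y‖ * ‖x‖ = ‖x - inv3 l y‖ * ‖y‖ at h2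
  have h3 : 0 < ‖inv3 l x - y‖ := norm_pos_iff.2 (inv3_sub_ne_zero hx hy)
  have h4 : 0 < ‖x - y‖ := norm_pos_iff.2 (sub_ne_zero.2 hxy)
  have h5 : ‖x - inv3 l y‖ = ‖inv3 l x - y‖ * ‖x‖ / ‖y‖ := by field_simp; linarith
  rw [refK, refK, h1, h5, log_mul (by positivity) h4.ne', log_div (by positivity) (by positivity),
    log_mul hx0.ne' hy0.ne', log_div (by positivity) hy0.ne', log_mul h3.ne' hx0.ne', log_pow]
  push_cast; ring

theorem refK_exp_sq {l : ℝ} {x y : E3} (hx : x ∈ pball l) (hy : y ∈ pball l) (hxy : x ≠ y) :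
    2 * refK l x y = log (1 + (l ^ 2 - ‖x‖ ^ 2) * (l ^ 2 - ‖y‖ ^ 2) / (l * ‖x - y‖) ^ 2) := by
  have hl : 0 < l := (norm_nonneg x).trans_lt hx.2
  have hx0 := norm_pos_iff.2 hx.1
  have h3 : 0 < ‖inv3 l x - y‖ := norm_pos_iff.2 (inv3_sub_ne_zero hx hy)
  have h4 : 0 < ‖x - y‖ := norm_pos_iff.2 (sub_ne_zero.2 hxy)
  have e1 : 1 + (l ^ 2 - ‖x‖ ^ 2) * (l ^ 2 - ‖y‖ ^ 2) / (l * ‖x - y‖) ^ 2 =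
      (‖inv3 l x - y‖ * ‖x‖ / (‖x - y‖ * l)) ^ 2 := by
    have a1 := norm_sub_sq_real (inv3 l x) y
    have a2 := norm_sub_sq_real x y
    rw [norm_inv3, inv3_eq, inner_smul_left] at a1
    simp only [RCLike.conj_to_real] at a1
    rw [div_pow, mul_pow (‖inv3 l x - y‖), inv3_eq, a1]
    field_simp
    rw [a2]
    ring
  rw [e1, log_pow, log_div (by positivity) (by positivity), log_mul h3.ne' hx0.ne',
    log_mul h4.ne' hl.ne', refK]
  push_cast; ring

theorem refK_pos {l : ℝ} {x y : E3} (hx : x ∈ pball l) (hy : y ∈ pball l) (hxy : x ≠ y) :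
    0 < refK l x y := by
  have hl : 0 < l := (norm_nonneg x).trans_lt hx.2
  have h4 : 0 < ‖x - y‖ := norm_pos_iff.2 (sub_ne_zero.2 hxy)
  have h1 : 0 < l ^ 2 - ‖x‖ ^ 2 := by have := hx.2; nlinarith [norm_nonneg x]
  have h2 : 0 < l ^ 2 - ‖y‖ ^ 2 := by have := hy.2; nlinarith [norm_nonneg y]
  have := log_pos (show 1 < 1 + (l ^ 2 - ‖x‖ ^ 2) * (l ^ 2 - ‖y‖ ^ 2) / (l * ‖x - y‖) ^ 2 by
    have : 0 < (l ^ 2 - ‖x‖ ^ 2) * (l ^ 2 - ‖y‖ ^ 2) / (l * ‖x - y‖) ^ 2 := by positivity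
    linarith)
  rw [← refK_exp_sq hx hy hxy] at this
  linarith

theorem refK_le {l : ℝ} {x y : E3} (hx : x ∈ pball l) (hy : y ∈ pball l) (hxy : x ≠ y) :
    refK l x y ≤ l * (1 / ‖x - y‖) := by
  have hl : 0 < l := (norm_nonneg x).trans_lt hx.2
  have h4 : 0 < ‖x - y‖ := norm_pos_iff.2 (sub_ne_zero.2 hxy)
  have h1 : 0 < l ^ 2 - ‖x‖ ^ 2 := by have := hx.2; nlinarith [norm_nonneg x]
  have h2 : 0 < l ^ 2 - ‖y‖ ^ 2 := by have := hy.2; nlinarith [norm_nonneg y]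
  set t := l * (1 / ‖x - y‖) with ht
  have ht0 : 0 < t := by positivity
  have h5 : (l ^ 2 - ‖x‖ ^ 2) * (l ^ 2 - ‖y‖ ^ 2) / (l * ‖x - y‖) ^ 2 ≤ t ^ 2 := by
    have : (l ^ 2 - ‖x‖ ^ 2) * (l ^ 2 - ‖y‖ ^ 2) ≤ l ^ 2 * l ^ 2 := by
      gcongr
      · linarith [sq_nonneg ‖x‖]
      · linarith [sq_nonneg ‖y‖]
    calc _ ≤ l ^ 2 * l ^ 2 / (l * ‖x - y‖) ^ 2 := by gcongr
      _ = t ^ 2 := by rw [ht]; field_simp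
  have h6 : 2 * refK l x y ≤ log ((1 + t) ^ 2) := by
    rw [refK_exp_sq hx hy hxy]
    exact log_le_log (by positivity) (by nlinarith)
  rw [log_pow] at h6
  have := log_le_sub_one_of_pos (show 0 < 1 + t by positivity)
  push_cast at h6
  linarith

theorem IsCrit.integrable_refK {f : E3 → ℝ} (h : IsCrit f) (l : ℝ) (x : E3) :
    Integrable fun y => exp (3 * f y) * refK l x y := by
  refine ((integrable_mul_log_sub_log h.cont_exp h.int x (inv3 l x)).add
    (h.int.mul_const (log ‖x‖ - log l))).congr (Eventually.of_forall fun y => ?_)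
  simp only [refK, Pi.add_apply]; ring

theorem IsCrit.ae_reflect {f : E3 → ℝ} {l : ℝ} {x : E3} (hx : x ∈ pball l) :
    ∀ᵐ y ∂(volume.restrict (pball l)),
      (l / ‖y‖) ^ 6 * (exp (3 * f (inv3 l y)) * refK l x (inv3 l y)) =
      -(refK l x y * exp (3 * kel l f y)) := by
  have hl : 0 < l := (norm_nonneg x).trans_lt hx.2
  filter_upwards [ae_restrict_mem (measurableSet_pball l),
    ae_restrict_of_ae (Measure.ae_ne volume x)] with y hy hyx
  rw [refK_inv3 hx hy (Ne.symm hyx), exp_kel hl f hy.1]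
  ring

theorem IsCrit.integrableOn_refK_kel {f : E3 → ℝ} (h : IsCrit f) {l : ℝ} {x : E3}
    (hx : x ∈ pball l) : IntegrableOn (fun y => refK l x y * exp (3 * kel l f y)) (pball l) := by
  have hl : 0 < l := (norm_nonneg x).trans_lt hx.2
  have := ((integrableOn_inversion hl (h.integrable_refK l x)).congr (ae_reflect hx)).neg
  refine this.congr (Eventually.of_forall fun y => ?_)
  simp

theorem IsCrit.integrableOn_refK_sub {f : E3 → ℝ} (h : IsCrit f) {l : ℝ} {x : E3}
    (hx : x ∈ pball l) :
    IntegrableOn (fun y => refK l x y * (exp (3 * f y) - exp (3 * kel l f y))) (pball l) := by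
  refine ((h.integrable_refK l x).integrableOn.sub (h.integrableOn_refK_kel hx)).congr
    (Eventually.of_forall fun y => ?_)
  simp only [Pi.sub_apply]; ring

theorem IsCrit.sub_kel {f : E3 → ℝ} (h : IsCrit f) {l : ℝ} {x : E3} (hx : x ∈ pball l) :
    f x - kel l f x =
      1 / π ^ 2 * ∫ y in pball l, refK l x y * (exp (3 * f y) - exp (3 * kel l f y)) := by
  have hl : 0 < l := (norm_nonneg x).trans_lt hx.2
  have hx0 := norm_pos_iff.2 hx.1
  have s1 : ∫ y, exp (3 * f y) * refK l x y =
      ∫ y in pball l, refK l x y * (exp (3 * f y) - exp (3 * kel l f y)) := by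
    have i1 : IntegrableOn (fun y => exp (3 * f y) * refK l x y) (pball l) :=
      (h.integrable_refK l x).integrableOn
    rw [← integral_add_compl (measurableSet_pball l) (h.integrable_refK l x),
      setIntegral_inversion hl, integral_congr_ae (ae_reflect hx), integral_neg, ← sub_eq_add_neg,
      ← integral_sub i1 (h.integrableOn_refK_kel hx)]
    refine integral_congr_ae (Eventually.of_forall fun y => ?_)
    simp only; ring
  have s2 : ∫ y, exp (3 * f y) * refK l x y =
      (∫ y, exp (3 * f y) * (log ‖inv3 l x - y‖ - log ‖x - y‖)) +
        2 * π ^ 2 * (log ‖x‖ - log l) := by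
    rw [← h.mass, ← integral_mul_const, ← integral_add
      (integrable_mul_log_sub_log h.cont_exp h.int x (inv3 l x)) (h.int.mul_const _)]
    congr 1; ext y; rw [refK]; ring
  rw [← s1, s2, mul_add, ← h.rep, kel, log_div hl.ne' hx0.ne']
  field_simp
  ring

/-- The Kelvin transform in the sphere of radius `l` dominates `f` inside that sphere. -/
def KelDominates (f : E3 → ℝ) (l : ℝ) : Prop := ∀ x ∈ pball l, f x ≤ kel l f x

def badSet (f : E3 → ℝ) (l : ℝ) : Set E3 := {y | y ∈ pball l ∧ kel l f y < f y}

theorem measurableSet_badSet {f : E3 → ℝ} (hf : Continuous f) {l : ℝ} (hl : 0 < l) :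
    MeasurableSet (badSet f l) := by
  have h : ContinuousOn (fun y => f y - kel l f y) (pball l) :=
    hf.continuousOn.sub ((continuousOn_kel hf hl).mono fun y hy => hy.1)
  have := (h.isOpen_inter_preimage (isOpen_pball l) (isOpen_Ioi (a := (0 : ℝ)))).measurableSet
  convert this using 1
  ext y
  simp [badSet, sub_pos]

theorem volume_pball_lt_top (l : ℝ) : volume (pball l) < ⊤ :=
  (measure_mono (t := Metric.ball (0 : E3) l)
    (fun y hy => by rw [mem_ball_zero_iff]; exact hy.2)).trans_lt measure_ball_lt_top

theorem volume_badSet_lt_top (f : E3 → ℝ) (l : ℝ) : volume (badSet f l) < ⊤ :=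
  (measure_mono fun _ hy => hy.1).trans_lt (volume_pball_lt_top l)

theorem inv_norm_le_split {r : ℝ} (hr : 0 < r) (hr1 : r ≤ 1) (z : E3) :
    1 / ‖z‖ ≤ 2 * r * (1 / (‖z‖ ^ 2 * (1 + ‖z‖ ^ 2))) + 1 / r := by
  rcases le_or_gt r ‖z‖ with h | h
  · have h1 : 1 / ‖z‖ ≤ 1 / r := one_div_le_one_div_of_le hr h
    have h2 : 0 ≤ 2 * r * (1 / (‖z‖ ^ 2 * (1 + ‖z‖ ^ 2))) := by positivity
    linarith
  · have h2 : 0 < 1 / r := by positivity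
    rcases (norm_nonneg z).eq_or_lt with h0 | h0
    · rw [← h0]; simp; positivity
    · have h1 : 1 / ‖z‖ ≤ 2 * r * (1 / (‖z‖ ^ 2 * (1 + ‖z‖ ^ 2))) := by
        rw [div_le_iff₀ h0]
        have e : 2 * r * (1 / (‖z‖ ^ 2 * (1 + ‖z‖ ^ 2))) * ‖z‖ = 2 * r / (‖z‖ * (1 + ‖z‖ ^ 2)) := by
          field_simp
        rw [e, le_div_iff₀ (by positivity)]
        nlinarith [mul_pos h0 h0]
      linarith

theorem integrable_inv_norm_on {S : Set E3} (hS : volume S < ⊤) (x : E3) :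
    IntegrableOn (fun y => 1 / ‖x - y‖) S := by
  have hb : IntegrableOn (fun y : E3 => 2 * 1 * (1 / (‖x - y‖ ^ 2 * (1 + ‖x - y‖ ^ 2))) + 1 / 1) S :=
    ((integrable_inv_sq_mul.comp_sub_left x).const_mul (2 * 1)).integrableOn.add
      (integrableOn_const hS.ne)
  refine hb.mono' (Measurable.aestronglyMeasurable (by fun_prop))
    (Eventually.of_forall fun y => ?_)
  rw [Real.norm_of_nonneg (by positivity)]
  exact inv_norm_le_split one_pos le_rfl (x - y)

theorem setIntegral_inv_norm_le {S : Set E3} (hS : volume S < ⊤) {r : ℝ}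
    (hr : 0 < r) (hr1 : r ≤ 1) (x : E3) :
    ∫ y in S, 1 / ‖x - y‖ ≤
      2 * r * (∫ z : E3, 1 / (‖z‖ ^ 2 * (1 + ‖z‖ ^ 2))) + volume.real S * (1 / r) := by
  have hi : Integrable (fun y : E3 => 2 * r * (1 / (‖x - y‖ ^ 2 * (1 + ‖x - y‖ ^ 2)))) :=
    (integrable_inv_sq_mul.comp_sub_left x).const_mul (2 * r)
  have hc : IntegrableOn (fun _ : E3 => 1 / r) S := integrableOn_const hS.ne
  have hic : IntegrableOn (fun y => 2 * r * (1 / (‖x - y‖ ^ 2 * (1 + ‖x - y‖ ^ 2))) + 1 / r) S :=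
    hi.integrableOn.add hc
  calc ∫ y in S, 1 / ‖x - y‖
      ≤ ∫ y in S, (2 * r * (1 / (‖x - y‖ ^ 2 * (1 + ‖x - y‖ ^ 2))) + 1 / r) :=
        integral_mono (integrable_inv_norm_on hS x) hic
          fun y => inv_norm_le_split hr hr1 (x - y)
    _ = (∫ y in S, 2 * r * (1 / (‖x - y‖ ^ 2 * (1 + ‖x - y‖ ^ 2)))) + volume.real S * (1 / r) := by
        rw [integral_add hi.integrableOn hc, setIntegral_const, smul_eq_mul]
    _ ≤ (∫ y : E3, 2 * r * (1 / (‖x - y‖ ^ 2 * (1 + ‖x - y‖ ^ 2)))) + volume.real S * (1 / r) := by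
        have := setIntegral_le_integral (s := S) hi (Eventually.of_forall fun y => by positivity)
        linarith
    _ = _ := by
        rw [integral_const_mul,
          integral_sub_left_eq_self (fun z : E3 => 1 / (‖z‖ ^ 2 * (1 + ‖z‖ ^ 2))) volume x]

theorem exp_sub_exp_le (a b : ℝ) : exp a - exp b ≤ exp a * (a - b) := by
  have h1 := add_one_le_exp (b - a)
  have h2 : exp b = exp a * exp (b - a) := by rw [← exp_add]; ring_nf
  rw [h2]
  nlinarith [exp_pos a]

theorem IsCrit.kel_diff_bdd {f : E3 → ℝ} (h : IsCrit f) {l : ℝ} (hl : 0 < l) :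
    ∃ B, ∀ x ∈ pball l, f x - kel l f x ≤ B := by
  obtain ⟨C, hC⟩ := h.lower
  obtain ⟨D, hD⟩ := (isCompact_closedBall (0 : E3) l).exists_bound_of_continuousOn
    h.cont.continuousOn
  refine ⟨D - C + 2 * log (1 + l), fun x hx => ?_⟩
  have hx0 := norm_pos_iff.2 hx.1
  have h1 := (le_abs_self _).trans (hD x (by simpa using hx.2.le))
  have h2 := hC (inv3 l x)
  have h3 : log (1 + ‖inv3 l x‖) ≤ log (l / ‖x‖) + log (1 + l) := by
    rw [← log_mul (by positivity) (by positivity), norm_inv3]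
    refine log_le_log (by positivity) ?_
    have : l / ‖x‖ * (1 + l) = l / ‖x‖ + l ^ 2 / ‖x‖ := by field_simp
    rw [this]
    gcongr
    rw [one_le_div hx0]; exact hx.2.le
  rw [kel]
  linarith

theorem IsCrit.halve {f : E3 → ℝ} (h : IsCrit f) {l C : ℝ} (hl : 0 < l)
    (hC : ∀ x ∈ pball l, exp (3 * f x) ≤ C)
    (hS : ∀ x ∈ pball l, 3 * C / π ^ 2 * l * ∫ y in badSet f l, 1 / ‖x - y‖ ≤ 1 / 2)
    {B : ℝ} (hB0 : 0 ≤ B) (hB : ∀ x ∈ pball l, f x - kel l f x ≤ B) :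
    ∀ x ∈ pball l, f x - kel l f x ≤ B / 2 := by
  intro x hx
  have hm := measurableSet_badSet h.cont hl
  have hC0 : 0 ≤ C := (exp_pos _).le.trans (hC x hx)
  have hi : IntegrableOn (fun y => 3 * C * B * l * (1 / ‖x - y‖)) (badSet f l) :=
    (integrable_inv_norm_on (volume_badSet_lt_top f l) x).const_mul _
  have key : ∫ y in pball l, refK l x y * (exp (3 * f y) - exp (3 * kel l f y)) ≤
      ∫ y in badSet f l, 3 * C * B * l * (1 / ‖x - y‖) := by
    rw [← integral_indicator (measurableSet_pball l), ← integral_indicator hm]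
    refine integral_mono_ae ((h.integrableOn_refK_sub hx).integrable_indicator
      (measurableSet_pball l)) (hi.integrable_indicator hm) ?_
    filter_upwards [Measure.ae_ne volume x] with y hyx
    by_cases hy : y ∈ pball l
    · rw [Set.indicator_of_mem hy]
      have k0 := (refK_pos hx hy (Ne.symm hyx)).le
      by_cases hb : kel l f y < f y
      · rw [Set.indicator_of_mem (show y ∈ badSet f l from ⟨hy, hb⟩)]
        have e1 := exp_sub_exp_le (3 * f y) (3 * kel l f y)
        have e2 : exp (3 * f y) * (3 * f y - 3 * kel l f y) ≤ C * (3 * B) := by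
          refine mul_le_mul (hC y hy) (by linarith [hB y hy]) (by linarith) hC0
        calc _ ≤ refK l x y * (C * (3 * B)) := mul_le_mul_of_nonneg_left (e1.trans e2) k0
          _ ≤ l * (1 / ‖x - y‖) * (C * (3 * B)) :=
            mul_le_mul_of_nonneg_right (refK_le hx hy (Ne.symm hyx)) (by positivity)
          _ = _ := by ring
      · rw [Set.indicator_of_notMem (show y ∉ badSet f l from fun h' => hb h'.2)]
        push Not at hb
        have : exp (3 * f y) ≤ exp (3 * kel l f y) := exp_le_exp.2 (by linarith)
        exact mul_nonpos_of_nonneg_of_nonpos k0 (by linarith)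
    · rw [Set.indicator_of_notMem hy,
        Set.indicator_of_notMem (show y ∉ badSet f l from fun h' => hy h'.1)]
  rw [h.sub_kel hx]
  rw [integral_const_mul] at key
  calc _ ≤ 1 / π ^ 2 * (3 * C * B * l * ∫ y in badSet f l, 1 / ‖x - y‖) := by gcongr
    _ = B * (3 * C / π ^ 2 * l * ∫ y in badSet f l, 1 / ‖x - y‖) := by ring
    _ ≤ B * (1 / 2) := mul_le_mul_of_nonneg_left (hS x hx) hB0
    _ = B / 2 := by ring

theorem IsCrit.kelDominates_of_integral_le {f : E3 → ℝ} (h : IsCrit f) {l C : ℝ} (hl : 0 < l)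
    (hC : ∀ x ∈ pball l, exp (3 * f x) ≤ C)
    (hS : ∀ x ∈ pball l, 3 * C / π ^ 2 * l * ∫ y in badSet f l, 1 / ‖x - y‖ ≤ 1 / 2) :
    KelDominates f l := by
  obtain ⟨B, hB⟩ := h.kel_diff_bdd hl
  have hn : ∀ n : ℕ, ∀ x ∈ pball l, f x - kel l f x ≤ |B| * (1 / 2) ^ n := fun n => by
    induction n with
    | zero => exact fun x hx => by simpa using (hB x hx).trans (le_abs_self B)
    | succ n ih =>
      intro x hx
      have := h.halve hl hC hS (by positivity) ih x hx
      rw [pow_succ]; linarith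
  intro x hx
  have ht : Tendsto (fun n : ℕ => |B| * (1 / 2 : ℝ) ^ n) atTop (𝓝 (|B| * 0)) :=
    (tendsto_pow_atTop_nhds_zero_of_lt_one (by norm_num) (by norm_num)).const_mul _
  have := ge_of_tendsto' ht fun n => hn n x hx
  linarith

theorem IsCrit.exists_volume_threshold {f : E3 → ℝ} (h : IsCrit f) {L : ℝ} (hL : 0 < L) :
    ∃ ε > 0, ∀ l, 0 < l → l ≤ L → volume.real (badSet f l) ≤ ε → KelDominates f l := by
  obtain ⟨D, hD⟩ := (isCompact_closedBall (0 : E3) L).exists_bound_of_continuousOn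
    h.cont_exp.continuousOn
  have hD0 : 0 < D := (norm_pos_iff.2 (exp_pos _).ne').trans_le (hD 0 (by simpa using hL.le))
  set I := ∫ z : E3, 1 / (‖z‖ ^ 2 * (1 + ‖z‖ ^ 2)) with hI
  have hI0 : 0 ≤ I := integral_nonneg fun z => by positivity
  set K := 3 * D / π ^ 2 * L with hK
  have hK0 : 0 < K := by positivity
  set r := min 1 (1 / (8 * K * (I + 1))) with hr
  have hr0 : 0 < r := lt_min one_pos (by positivity)
  have hr1 : r ≤ 1 := min_le_left _ _
  have hr2 : r * (8 * K * (I + 1)) ≤ 1 := by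
    rw [← le_div_iff₀ (by positivity)]; exact min_le_right _ _
  refine ⟨r / (4 * K), by positivity, fun l hl hlL hv => ?_⟩
  refine h.kelDominates_of_integral_le hl (C := D) (fun x hx => ?_) fun x hx => ?_
  · exact (le_abs_self _).trans (hD x (by simpa using (hx.2.le.trans hlL)))
  · have h1 := setIntegral_inv_norm_le (volume_badSet_lt_top f l) hr0 hr1 x
    rw [← hI] at h1
    have h2 : volume.real (badSet f l) * (1 / r) ≤ 1 / (4 * K) := by
      calc _ ≤ r / (4 * K) * (1 / r) := by gcongr
        _ = _ := by field_simp
    have h0 : 0 ≤ ∫ y in badSet f l, 1 / ‖x - y‖ := integral_nonneg fun y => by positivity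
    calc 3 * D / π ^ 2 * l * ∫ y in badSet f l, 1 / ‖x - y‖
        ≤ K * (2 * r * I + 1 / (4 * K)) := by
          refine mul_le_mul ?_ (h1.trans (by linarith)) h0 hK0.le
          rw [hK]; gcongr
      _ = (r * (8 * K * I)) / 4 + 1 / 4 := by field_simp; ring
      _ ≤ 1 / 2 := by nlinarith [mul_pos hr0 hK0]

theorem IsCrit.eventually_kelDominates {f : E3 → ℝ} (h : IsCrit f) {l₀ : ℝ} (hl₀ : 0 ≤ l₀)
    (hlt : ∀ x ∈ pball l₀, f x < kel l₀ f x) : ∀ᶠ l in 𝓝[>] l₀, KelDominates f l := by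
  obtain ⟨ε, hε, H⟩ := h.exists_volume_threshold (L := l₀ + 1) (by linarith)
  have hnear : ∀ᶠ l in 𝓝[>] l₀, l₀ < l ∧ l < l₀ + 1 := Ioo_mem_nhdsGT (by linarith)
  have hlim : Tendsto (fun l => ∫ y, (badSet f l).indicator (fun _ => (1 : ℝ)) y) (𝓝[>] l₀)
      (𝓝 (∫ _ : E3, (0 : ℝ))) := by
    refine tendsto_integral_filter_of_dominated_convergence
      ((pball (l₀ + 1)).indicator fun _ => (1 : ℝ)) ?_ ?_ ?_ ?_
    · filter_upwards [hnear] with l hl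
      exact (measurable_const.indicator
        (measurableSet_badSet h.cont (hl₀.trans_lt hl.1))).aestronglyMeasurable
    · filter_upwards [hnear] with l hl
      refine Eventually.of_forall fun y => ?_
      rw [Real.norm_of_nonneg (Set.indicator_nonneg (fun _ _ => zero_le_one) _)]
      have hsub : badSet f l ⊆ pball (l₀ + 1) := fun y hy => ⟨hy.1.1, hy.1.2.trans hl.2⟩
      exact Set.indicator_le_indicator_of_subset hsub (fun _ => zero_le_one) y
    · exact (integrable_indicator_iff (measurableSet_pball _)).2
        (integrableOn_const (volume_pball_lt_top _).ne)
    · have h1 : volume (Metric.sphere (0 : E3) l₀) = 0 := Measure.addHaar_sphere _ _ _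
      filter_upwards [measure_eq_zero_iff_ae_notMem.1 h1, Measure.ae_ne volume (0 : E3)] with y hy hy0
      rw [mem_sphere_zero_iff_norm] at hy
      refine tendsto_const_nhds.congr' ?_
      rcases lt_or_gt_of_ne hy with h2 | h2
      · have h3 : ContinuousAt (fun l => kel l f y) l₀ :=
          (continuousAt_kel h.cont ((norm_nonneg y).trans_lt h2) hy0).comp
            (f := fun l : ℝ => (l, y)) (by fun_prop)
        filter_upwards [(h3.eventually (lt_mem_nhds (hlt y ⟨hy0, h2⟩))).filter_mono
          nhdsWithin_le_nhds] with l hl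
        rw [Set.indicator_of_notMem fun h' => absurd h'.2 (not_lt.2 (le_of_lt hl))]
      · filter_upwards [(gt_mem_nhds h2).filter_mono nhdsWithin_le_nhds] with l hl
        rw [Set.indicator_of_notMem fun h' => absurd h'.1.2 (not_lt.2 (le_of_lt hl))]
  rw [integral_zero] at hlim
  filter_upwards [hnear, hlim.eventually (gt_mem_nhds hε)] with l hl hv
  refine H l (hl₀.trans_lt hl.1) hl.2.le ?_
  rw [integral_indicator_const _ (measurableSet_badSet h.cont (hl₀.trans_lt hl.1)), smul_eq_mul, mul_one] at hv
  exact hv.le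

theorem IsCrit.eq_or_lt_kel {f : E3 → ℝ} (h : IsCrit f) {l : ℝ} (hl : 0 < l)
    (hd : KelDominates f l) :
    (∀ x ∈ pball l, f x = kel l f x) ∨ ∀ x ∈ pball l, f x < kel l f x := by
  by_contra hc
  push Not at hc
  obtain ⟨⟨x₁, hx₁, hne⟩, x, hx, hle⟩ := hc
  have h0 : f x - kel l f x = 0 := by linarith [hd x hx]
  rw [h.sub_kel hx, mul_eq_zero] at h0
  have h1 : ∫ y in pball l, refK l x y * (exp (3 * f y) - exp (3 * kel l f y)) = 0 :=
    h0.resolve_left (by positivity)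
  have h2 : ∫ y in pball l, -(refK l x y * (exp (3 * f y) - exp (3 * kel l f y))) = 0 := by
    rw [integral_neg, h1, neg_zero]
  have h3 : ∀ᵐ y ∂(volume.restrict (pball l)), y ∈ pball l ∧ y ≠ x :=
    (ae_restrict_mem (measurableSet_pball l)).and (ae_restrict_of_ae (Measure.ae_ne volume x))
  have hi : IntegrableOn (fun y => -(refK l x y * (exp (3 * f y) - exp (3 * kel l f y))))
    (pball l) := (h.integrableOn_refK_sub hx).neg
  rw [integral_eq_zero_iff_of_nonneg_ae ?_ hi] at h2
  · have h4 : f =ᵐ[volume.restrict (pball l)] kel l f := by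
      filter_upwards [h2, h3] with y hy hy'
      have k0 := (refK_pos hx hy'.1 (Ne.symm hy'.2)).ne'
      simp only [Pi.zero_apply, neg_eq_zero, mul_eq_zero, k0, false_or, sub_eq_zero] at hy
      have := exp_injective hy
      linarith
    have h5 := Measure.eqOn_open_of_ae_eq h4 (isOpen_pball l) h.cont.continuousOn
      ((continuousOn_kel h.cont hl).mono fun y hy => hy.1)
    exact hne (h5 hx₁)
  · filter_upwards [h3] with y hy
    have k0 := (refK_pos hx hy.1 (Ne.symm hy.2)).le
    have : exp (3 * f y) ≤ exp (3 * kel l f y) := exp_le_exp.2 (by linarith [hd y hy.1])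
    have := mul_nonneg k0 (sub_nonneg.2 this)
    simp only [Pi.zero_apply]
    linarith

theorem isClosed_kelDominates {f : E3 → ℝ} (hf : Continuous f) {a b : ℝ} (ha : 0 < a) :
    IsClosed ({l | KelDominates f l} ∩ Set.Icc a b) := by
  refine isClosed_of_closure_subset fun l hl => ?_
  have hlI : l ∈ Set.Icc a b := closure_minimal Set.inter_subset_right isClosed_Icc hl
  refine ⟨fun x hx => ?_, hlI⟩
  by_contra hc
  push Not at hc
  have h3 : ContinuousAt (fun l => kel l f x) l :=
    (continuousAt_kel hf (ha.trans_le hlI.1) hx.1).comp (f := fun l : ℝ => (l, x)) (by fun_prop)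
  rw [mem_closure_iff_frequently] at hl
  obtain ⟨l', ⟨hl', -⟩, h4, h5⟩ := (hl.and_eventually ((h3.eventually (gt_mem_nhds hc)).and
    (lt_mem_nhds hx.2))).exists
  exact absurd (hl' x ⟨hx.1, h5⟩) (not_le.2 h4)

/-- Moving spheres: either some sphere about the origin is a sphere of symmetry, or all spheres
can be reached. -/
theorem IsCrit.moving_spheres {f : E3 → ℝ} (h : IsCrit f) :
    (∃ l > 0, ∀ x ∈ pball l, f x = kel l f x) ∨ ∀ l > 0, KelDominates f l := by
  refine or_iff_not_imp_left.2 fun hno L hL => ?_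
  push Not at hno
  have hstep : ∀ l > 0, KelDominates f l → ∀ᶠ l' in 𝓝[>] l, KelDominates f l' := fun l hl hd =>
    h.eventually_kelDominates hl.le ((h.eq_or_lt_kel hl hd).resolve_left fun h' => by
      obtain ⟨x, hx, hne⟩ := hno l hl
      exact hne (h' x hx))
  have h0 : ∀ᶠ l in 𝓝[>] 0, KelDominates f l := h.eventually_kelDominates le_rfl fun x hx =>
    absurd hx.2 (not_lt.2 (norm_nonneg x))
  obtain ⟨a, hda, ha0, haL⟩ := (h0.and (Ioo_mem_nhdsGT hL)).exists
  have := (isClosed_kelDominates h.cont (b := L) ha0).Icc_subset_of_forall_mem_nhdsWithin hda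
    fun l hl => hstep l (ha0.trans_le hl.2.1) hl.1
  exact this ⟨haL.le, le_rfl⟩

/-- `f` is invariant under the Kelvin transform in the sphere of centre `c` and radius `l`. -/
def SymAt (f : E3 → ℝ) (c : E3) (l : ℝ) : Prop :=
  ∀ x, x ≠ 0 → f (x + c) = f (inv3 l x + c) + 2 * log (l / ‖x‖)

theorem symAt_of_eq_kel {f : E3 → ℝ} {c : E3} {l : ℝ} (hl : 0 < l)
    (h : ∀ x ∈ pball l, f (x + c) = kel l (fun x => f (x + c)) x) : SymAt f c l := by
  intro x hx
  have hx0 := norm_pos_iff.2 hx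
  rcases lt_trichotomy ‖x‖ l with h1 | h1 | h1
  · exact h x ⟨hx, h1⟩
  · rw [inv3_eq, ← h1, div_self hx0.ne', one_pow, one_smul, log_one]; ring
  · have h2 : inv3 l x ∈ pball l := ⟨inv3_ne_zero hl hx, by
      rw [norm_inv3, div_lt_iff₀ hx0]; nlinarith⟩
    have h3 := h _ h2
    rw [kel, inv3_inv3 hl, norm_inv3] at h3
    have h4 : l / (l ^ 2 / ‖x‖) = (l / ‖x‖)⁻¹ := by field_simp
    rw [h4, log_inv] at h3
    linarith

theorem not_kelDominates_of_symAt {f : E3 → ℝ} (hf : Continuous f) {c₀ c : E3} {l₀ : ℝ}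
    (hl₀ : 0 < l₀) (hs : SymAt f c₀ l₀) (hd : ∀ l > 0, KelDominates (fun x => f (x + c)) l) :
    False := by
  obtain ⟨M₁, hM₁⟩ := (isCompact_closedBall (0 : E3) 1).exists_bound_of_continuousOn
    (f := fun x => f (x + c₀)) (hf.comp (continuous_id.add continuous_const)).continuousOn
  obtain ⟨M₂, hM₂⟩ := (isCompact_closedBall (0 : E3) 1).exists_bound_of_continuousOn
    (f := fun x => f (x + c)) (hf.comp (continuous_id.add continuous_const)).continuousOn
  set l := exp (M₁ + M₂ + log l₀ + log 2) with hl
  have hM0 : 0 ≤ M₁ + M₂ := add_nonneg ((norm_nonneg _).trans (hM₁ 0 (by simp)))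
    ((norm_nonneg _).trans (hM₂ 0 (by simp)))
  set L := exp (M₁ + M₂ + log l₀ + log 2 + 1) with hL
  have hL0 : 0 < L := exp_pos _
  obtain ⟨x, hx⟩ := NormedSpace.exists_lt_norm ℝ E3 (L + L ^ 2 + 2 * ‖c - c₀‖ + 2 * l₀ ^ 2)
  have hc0 := norm_nonneg (c - c₀)
  have hx0 : 0 < ‖x‖ := by nlinarith [sq_nonneg L, sq_nonneg l₀]
  set y := x + (c - c₀) with hy
  have hy1 : ‖x‖ / 2 ≤ ‖y‖ := by
    have := norm_sub_le y (c - c₀)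
    rw [hy, add_sub_cancel_right, ← hy] at this
    nlinarith [sq_nonneg L, sq_nonneg l₀]
  have hy0 : 0 < ‖y‖ := by linarith
  have e1 : f (x + c) = f (inv3 l₀ y + c₀) + 2 * log (l₀ / ‖y‖) := by
    rw [← hs y (norm_pos_iff.1 hy0)]
    congr 1; rw [hy]; abel
  have hX : inv3 L x ∈ pball L := ⟨inv3_ne_zero hL0 (norm_pos_iff.1 hx0), by
    rw [norm_inv3, div_lt_iff₀ hx0]; nlinarith [sq_nonneg l₀]⟩
  have e2 := hd L hL0 _ hX
  rw [kel, inv3_inv3 hL0, norm_inv3] at e2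
  have h4 : L / (L ^ 2 / ‖x‖) = ‖x‖ / L := by field_simp
  rw [h4, log_div hx0.ne' hL0.ne', e1, log_div hl₀.ne' hy0.ne'] at e2
  have b1 := (le_abs_self _).trans (hM₁ (inv3 l₀ y) (by
    rw [mem_closedBall_zero_iff, norm_inv3, div_le_one hy0]; nlinarith [sq_nonneg L]))
  have b2 := (neg_le_abs _).trans (hM₂ (inv3 L x) (by
    rw [mem_closedBall_zero_iff, norm_inv3, div_le_one hx0]; nlinarith [sq_nonneg l₀]))
  have b3 : log ‖x‖ ≤ log ‖y‖ + log 2 := by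
    rw [← log_mul hy0.ne' two_ne_zero]
    exact log_le_log hx0 (by linarith)
  rw [hL, log_exp] at e2
  linarith

theorem le_of_kelDominates {f : E3 → ℝ} (h : ∀ c, ∀ l > 0, KelDominates (fun x => f (x + c)) l)
    (a b : E3) : f a ≤ f b := by
  rcases eq_or_ne a b with rfl | hab
  · exact le_rfl
  refine le_of_forall_pos_le_add fun ε hε => ?_
  set d := a - b with hd
  have hd0 : 0 < ‖d‖ := norm_pos_iff.2 (sub_ne_zero.2 hab)
  set r := 1 / ε with hr
  have hr0 : 0 < r := by positivity
  set l := √(r * (r + 1)) * ‖d‖ with hl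
  have hl0 : 0 < l := by positivity
  have hl2 : l ^ 2 = r * (r + 1) * ‖d‖ ^ 2 := by
    rw [hl, mul_pow, sq_sqrt (by positivity)]
  set x : E3 := -(r • d) with hx
  have hxn : ‖x‖ = r * ‖d‖ := by rw [hx, norm_neg, norm_smul, Real.norm_of_nonneg hr0.le]
  have hx0 : 0 < ‖x‖ := by rw [hxn]; positivity
  have hxl : ‖x‖ < l := by
    refine lt_of_pow_lt_pow_left₀ 2 hl0.le ?_
    rw [hl2, hxn, mul_pow]
    have : 0 < r * ‖d‖ ^ 2 := by positivity
    nlinarith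
  have e2 : (l / ‖x‖) ^ 2 = (r + 1) / r := by
    rw [div_pow, hl2, hxn]; field_simp
  have key := h (b + (r + 1) • d) l hl0 x ⟨norm_pos_iff.1 hx0, hxl⟩
  rw [kel, inv3_eq, e2] at key
  have a1 : x + (b + (r + 1) • d) = a := by rw [hx, add_smul, one_smul, hd]; abel
  have a2 : ((r + 1) / r) • x + (b + (r + 1) • d) = b := by
    rw [hx, smul_neg, smul_smul, div_mul_cancel₀ _ hr0.ne']; abel
  simp only [a1, a2] at key
  have e3 : 2 * log (l / ‖x‖) = log ((r + 1) / r) := by rw [← e2, log_pow]; push_cast; ring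
  have e4 : log ((r + 1) / r) ≤ ε := by
    have := log_le_sub_one_of_pos (show 0 < (r + 1) / r by positivity)
    have e5 : (r + 1) / r - 1 = ε := by rw [hr]; field_simp; ring
    linarith
  linarith

theorem not_integrable_const_exp (t : ℝ) : ¬ Integrable fun _ : E3 => exp (3 * t) := by
  intro h
  rw [integrable_const_iff] at h
  rcases h with h | h
  · exact (exp_pos _).ne' h
  · have := h.measure_univ_lt_top
    rw [measure_univ_of_isAddLeftInvariant] at this
    exact lt_irrefl _ this

theorem IsCrit.exists_symAt {f : E3 → ℝ} (h : IsCrit f) (c : E3) : ∃ l > 0, SymAt f c l := by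
  have hms : ∀ c, (∃ l > 0, SymAt f c l) ∨ ∀ l > 0, KelDominates (fun x => f (x + c)) l :=
    fun c => (h.translate c).moving_spheres.imp_left fun ⟨l, hl, H⟩ =>
      ⟨l, hl, symAt_of_eq_kel hl H⟩
  by_cases hex : ∃ c₀, ∃ l > 0, SymAt f c₀ l
  · obtain ⟨c₀, l₀, hl₀, hs⟩ := hex
    exact (hms c).resolve_right fun hd => not_kelDominates_of_symAt h.cont hl₀ hs hd
  · push Not at hex
    have hd : ∀ c, ∀ l > 0, KelDominates (fun x => f (x + c)) l := fun c =>
      (hms c).resolve_left fun ⟨l, hl, H⟩ => hex c l hl H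
    have hc : ∀ x, f x = f 0 := fun x =>
      le_antisymm (le_of_kelDominates hd x 0) (le_of_kelDominates hd 0 x)
    have := h.int
    simp only [hc] at this
    exact absurd this (not_integrable_const_exp _)

theorem exp_symAt {f : E3 → ℝ} {c : E3} {l : ℝ} (hl : 0 < l) (h : SymAt f c l) {x : E3}
    (hx : x ≠ 0) : exp (-f (x + c)) = exp (-f (c + inv3 l x)) * (‖x‖ ^ 2 / l ^ 2) := by
  have hx0 := norm_pos_iff.2 hx
  have e : -f (x + c) = -f (c + inv3 l x) + log ((‖x‖ / l) ^ 2) := by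
    rw [h x hx, add_comm c, log_div hl.ne' hx0.ne', log_pow, log_div hx0.ne' hl.ne']
    push_cast; ring
  rw [e, exp_add, exp_log (by positivity), div_pow]

/-- Second-order expansion at infinity of `e^{-f}` along rays. -/
theorem SymAt.expansion {f : E3 → ℝ} (hf : Differentiable ℝ fun x => exp (-f x)) {c : E3} {l : ℝ}
    (hl : 0 < l) (h : SymAt f c l) {e : E3} (he : e ≠ 0) :
    Tendsto (fun t : ℝ => (exp (-f (t • e)) - exp (-f c) / l ^ 2 * ‖t • e - c‖ ^ 2 -
      fderiv ℝ (fun x => exp (-f x)) c (t • e - c)) / t) atTop (𝓝 0) := by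
  have he0 := norm_pos_iff.2 he
  set F : E3 → ℝ := fun x => exp (-f x) with hF
  have ho := hasFDerivAt_iff_isLittleO_nhds_zero.1 (hf c).hasFDerivAt
  have hinf : Tendsto (fun t : ℝ => ‖t • e - c‖) atTop atTop := by
    refine tendsto_atTop_mono' (f₁ := fun t => t * ‖e‖ - ‖c‖) _ ?_
      (tendsto_atTop_add_const_right _ _ (tendsto_id.atTop_mul_const he0))
    filter_upwards [eventually_ge_atTop 0] with t ht
    have := norm_sub_norm_le (t • e) c
    rwa [norm_smul, Real.norm_of_nonneg ht] at this
  have h0 : Tendsto (fun t : ℝ => inv3 l (t • e - c)) atTop (𝓝 0) := by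
    rw [tendsto_zero_iff_norm_tendsto_zero]
    simp only [norm_inv3]
    exact hinf.const_div_atTop (l ^ 2)
  rw [Metric.tendsto_nhds]
  intro ε hε
  set K := ‖e‖ + ‖c‖ + 1 with hK
  have hK0 : 0 < K := by positivity
  have hb := h0.eventually (ho.def (show 0 < ε / (2 * K) by positivity))
  filter_upwards [hb, hinf.eventually_gt_atTop 0, eventually_ge_atTop 1] with t ht hx0 ht1
  set x := t • e - c with hx
  have ht0 : 0 < t := by linarith
  have hxne : x ≠ 0 := norm_pos_iff.1 hx0
  have e1 : F (t • e) = F (c + inv3 l x) * (‖x‖ ^ 2 / l ^ 2) := by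
    rw [← exp_symAt hl h hxne, hx, sub_add_cancel]
  have e2 : F (t • e) - F c / l ^ 2 * ‖x‖ ^ 2 - fderiv ℝ F c x =
      ‖x‖ ^ 2 / l ^ 2 * (F (c + inv3 l x) - F c - fderiv ℝ F c (inv3 l x)) := by
    rw [e1]
    have : fderiv ℝ F c (inv3 l x) = (l / ‖x‖) ^ 2 * fderiv ℝ F c x := by
      rw [inv3_eq, map_smul, smul_eq_mul]
    rw [this]; field_simp
  have hxt : ‖x‖ ≤ K * t := by
    have := norm_sub_le (t • e) c
    rw [norm_smul, Real.norm_of_nonneg ht0.le] at this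
    nlinarith [norm_nonneg c, norm_nonneg e]
  rw [dist_zero_right]
  change ‖(F (t • e) - F c / l ^ 2 * ‖x‖ ^ 2 - fderiv ℝ F c x) / t‖ < ε
  rw [e2, norm_div, norm_mul, Real.norm_of_nonneg ht0.le, div_lt_iff₀ ht0,
    Real.norm_of_nonneg (show 0 ≤ ‖x‖ ^ 2 / l ^ 2 by positivity)]
  calc _ ≤ ‖x‖ ^ 2 / l ^ 2 * (ε / (2 * K) * ‖inv3 l x‖) := by gcongr
    _ = ε / (2 * K) * ‖x‖ := by rw [norm_inv3]; field_simp
    _ ≤ ε / (2 * K) * (K * t) := by gcongr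
    _ = ε / 2 * t := by field_simp
    _ < ε * t := by nlinarith

theorem coeffs_eq_zero {a b c : ℝ} (h : Tendsto (fun t : ℝ => (a * t ^ 2 + b * t + c) / t) atTop (𝓝 0)) :
    a = 0 ∧ b = 0 := by
  have hi : Tendsto (fun t : ℝ => t⁻¹) atTop (𝓝 0) := tendsto_inv_atTop_zero
  have h1 : Tendsto (fun t : ℝ => a + b * t⁻¹ + c * (t⁻¹ * t⁻¹)) atTop
      (𝓝 (a + b * 0 + c * (0 * 0))) :=
    (tendsto_const_nhds.add (hi.const_mul b)).add ((hi.mul hi).const_mul c)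
  have h2 := h.mul hi
  have ha : a + b * 0 + c * (0 * 0) = 0 * 0 := tendsto_nhds_unique h1 (h2.congr' (by
    filter_upwards [eventually_gt_atTop 0] with t ht
    field_simp))
  have ha0 : a = 0 := by simpa using ha
  subst ha0
  have h3 : Tendsto (fun t : ℝ => b + c * t⁻¹) atTop (𝓝 (b + c * 0)) :=
    tendsto_const_nhds.add (hi.const_mul c)
  have hb : b + c * 0 = 0 := tendsto_nhds_unique h3 (h.congr' (by
    filter_upwards [eventually_gt_atTop 0] with t ht
    field_simp; ring))
  exact ⟨rfl, by simpa using hb⟩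

theorem SymAt.compare {f : E3 → ℝ} (hf : Differentiable ℝ fun x => exp (-f x)) {c : E3} {l l₀ : ℝ}
    (hl : 0 < l) (hl₀ : 0 < l₀) (h : SymAt f c l) (h₀ : SymAt f 0 l₀) {e : E3} (he : e ≠ 0) :
    exp (-f c) / l ^ 2 = exp (-f 0) / l₀ ^ 2 ∧
    fderiv ℝ (fun x => exp (-f x)) c e =
      fderiv ℝ (fun x => exp (-f x)) 0 e + 2 * (exp (-f 0) / l₀ ^ 2) * inner ℝ c e := by
  have he0 := norm_pos_iff.2 he
  set β := exp (-f c) / l ^ 2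
  set β₀ := exp (-f 0) / l₀ ^ 2
  set D := fderiv ℝ (fun x => exp (-f x)) c
  set D₀ := fderiv ℝ (fun x => exp (-f x)) 0
  have h1 := (h₀.expansion hf hl₀ he).sub (h.expansion hf hl he)
  rw [sub_zero] at h1
  have h2 := coeffs_eq_zero (a := (β - β₀) * ‖e‖ ^ 2) (b := D e - D₀ e - 2 * β * inner ℝ c e)
    (c := β * ‖c‖ ^ 2 - D c) (h1.congr fun t => by
      rw [← sub_div]
      congr 1
      change (_ - β₀ * ‖t • e - 0‖ ^ 2 - D₀ (t • e - 0)) - (_ - β * ‖t • e - c‖ ^ 2 - D (t • e - c)) = _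
      rw [sub_zero, norm_sub_sq_real, norm_smul, map_sub, map_smul, map_smul, inner_smul_left,
        mul_pow, Real.norm_eq_abs, sq_abs, real_inner_comm]
      simp only [RCLike.conj_to_real, smul_eq_mul]
      ring)
  have h3 : β = β₀ := by
    have := (mul_eq_zero.1 h2.1).resolve_right (by positivity)
    linarith
  refine ⟨h3, ?_⟩
  rw [← h3]
  linarith [h2.2]

theorem eq_quadratic_of_fderiv {F : E3 → ℝ} (hF : Differentiable ℝ F) {β : ℝ} (hβ : β ≠ 0)
    (h : ∀ c e, fderiv ℝ F c e = fderiv ℝ F 0 e + 2 * β * inner ℝ c e) :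
    ∃ p, ∀ x, F x = β * ‖x - p‖ ^ 2 + F p := by
  set v := (InnerProductSpace.toDual ℝ E3).symm (fderiv ℝ F 0) with hv
  have hve : ∀ e, fderiv ℝ F 0 e = inner ℝ v e := fun e =>
    (InnerProductSpace.toDual_symm_apply).symm
  set p : E3 := -((1 / (2 * β)) • v) with hp
  refine ⟨p, fun x => ?_⟩
  have hd : ∀ c, HasFDerivAt (fun x => F x - β * ‖x - p‖ ^ 2) (0 : E3 →L[ℝ] ℝ) c := fun c => by
    have h1 : HasFDerivAt (fun x : E3 => ‖x - p‖ ^ 2) (2 • innerSL ℝ (c - p)) c := by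
      have := (hasStrictFDerivAt_norm_sq (c - p)).hasFDerivAt.comp c
        ((hasFDerivAt_id c).sub_const p)
      exact this
    refine ((hF c).hasFDerivAt.sub (h1.const_mul β)).congr_fderiv ?_
    ext1 e
    have h2 := h c e
    rw [hve] at h2
    simp only [_root_.sub_apply, _root_.smul_apply, innerSL_apply_apply, _root_.zero_apply, h2]
    rw [hp, sub_neg_eq_add, inner_add_left, inner_smul_left]
    simp only [RCLike.conj_to_real, smul_eq_mul, nsmul_eq_mul]
    push_cast
    field_simp
    ring
  have hc := is_const_of_fderiv_eq_zero (𝕜 := ℝ) (fun c => (hd c).differentiableAt)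
    (fun c => (hd c).fderiv) x p
  simp only [sub_self, norm_zero] at hc
  linarith

theorem integral_inv_quadratic_cube {d k : ℝ} (hd : 0 < d) (hk : 0 < k) :
    ∫ z : E3, 1 / (d * (1 + k ^ 2 * ‖z‖ ^ 2)) ^ 3 = π ^ 2 / (4 * (d * k) ^ 3) := by
  rw [integral_radial fun r => 1 / (d * (1 + k ^ 2 * r ^ 2)) ^ 3]
  have hA : ∀ r ∈ Set.Ioi (0:ℝ), HasDerivAt
      (fun r => 1 / (8 * (d * k) ^ 3) *
        (arctan (k * r) + ((k * r) ^ 3 - k * r) / ((k * r) ^ 2 + 1) ^ 2))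
      (r ^ 2 * (1 / (d * (1 + k ^ 2 * r ^ 2)) ^ 3)) r := fun r _ => by
    have h1 : HasDerivAt (fun r : ℝ => k * r) k r := by simpa using (hasDerivAt_id r).const_mul k
    have h2 := h1.arctan
    have h3 := ((h1.pow 3).sub h1).div (((h1.pow 2).add_const 1).pow 2)
      (by positivity : ((k * r) ^ 2 + 1) ^ 2 ≠ 0)
    refine ((h2.add h3).const_mul (1 / (8 * (d * k) ^ 3))).congr_deriv ?_
    have e1 : 1 + k ^ 2 * r ^ 2 ≠ 0 := by positivity
    simp only [Pi.pow_apply, Pi.sub_apply, Nat.cast_ofNat]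
    norm_num
    field_simp
    ring
  have hi : Tendsto (fun r : ℝ => k * r) atTop atTop := tendsto_id.const_mul_atTop hk
  have h1 : Tendsto (fun s : ℝ => (s ^ 3 - s) / (s ^ 2 + 1) ^ 2) atTop (𝓝 0) := by
    refine squeeze_zero_norm' ?_ tendsto_inv_atTop_zero
    filter_upwards [eventually_ge_atTop 1] with s hs
    rw [norm_div, Real.norm_of_nonneg (show 0 ≤ s ^ 3 - s by nlinarith [sq_nonneg s]),
      Real.norm_of_nonneg (by positivity), div_le_iff₀ (by positivity), inv_mul_eq_div,
      le_div_iff₀ (by positivity)]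
    nlinarith [sq_nonneg s]
  have hB : Tendsto (fun r => 1 / (8 * (d * k) ^ 3) *
        (arctan (k * r) + ((k * r) ^ 3 - k * r) / ((k * r) ^ 2 + 1) ^ 2)) atTop
      (𝓝 (1 / (8 * (d * k) ^ 3) * (π / 2 + 0))) :=
    (((tendsto_arctan_atTop.mono_right nhdsWithin_le_nhds).comp hi).add (h1.comp hi)).const_mul _
  have h0 : Tendsto (fun r => 1 / (8 * (d * k) ^ 3) *
        (arctan (k * r) + ((k * r) ^ 3 - k * r) / ((k * r) ^ 2 + 1) ^ 2)) (𝓝[>] 0) (𝓝 0) := by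
    have hc : Continuous (fun r => 1 / (8 * (d * k) ^ 3) *
        (arctan (k * r) + ((k * r) ^ 3 - k * r) / ((k * r) ^ 2 + 1) ^ 2)) := by
      have : ∀ r : ℝ, ((k * r) ^ 2 + 1) ^ 2 ≠ 0 := fun r => by positivity
      have ha : Continuous fun r => arctan (k * r) :=
        continuous_arctan.comp (continuous_const.mul continuous_id)
      exact continuous_const.mul (ha.add (Continuous.div (by fun_prop) (by fun_prop) this))
    have := (hc.tendsto 0).mono_left (nhdsWithin_le_nhds (s := Set.Ioi 0))
    simpa using this
  rw [(Ioi_ftc_nonneg hA (fun r _ => by positivity) h0 hB).2]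
  field_simp
  ring

theorem IsCrit.isSpherical {f : E3 → ℝ} (h : IsCrit f) : IsSpherical f := by
  have hF : Differentiable ℝ fun x => exp (-f x) := h.diff.neg.exp
  obtain ⟨l₀, hl₀, h₀⟩ := h.exists_symAt 0
  set β := exp (-f 0) / l₀ ^ 2 with hβ
  have hβ0 : 0 < β := by positivity
  obtain ⟨p, hp⟩ := eq_quadratic_of_fderiv hF hβ0.ne' fun c e => by
    rcases eq_or_ne e 0 with rfl | he
    · simp
    · obtain ⟨l, hl, hs⟩ := h.exists_symAt c
      exact (hs.compare hF hl hl₀ h₀ he).2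
  set d := exp (-f p) with hd
  have hd0 : 0 < d := exp_pos _
  set k := √(β / d) with hk
  have hk0 : 0 < k := sqrt_pos.2 (by positivity)
  have hk2 : k ^ 2 * d = β := by rw [hk, sq_sqrt (by positivity)]; field_simp
  have hf : ∀ x, exp (-f x) = d * (1 + k ^ 2 * ‖x - p‖ ^ 2) := fun x => by
    rw [hp, ← hk2]; ring
  have hm := h.mass
  have e3 : ∀ x, exp (3 * f x) = 1 / (d * (1 + k ^ 2 * ‖x - p‖ ^ 2)) ^ 3 := fun x => by
    rw [← hf, ← exp_nat_mul, one_div, ← exp_neg]; push_cast; ring_nf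
  rw [integral_congr_ae (Eventually.of_forall e3),
    integral_sub_right_eq_self (fun z : E3 => 1 / (d * (1 + k ^ 2 * ‖z‖ ^ 2)) ^ 3) p,
    integral_inv_quadratic_cube hd0 hk0] at hm
  have hdk : d * k = 1 / 2 := by
    have h8 : (d * k) ^ 3 = (1 / 2) ^ 3 := by
      field_simp at hm
      have hq : 1 = d ^ 3 * k ^ 3 * 8 := by nlinarith
      rw [mul_pow]; linarith
    exact (pow_left_inj₀ (by positivity) (by norm_num) (by norm_num)).1 h8
  refine ⟨k, hk0, p, fun x => ?_⟩
  have e4 : 2 * k / (1 + k ^ 2 * ‖x - p‖ ^ 2) = exp (f x) := by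
    have : exp (f x) = (exp (-f x))⁻¹ := by rw [exp_neg, inv_inv]
    have hd' : d = 1 / (2 * k) := by field_simp; linarith
    rw [this, hf, hd']
    field_simp
  rw [e4, log_exp]

theorem IsSolution.exists_isRep {u : E3 → ℝ} (hu : IsSolution u) : ∃ c, IsRep u c := by
  obtain ⟨hs, hL, hi, hw⟩ := hu
  have hs2 : ContDiff ℝ 2 u := contDiff_infty.1 hs 2
  have hriesz := riesz_representation (continuous_lap hs2).neg
    (by simpa only [Pi.neg_apply, abs_neg] using hL.2)
    (by have := hs2.continuous; fun_prop) hi hw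
  refine ⟨-lap u 0 - 1 / π ^ 2 * ∫ y, exp (3 * u y) * (1 / ‖0 - y‖ ^ 2), hs2, hi, fun x => ?_⟩
  have := hriesz x 0
  simp only [Pi.neg_apply] at this
  rw [mul_sub] at this
  linarith

/-- Theorem 5: if `u` is a non-spherical smooth finite-volume solution of
`(−Δ)^{3/2}u = 2e^{3u}`, then there is a constant `a > 0` with `Δu(x) → −a` as `|x| → ∞`. -/
theorem laplacian_limit_of_nonspherical (u : E3 → ℝ) (hu : IsSolution u)
    (hns : ¬ IsSpherical u) :
    ∃ a : ℝ, 0 < a ∧ Filter.Tendsto (fun x : E3 => lap u x)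
      (Filter.comap (fun x : E3 => ‖x‖) Filter.atTop) (𝓝 (-a)) := by
  obtain ⟨c, h⟩ := hu.exists_isRep
  rcases h.nonneg.eq_or_lt with rfl | hc
  · exact absurd h.isCrit.isSpherical hns
  · exact ⟨c, hc, h.tendsto_lap⟩
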